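/- Let B be a block of the completed group algebra k⟦G⟧ of a profinite group G, with non-trivial cyclic defect group D. Then the set of isomorphism classes of simple B-modules is finite (in fact of cardinality at most p − 1), and hence the set of isomorphism classes of indecomposable projective B-modules is finite. -/

import Mathlib

open scoped Classical
set_option maxHeartbeats 1000000
set_option synthInstance.maxHeartbeats 400000

noncomputable section

namespace ProfiniteBlocks

variable (k : Type) [Field k] (G : Type) [Group G] [TopologicalSpace G]

/-- Discrete topology on each finite level group algebra. -/
instance (X : Type) : TopologicalSpace (MonoidAlgebra k X) := ⊥

/-- The canonical quotient homomorphism `G/N → G/M` for `N ≤ M`. -/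
def qHom (N M : OpenNormalSubgroup G) (h : N ≤ M) :
    G ⧸ N.toSubgroup →* G ⧸ M.toSubgroup :=
  QuotientGroup.map _ _ (MonoidHom.id G) (fun x hx => h hx)

/-- The induced algebra homomorphism `k[G/N] → k[G/M]` for `N ≤ M`. -/
def tHom (N M : OpenNormalSubgroup G) (h : N ≤ M) :
    MonoidAlgebra k (G ⧸ N.toSubgroup) →ₐ[k] MonoidAlgebra k (G ⧸ M.toSubgroup) :=
  MonoidAlgebra.mapDomainAlgHom k k (qHom G N M h)

/-- The completed group algebra `k⟦G⟧`, realized as the inverse limit of the finite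
level group algebras `k[G/N]` over all open normal subgroups `N` of `G`, sitting inside
their product. -/
def CGA : Subalgebra k (∀ N : OpenNormalSubgroup G, MonoidAlgebra k (G ⧸ N.toSubgroup)) where
  carrier := {x | ∀ (N M : OpenNormalSubgroup G) (h : N ≤ M), tHom k G N M h (x N) = x M}
  add_mem' hx hy N M h := by simp [map_add, hx N M h, hy N M h]
  mul_mem' hx hy N M h := by simp [map_mul, hx N M h, hy N M h]
  algebraMap_mem' r N M h := by
    simp [tHom, MonoidAlgebra.mapDomainAlgHom, MonoidAlgebra.mapDomainRingHom,
      Finsupp.mapDomain_single]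

instance : Ring (CGA k G) := inferInstance
instance : Algebra k (CGA k G) := inferInstance

/-- `k⟦G⟧` carries the inverse limit topology (each `k[G/N]` being discrete). -/
instance : TopologicalSpace (CGA k G) := inferInstanceAs (TopologicalSpace (Subtype _))

/-- The canonical (continuous) inclusion of `G` into `k⟦G⟧`. -/
def ofG : G →* CGA k G where
  toFun g := ⟨fun N => MonoidAlgebra.single ((g : G) : G ⧸ N.toSubgroup) 1, by
    intro N M h
    simp [tHom, MonoidAlgebra.mapDomainAlgHom, MonoidAlgebra.mapDomainRingHom,
      Finsupp.mapDomain_single, qHom, QuotientGroup.map_mk]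
    rfl⟩
  map_one' := by
    ext N
    simp [MonoidAlgebra.one_def]
  map_mul' g g' := by
    ext N
    simp [MonoidAlgebra.single_mul_single]


/-- The map between quotient modules induced by `f` (the canonical map whenever
`f` carries `P` into `Q`). -/
def mapQ' {R X Y : Type} [Ring R] [AddCommGroup X] [AddCommGroup Y] [Module R X]
    [Module R Y] (P : Submodule R X) (Q : Submodule R Y) (f : X →ₗ[R] Y) :
    (X ⧸ P) →ₗ[R] (Y ⧸ Q) :=
  if h : P ≤ Q.comap f then Submodule.mapQ P Q f h else 0

/-- The map between submodules induced by `f` (the canonical restriction whenever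
`f` carries `P` into `Q`). -/
def restrict' {R X Y : Type} [Ring R] [AddCommGroup X] [AddCommGroup Y] [Module R X]
    [Module R Y] (P : Submodule R X) (Q : Submodule R Y) (f : X →ₗ[R] Y) :
    P →ₗ[R] Q :=
  if h : ∀ x ∈ P, f x ∈ Q then f.restrict h else 0

/-- The subquotient `W / W'` of a module. -/
abbrev subQuot {R X : Type} [Ring R] [AddCommGroup X] [Module R X]
    (W W' : Submodule R X) : Type :=
  W ⧸ (W'.comap W.subtype)

/-- The radical of a topological module: the intersection of its maximal open
submodules. -/
def radical (R : Type) [Ring R] (X : Type) [AddCommGroup X] [Module R X]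
    [TopologicalSpace X] : Submodule R X :=
  sInf {W : Submodule R X | IsCoatom W ∧ IsOpen (W : Set X)}

/-- Iterated radicals `Rad^i(X)`, with `Rad^0(X) = X`. -/
def radPow (R : Type) [Ring R] (X : Type) [AddCommGroup X] [Module R X]
    [TopologicalSpace X] : ℕ → Submodule R X
  | 0 => ⊤
  | (n + 1) => (radical R (radPow R X n)).map (radPow R X n).subtype

/-- A topological module is semisimple if every closed submodule has a closed
complement. -/
def IsSemisimpleTop (R : Type) [Ring R] (X : Type) [AddCommGroup X] [Module R X]
    [TopologicalSpace X] : Prop :=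
  ∀ W : Submodule R X, IsClosed (W : Set X) →
    ∃ W' : Submodule R X, IsClosed (W' : Set X) ∧ IsCompl W W'

/-- The socle of a topological module: the largest closed semisimple submodule
(defined as the join of all closed semisimple submodules). -/
def socle (R : Type) [Ring R] (X : Type) [AddCommGroup X] [Module R X]
    [TopologicalSpace X] : Submodule R X :=
  sSup {W : Submodule R X | IsClosed (W : Set X) ∧ IsSemisimpleTop R W}

/-- A module is uniserial if its submodules form a chain. -/
def Uniserial (R : Type) [Ring R] (X : Type) [AddCommGroup X] [Module R X] : Prop :=
  ∀ W W' : Submodule R X, W ≤ W' ∨ W' ≤ W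

/-- A topological module is (topologically) indecomposable if it is non-zero and
admits no non-trivial decomposition into closed direct summands. -/
def IsIndecTop (R : Type) [Ring R] (X : Type) [AddCommGroup X] [Module R X]
    [TopologicalSpace X] : Prop :=
  Nontrivial X ∧ ∀ W W' : Submodule R X, IsClosed (W : Set X) → IsClosed (W' : Set X) →
    IsCompl W W' → W = ⊥ ∨ W' = ⊥

/-- The inverse limit of a compatible system of modules indexed by a preorder,
realized as the submodule of compatible families in the product. -/
def compatLim {ι : Type} [Preorder ι] {R : Type} [Ring R] (T : ι → Type)
    [∀ i, AddCommGroup (T i)] [∀ i, Module R (T i)]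
    (t : ∀ i j, i ≤ j → (T i →ₗ[R] T j)) : Submodule R (∀ i, T i) where
  carrier := {f | ∀ (i j : ι) (h : i ≤ j), t i j h (f i) = f j}
  add_mem' ha hb i j h := by simp only [Pi.add_apply, map_add]; rw [ha i j h, hb i j h]
  zero_mem' i j h := by simp
  smul_mem' c a ha i j h := by simp only [Pi.smul_apply, map_smul]; rw [ha i j h]

/-- `X` has exactly `n` composition factors (measured along the radical series). -/
def HasNFactors (R : Type) [Ring R] (X : Type) [AddCommGroup X] [Module R X]
    [TopologicalSpace X] (n : ℕ) : Prop :=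
  radPow R X n = ⊥ ∧ ∀ m < n, radPow R X m ≠ ⊥

/-- `X` has infinitely many composition factors. -/
def HasInfFactors (R : Type) [Ring R] (X : Type) [AddCommGroup X] [Module R X]
    [TopologicalSpace X] : Prop :=
  ∀ n : ℕ, radPow R X n ≠ ⊥



section Coinvariants

variable {k : Type} [Field k] {G : Type} [Group G] [TopologicalSpace G]

variable (k G) in
/-- The (closed) submodule `I_N U` of a topological `k⟦G⟧`-module `U`: the smallest
closed submodule containing all elements `n • u - u` for `n ∈ N`.  Its quotient is the
module of `N`-coinvariants. -/
def coinvKer (N : OpenNormalSubgroup G) (U : Type) [AddCommGroup U]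
    [Module (CGA k G) U] [TopologicalSpace U] : Submodule (CGA k G) U :=
  sInf {W : Submodule (CGA k G) U | IsClosed (W : Set U) ∧
    ∀ n ∈ N.toSubgroup, ∀ u : U, ofG k G n • u - u ∈ W}

variable (k G) in
/-- The module of `N`-coinvariants `U_N` of a topological `k⟦G⟧`-module `U`. -/
abbrev coinv (N : OpenNormalSubgroup G) (U : Type) [AddCommGroup U]
    [Module (CGA k G) U] [TopologicalSpace U] : Type :=
  U ⧸ coinvKer k G N U

variable (k G) in
/-- The canonical projection `φ_N : U → U_N`. -/
def phi (N : OpenNormalSubgroup G) (U : Type) [AddCommGroup U]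
    [Module (CGA k G) U] [TopologicalSpace U] : U →ₗ[CGA k G] coinv k G N U :=
  (coinvKer k G N U).mkQ

lemma coinvKer_mono {N M : OpenNormalSubgroup G} (h : N ≤ M) (U : Type) [AddCommGroup U]
    [Module (CGA k G) U] [TopologicalSpace U] : coinvKer k G N U ≤ coinvKer k G M U :=
  sInf_le_sInf (fun W hW => ⟨hW.1, fun n hn u => hW.2 n (h hn) u⟩)

variable (k G) in
/-- The canonical projection `φ_{MN} : U_N → U_M` for `N ≤ M`. -/
def phiT (N M : OpenNormalSubgroup G) (h : N ≤ M) (U : Type) [AddCommGroup U]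
    [Module (CGA k G) U] [TopologicalSpace U] :
    coinv k G N U →ₗ[CGA k G] coinv k G M U :=
  Submodule.mapQ _ _ LinearMap.id (fun _ hx => coinvKer_mono h U hx)

variable (k G) in
/-- `N` acts trivially on the `k⟦G⟧`-module `W`. -/
def NTrivial (N : OpenNormalSubgroup G) (W : Type) [AddCommGroup W]
    [Module (CGA k G) W] : Prop :=
  ∀ n ∈ N.toSubgroup, ∀ w : W, ofG k G n • w = w

end Coinvariants

section Pseudocompact

variable (k : Type) [Field k]

/-- A pseudocompact module over a topological `k`-algebra `A`: a Hausdorff topological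
module possessing a basis of neighbourhoods of `0` consisting of open submodules of
finite codimension which intersect in `0`, and which is the inverse limit of the
corresponding discrete quotients. -/
structure IsPseudocompactMod (A : Type) [Ring A] [Algebra k A] [TopologicalSpace A]
    (X : Type) [AddCommGroup X] [Module k X] [Module A X] [IsScalarTower k A X]
    [TopologicalSpace X] : Prop where
  t2 : T2Space X
  addGroup : IsTopologicalAddGroup X
  contSMul : ContinuousSMul A X
  basis : (nhds (0 : X)).HasBasis
    (fun V : Submodule A X => IsOpen (V : Set X) ∧
      FiniteDimensional k (X ⧸ V.restrictScalars k))
    (fun V => (V : Set X))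
  inf_bot : (⨅ (V : Submodule A X) (_ : IsOpen (V : Set X) ∧
      FiniteDimensional k (X ⧸ V.restrictScalars k)), V) = ⊥
  complete : ∀ c : ∀ V : {V : Submodule A X // IsOpen (V : Set X) ∧
      FiniteDimensional k (X ⧸ V.restrictScalars k)}, X ⧸ V.1,
    (∀ (V W : {V : Submodule A X // IsOpen (V : Set X) ∧
        FiniteDimensional k (X ⧸ V.restrictScalars k)}), V.1 ≤ W.1 →
      mapQ' V.1 W.1 LinearMap.id (c V) = c W) →
    ∃ x : X, ∀ V, c V = Submodule.Quotient.mk x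

end Pseudocompact

section Blocks

variable (R : Type) [Ring R]

/-- A block idempotent: a centrally primitive idempotent of `R`. -/
structure IsBlockIdem (e : R) : Prop where
  idem : IsIdempotentElem e
  ne_zero : e ≠ 0
  central : e ∈ Set.center R
  primitive : ∀ f g : R, f ∈ Set.center R → g ∈ Set.center R → IsIdempotentElem f →
    IsIdempotentElem g → f * g = 0 → g * f = 0 → e = f + g → f = 0 ∨ g = 0

/-- The block `B = Re` determined by a central idempotent `e`, as a left `R`-module. -/
def blockMod (e : R) (he : e ∈ Set.center R) : Submodule R R where
  carrier := {a : R | a * e = a}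
  add_mem' := by intro a b ha hb; simp only [Set.mem_setOf_eq, add_mul] at *; rw [ha, hb]
  zero_mem' := by simp
  smul_mem' := by
    intro c a ha
    simp only [Set.mem_setOf_eq, smul_eq_mul, mul_assoc] at *
    rw [ha]

/-- A module belongs to the block of the central idempotent `e` if `e` acts as the
identity on it. -/
def InBlock {X : Type} [AddCommGroup X] [Module R X] (e : R) : Prop :=
  ∀ x : X, e • x = x

end Blocks

section Defect

variable {k : Type} [Field k] {G : Type} [Group G] [TopologicalSpace G]

variable (k G) in
/-- The conjugation action of `G` on `k⟦G⟧`. -/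
def conjAct (g : G) (x : CGA k G) : CGA k G :=
  ofG k G g * x * ofG k G g⁻¹

variable (k G) in
/-- The `H`-fixed points of `k⟦G⟧` under conjugation. -/
def fixedBy (H : Subgroup G) : Set (CGA k G) :=
  {x : CGA k G | ∀ h ∈ H, conjAct k G h x = x}

variable (k G) in
/-- The relative trace map `Tr_H^G` on `k⟦G⟧` (a finite sum over coset
representatives when `H` is open). -/
def trMap (H : Subgroup G) (x : CGA k G) : CGA k G :=
  ∑ᶠ c : G ⧸ H, conjAct k G (Quotient.out c) x

variable (k G) in
/-- The image `Tr_H^G(k⟦G⟧^H)`. -/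
def trImage (H : Subgroup G) : Set (CGA k G) :=
  trMap k G H '' fixedBy k G H

variable (k G) in
/-- `D` satisfies the defect property for `e`:
`e ∈ ⋂_N Tr_{DN}^G (k⟦G⟧^{DN})`. -/
def DefectProp (e : CGA k G) (D : Subgroup G) : Prop :=
  ∀ N : OpenNormalSubgroup G, e ∈ trImage k G (D ⊔ N.toSubgroup)

variable (k G) in
/-- `D` is a defect group of the block of `e`: a closed subgroup, minimal subject to
the defect property. -/
structure IsDefectGroup (e : CGA k G) (D : Subgroup G) : Prop where
  closed : IsClosed (D : Set G)
  defect : DefectProp k G e D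
  minimal : ∀ D' : Subgroup G, IsClosed ((D' : Set G)) → D' ≤ D →
    DefectProp k G e D' → D' = D

end Defect

section FiniteDefect

variable (k : Type) [Field k] (Q : Type) [Group Q]

/-- Conjugation on a finite level group algebra `k[Q]`. -/
def conjActF (q : Q) (x : MonoidAlgebra k Q) : MonoidAlgebra k Q :=
  MonoidAlgebra.single q 1 * x * MonoidAlgebra.single q⁻¹ 1

/-- `H`-fixed points of `k[Q]` under conjugation. -/
def fixedByF (H : Subgroup Q) : Set (MonoidAlgebra k Q) :=
  {x | ∀ h ∈ H, conjActF k Q h x = x}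

/-- The relative trace map `Tr_H^Q` on `k[Q]`. -/
def trMapF (H : Subgroup Q) (x : MonoidAlgebra k Q) : MonoidAlgebra k Q :=
  ∑ᶠ c : Q ⧸ H, conjActF k Q (Quotient.out c) x

/-- The image `Tr_H^Q(k[Q]^H)`. -/
def trImageF (H : Subgroup Q) : Set (MonoidAlgebra k Q) :=
  trMapF k Q H '' fixedByF k Q H

/-- `Dq` is a defect group of the block of `e` in the group algebra `k[Q]`. -/
structure IsDefectGroupF (e : MonoidAlgebra k Q) (Dq : Subgroup Q) : Prop where
  defect : e ∈ trImageF k Q Dq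
  minimal : ∀ D' : Subgroup Q, D' ≤ Dq → e ∈ trImageF k Q D' → D' = Dq

end FiniteDefect

section CyclicDefect

variable {k : Type} [Field k] {G : Type} [Group G] [TopologicalSpace G]

variable (G) in
/-- A subgroup is procyclic if it possesses a dense cyclic (abstract) subgroup. -/
def IsProcyclic (D : Subgroup G) : Prop :=
  ∃ g : G, closure ((Subgroup.zpowers g : Subgroup G) : Set G) = (D : Set G)

variable (G) in
/-- `D` is isomorphic, as a topological group, to the `p`-adic integers `ℤ_p`. -/
def IsZpGroup (p : ℕ) [Fact p.Prime] (D : Subgroup G) : Prop :=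
  ∃ φ : D ≃ₜ Multiplicative ℤ_[p], ∀ x y : D, φ (x * y) = φ x * φ y

variable (G) in
/-- `D` is a cyclic pro-`p` group: either a finite cyclic `p`-group or `ℤ_p`. -/
def IsCyclicProP (p : ℕ) [Fact p.Prime] (D : Subgroup G) : Prop :=
  (Finite D ∧ IsPGroup p D ∧ IsCyclic D) ∨ IsZpGroup G p D

end CyclicDefect

section Simples

variable {k : Type} [Field k] {G : Type} [Group G] [TopologicalSpace G]

variable (k G) in
/-- The projection `k⟦G⟧ → k[G/N]`. -/
def projN (N : OpenNormalSubgroup G) (x : CGA k G) :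
    MonoidAlgebra k (G ⧸ N.toSubgroup) :=
  (x : ∀ N : OpenNormalSubgroup G, MonoidAlgebra k (G ⧸ N.toSubgroup)) N

variable (k G) in
/-- `N` acts trivially on every simple module of the block of `e`. -/
def TrivOnSimples (e : CGA k G) (N : OpenNormalSubgroup G) : Prop :=
  ∀ (S : Type) [AddCommGroup S] [Module (CGA k G) S],
    IsSimpleModule (CGA k G) S → InBlock (CGA k G) (X := S) e → NTrivial k G N S

variable (k G) in
/-- Membership of `N` in the standard cofinal system `𝒩` for the block `B` of `e`
with defect group `D`: the coinvariant algebra `B_N` is a block of `k[G/N]` with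
defect group `DN/N`, and `N` acts trivially on every simple `B`-module. -/
structure GoodN (e : CGA k G) (D : Subgroup G) (N : OpenNormalSubgroup G) : Prop where
  blockN : IsBlockIdem (MonoidAlgebra k (G ⧸ N.toSubgroup)) (projN k G N e)
  defectN : IsDefectGroupF k (G ⧸ N.toSubgroup) (projN k G N e)
    (D.map (QuotientGroup.mk' N.toSubgroup))
  triv : TrivOnSimples k G e N

/-- A cofinal set of open normal subgroups. -/
def IsCofinal {G : Type} [Group G] [TopologicalSpace G]
    (𝒩 : Set (OpenNormalSubgroup G)) : Prop :=
  ∀ M : OpenNormalSubgroup G, ∃ N ∈ 𝒩, N ≤ M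

variable (k G) in
/-- A pseudocompact module is pro-uniserial (w.r.t. the cofinal system `𝒩`) if all
its coinvariant quotients at members of `𝒩` are uniserial. -/
def ProUniserial (𝒩 : Set (OpenNormalSubgroup G)) (U : Type) [AddCommGroup U]
    [Module (CGA k G) U] [TopologicalSpace U] : Prop :=
  ∀ N ∈ 𝒩, Uniserial (CGA k G) (coinv k G N U)

variable (k G) in
/-- `S` is a composition factor of the pseudocompact module `U`: it is a composition
factor of some finite coinvariant quotient `U_N`. -/
def IsCompFactorOf (U : Type) [AddCommGroup U] [Module (CGA k G) U]
    [TopologicalSpace U] (S : Type) [AddCommGroup S] [Module (CGA k G) S] : Prop :=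
  ∃ (N : OpenNormalSubgroup G) (W W' : Submodule (CGA k G) (coinv k G N U)),
    W' ≤ W ∧ Nonempty (subQuot W W' ≃ₗ[CGA k G] S)

variable (k G) in
/-- `S` is a composition factor of the finite-dimensional module `X`. -/
def IsCompFactorFin (X : Type) [AddCommGroup X] [Module (CGA k G) X]
    (S : Type) [AddCommGroup S] [Module (CGA k G) S] : Prop :=
  ∃ W W' : Submodule (CGA k G) X, W' ≤ W ∧ Nonempty (subQuot W W' ≃ₗ[CGA k G] S)

end Simples

section Projective

variable {k : Type} [Field k] {G : Type} [Group G] [TopologicalSpace G]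

variable (k G) in
/-- A pseudocompact `k⟦G⟧`-module is (categorically) projective if every continuous
surjection onto it from a pseudocompact module splits. -/
def IsPCProjective (P : Type) [AddCommGroup P] [Module (CGA k G) P]
    [TopologicalSpace P] : Prop :=
  ∀ (W : Type) [AddCommGroup W] [Module k W] [Module (CGA k G) W]
    [IsScalarTower k (CGA k G) W] [TopologicalSpace W],
    IsPseudocompactMod k (CGA k G) W →
    ∀ f : W →ₗ[CGA k G] P, Continuous f → Function.Surjective f →
      ∃ s : P →ₗ[CGA k G] W, Continuous s ∧ f.comp s = LinearMap.id

variable (k G) in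
/-- `P` is a projective cover of the simple module `S` in the block of `e`:
a pseudocompact projective module of the block together with a surjection onto `S`
whose kernel is superfluous (contained in the radical). -/
structure IsProjCover (e : CGA k G) (P : Type) [AddCommGroup P] [Module k P]
    [Module (CGA k G) P] [IsScalarTower k (CGA k G) P] [TopologicalSpace P]
    (S : Type) [AddCommGroup S] [Module (CGA k G) S] : Prop where
  pseudocompact : IsPseudocompactMod k (CGA k G) P
  inBlock : InBlock (CGA k G) (X := P) e
  projective : IsPCProjective k G P
  cover : ∃ π : P →ₗ[CGA k G] S, Function.Surjective π ∧
    LinearMap.ker π ≤ radical (CGA k G) P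

end Projective




/-- The map between subquotients induced by `f`. -/
def subQuotMap {R X Y : Type} [Ring R] [AddCommGroup X] [AddCommGroup Y] [Module R X]
    [Module R Y] (W W' : Submodule R X) (V V' : Submodule R Y) (f : X →ₗ[R] Y) :
    subQuot W W' →ₗ[R] subQuot V V' :=
  mapQ' (W'.comap W.subtype) (V'.comap V.subtype) (restrict' W V f)

/-- The conditions of Proposition 3.8 on a pair of pro-uniserial submodules `X`, `Y`
of an indecomposable projective `P`: `X ∩ Y = Soc(P)`, `X + Y = Rad(P)`, and
`Rad(P)/Soc(P) ≅ X/Soc(P) ⊕ Y/Soc(P)` with no common composition factors. -/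
def ProUniserialPair (k : Type) [Field k] (G : Type) [Group G] [TopologicalSpace G]
    (𝒩 : Set (OpenNormalSubgroup G)) (P : Type) [AddCommGroup P]
    [Module (CGA k G) P] [TopologicalSpace P]
    (X Y : Submodule (CGA k G) P) : Prop :=
  ProUniserial k G 𝒩 X ∧ ProUniserial k G 𝒩 Y ∧
  X ⊓ Y = socle (CGA k G) P ∧
  X ⊔ Y = radical (CGA k G) P ∧
  Nonempty ((subQuot (radical (CGA k G) P) (socle (CGA k G) P)) ≃ₗ[CGA k G]
    (subQuot X (socle (CGA k G) P) × subQuot Y (socle (CGA k G) P))) ∧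
  ∀ (T : Type) [AddCommGroup T] [Module (CGA k G) T], IsSimpleModule (CGA k G) T →
    ¬ (IsCompFactorOf k G (subQuot X (socle (CGA k G) P)) T ∧
       IsCompFactorOf k G (subQuot Y (socle (CGA k G) P)) T)

/-- `S : ι → Type` is a complete set of pairwise non-isomorphic representatives of
the simple modules of the block of `e`. -/
def IsSimpleReps (k : Type) [Field k] (G : Type) [Group G] [TopologicalSpace G]
    (e : CGA k G) {ι : Type} (S : ι → Type) [∀ i, AddCommGroup (S i)]
    [∀ i, Module (CGA k G) (S i)] : Prop :=
  (∀ i, IsSimpleModule (CGA k G) (S i) ∧ InBlock (CGA k G) (X := S i) e) ∧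
  (∀ i j, i ≠ j → IsEmpty (S i ≃ₗ[CGA k G] S j)) ∧
  (∀ (T : Type) [AddCommGroup T] [Module (CGA k G) T],
    IsSimpleModule (CGA k G) T → InBlock (CGA k G) (X := T) e →
      ∃ i, Nonempty (T ≃ₗ[CGA k G] S i))

section Brauer

/-- The size of the `ρ`-orbit of `i` (the number of edges at the corresponding vertex
of the Brauer tree). -/
def orbSize {ι : Type} (ρ : Equiv.Perm ι) (i : ι) : ℕ :=
  Function.minimalPeriod ρ i

/-- Data describing the exceptional vertex of a Brauer tree: `none` if there is no
exceptional vertex, and otherwise a flag recording whether it is a `ρ`-vertex or a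
`σ`-vertex together with an edge adjacent to it. -/
abbrev ExcVertex (ι : Type) : Type := Option (Bool × ι)

/-- The edge `i` is adjacent to the exceptional vertex, its `ρ`-endpoint being
exceptional. -/
def AdjExcRho {ι : Type} (ρ : Equiv.Perm ι) (exc : ExcVertex ι) (i : ι) : Prop :=
  ∃ j : ι, exc = some (true, j) ∧ ρ.SameCycle j i

/-- The edge `i` is adjacent to the exceptional vertex, its `σ`-endpoint being
exceptional. -/
def AdjExcSigma {ι : Type} (σ : Equiv.Perm ι) (exc : ExcVertex ι) (i : ι) : Prop :=
  ∃ j : ι, exc = some (false, j) ∧ σ.SameCycle j i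

/-- The edge `i` is adjacent to the exceptional vertex. -/
def AdjExc {ι : Type} (ρ σ : Equiv.Perm ι) (exc : ExcVertex ι) (i : ι) : Prop :=
  AdjExcRho ρ exc i ∨ AdjExcSigma σ exc i

end Brauer


set_option linter.unusedSectionVars false

/-- A finite-dimensional representation of `Q` over `K`. -/
structure Rp (K Q : Type) [Field K] [Group Q] where
  V : Type
  [ac : AddCommGroup V]
  [md : Module K V]
  [fd : FiniteDimensional K V]
  ρ : Representation K Q V

attribute [instance] Rp.ac Rp.md Rp.fd

namespace Rp

variable {K Q : Type} [Field K] [Group Q]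

/-- The space of linear maps between the underlying spaces, with its conjugation action. -/
def cj (X Y : Rp K Q) : Representation K Q (X.V →ₗ[K] Y.V) := Representation.linHom X.ρ Y.ρ

lemma cj_apply (X Y : Rp K Q) (g : Q) (φ : X.V →ₗ[K] Y.V) (v : X.V) :
    cj X Y g φ v = Y.ρ g (φ (X.ρ g⁻¹ v)) := rfl

/-- Intertwining maps. -/
def IsHom (X Y : Rp K Q) (φ : X.V →ₗ[K] Y.V) : Prop := ∀ g v, φ (X.ρ g v) = Y.ρ g (φ v)

@[simp] lemma ρ_inv_self (X : Rp K Q) (g : Q) (v : X.V) : X.ρ g (X.ρ g⁻¹ v) = v := by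
  rw [← Module.End.mul_apply, ← map_mul]; simp

@[simp] lemma ρ_self_inv (X : Rp K Q) (g : Q) (v : X.V) : X.ρ g⁻¹ (X.ρ g v) = v := by
  rw [← Module.End.mul_apply, ← map_mul]; simp

lemma ρ_mul (X : Rp K Q) (g h : Q) (v : X.V) : X.ρ (g * h) v = X.ρ g (X.ρ h v) := by
  rw [map_mul]; rfl

lemma cj_mul (X Y : Rp K Q) (g h : Q) (φ : X.V →ₗ[K] Y.V) :
    cj X Y (g * h) φ = cj X Y g (cj X Y h φ) := by
  rw [map_mul]; rfl

lemma isHom_iff_cj {X Y : Rp K Q} {φ : X.V →ₗ[K] Y.V} :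
    IsHom X Y φ ↔ ∀ g, cj X Y g φ = φ := by
  constructor
  · intro h g
    ext v
    rw [cj_apply, ← h, ρ_inv_self]
  · intro h g v
    conv_lhs => rw [← h g]
    rw [cj_apply, ρ_self_inv]

lemma IsHom.cj {X Y : Rp K Q} {φ : X.V →ₗ[K] Y.V} (h : IsHom X Y φ) (g : Q) :
    Rp.cj X Y g φ = φ := isHom_iff_cj.1 h g

lemma cj_comp {X Y Z : Rp K Q} (g : Q) (ψ : Y.V →ₗ[K] Z.V) (φ : X.V →ₗ[K] Y.V) :
    cj X Z g (ψ ∘ₗ φ) = cj Y Z g ψ ∘ₗ cj X Y g φ := by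
  ext v
  simp [cj_apply]

lemma IsHom.comp {X Y Z : Rp K Q} {ψ : Y.V →ₗ[K] Z.V} {φ : X.V →ₗ[K] Y.V}
    (hψ : IsHom Y Z ψ) (hφ : IsHom X Y φ) : IsHom X Z (ψ ∘ₗ φ) := fun g v => by
  simp [hφ g, hψ g]

lemma IsHom.id (X : Rp K Q) : IsHom X X LinearMap.id := fun _ _ => rfl

lemma IsHom.zero (X Y : Rp K Q) : IsHom X Y 0 := fun g v => by simp

lemma IsHom.add {X Y : Rp K Q} {φ ψ : X.V →ₗ[K] Y.V}
    (hφ : IsHom X Y φ) (hψ : IsHom X Y ψ) : IsHom X Y (φ + ψ) := fun g v => by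
  simp [hφ g, hψ g]

lemma IsHom.sub {X Y : Rp K Q} {φ ψ : X.V →ₗ[K] Y.V}
    (hφ : IsHom X Y φ) (hψ : IsHom X Y ψ) : IsHom X Y (φ - ψ) := fun g v => by
  simp [hφ g, hψ g]

lemma IsHom.smul {X Y : Rp K Q} {φ : X.V →ₗ[K] Y.V} (c : K)
    (hφ : IsHom X Y φ) : IsHom X Y (c • φ) := fun g v => by
  simp [hφ g]

lemma IsHom.pow {X : Rp K Q} {φ : X.V →ₗ[K] X.V} (hφ : IsHom X X φ) (n : ℕ) :
    IsHom X X (φ ^ n) := by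
  induction n with
  | zero => exact IsHom.id X
  | succ n ih => rw [pow_succ]; exact ih.comp hφ

/-- Invariant subspaces. -/
def Inv (X : Rp K Q) (W : Submodule K X.V) : Prop := ∀ g, ∀ v ∈ W, X.ρ g v ∈ W

/-- The subrepresentation on an invariant subspace. -/
abbrev sub (X : Rp K Q) (W : Submodule K X.V) (h : X.Inv W) : Rp K Q where
  V := W
  ρ :=
    { toFun := fun g => (X.ρ g).restrict (h g)
      map_one' := by ext v; simp
      map_mul' := fun g g' => by ext v; simp }

/-- The quotient by an invariant subspace. -/
abbrev quo (X : Rp K Q) (W : Submodule K X.V) (h : X.Inv W) : Rp K Q where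
  V := X.V ⧸ W
  ρ :=
    { toFun := fun g => W.mapQ W (X.ρ g) (h g)
      map_one' := by
        apply LinearMap.ext; intro v
        obtain ⟨v, rfl⟩ := Submodule.Quotient.mk_surjective _ v
        simp
      map_mul' := fun g g' => by
        apply LinearMap.ext; intro v
        obtain ⟨v, rfl⟩ := Submodule.Quotient.mk_surjective _ v
        simp }

/-- The pullback along a homomorphism. -/
abbrev pull {Q' : Type} [Group Q'] (X : Rp K Q) (f : Q' →* Q) : Rp K Q' where
  V := X.V
  ρ := X.ρ.comp f

/-- The twist by a linear character. -/
abbrev tw (X : Rp K Q) (χ : Q →* Kˣ) : Rp K Q where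
  V := X.V
  ρ :=
    { toFun := fun g => (χ g : K) • X.ρ g
      map_one' := by simp
      map_mul' := fun g g' => by
        ext v
        simp only [map_mul, Units.val_mul, LinearMap.smul_apply, Module.End.mul_apply,
          map_smul, smul_smul]
        rw [mul_comm] }

lemma isHom_subtype (X : Rp K Q) (W : Submodule K X.V) (h : X.Inv W) :
    IsHom (X.sub W h) X W.subtype := fun _ _ => rfl

lemma isHom_mkQ (X : Rp K Q) (W : Submodule K X.V) (h : X.Inv W) :
    IsHom X (X.quo W h) W.mkQ := fun _ _ => rfl

lemma tw_ρ (X : Rp K Q) (χ : Q →* Kˣ) (g : Q) (v : X.V) :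
    (X.tw χ).ρ g v = (χ g : K) • X.ρ g v := rfl

lemma tw_cj (X Y : Rp K Q) (χ : Q →* Kˣ) (g : Q) (φ : X.V →ₗ[K] Y.V) :
    cj (X.tw χ) (Y.tw χ) g φ = cj X Y g φ := by
  apply LinearMap.ext; intro v
  change (χ g : K) • Y.ρ g (φ ((χ g⁻¹ : K) • X.ρ g⁻¹ v)) = Y.ρ g (φ (X.ρ g⁻¹ v))
  simp [smul_smul]

lemma tw_inv {X : Rp K Q} {χ : Q →* Kˣ} {W : Submodule K X.V} :
    (X.tw χ).Inv W ↔ X.Inv W := by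
  constructor
  · intro h g v hv
    have := W.smul_mem ((χ g)⁻¹ : Kˣ) (h g v hv)
    rw [tw_ρ, smul_smul] at this
    simpa using this
  · intro h g v hv
    exact W.smul_mem _ (h g v hv)

lemma tw_isHom {X Y : Rp K Q} {χ : Q →* Kˣ} {φ : X.V →ₗ[K] Y.V} :
    IsHom (X.tw χ) (Y.tw χ) φ ↔ IsHom X Y φ := by
  rw [isHom_iff_cj, isHom_iff_cj]
  exact forall_congr' fun g => by rw [← tw_cj X Y χ g]

lemma IsHom.range {X Y : Rp K Q} {φ : X.V →ₗ[K] Y.V} (h : IsHom X Y φ) :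
    Y.Inv (LinearMap.range φ) := by
  rintro g _ ⟨v, rfl⟩
  exact ⟨X.ρ g v, h g v⟩

lemma IsHom.ker {X Y : Rp K Q} {φ : X.V →ₗ[K] Y.V} (h : IsHom X Y φ) :
    X.Inv (LinearMap.ker φ) := by
  intro g v hv
  rw [LinearMap.mem_ker] at hv ⊢
  rw [h, hv, map_zero]

lemma IsHom.map {X Y : Rp K Q} {φ : X.V →ₗ[K] Y.V} (h : IsHom X Y φ) {W : Submodule K X.V}
    (hW : X.Inv W) : Y.Inv (W.map φ) := by
  rintro g _ ⟨v, hv, rfl⟩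
  exact ⟨X.ρ g v, hW g v hv, h g v⟩

lemma IsHom.comap {X Y : Rp K Q} {φ : X.V →ₗ[K] Y.V} (h : IsHom X Y φ) {W : Submodule K Y.V}
    (hW : Y.Inv W) : X.Inv (W.comap φ) := by
  intro g v hv
  rw [Submodule.mem_comap] at hv ⊢
  rw [h]; exact hW g _ hv

lemma Inv.sup {X : Rp K Q} {W W' : Submodule K X.V} (h : X.Inv W) (h' : X.Inv W') :
    X.Inv (W ⊔ W') := by
  intro g v hv
  obtain ⟨a, ha, b, hb, rfl⟩ := Submodule.mem_sup.1 hv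
  rw [map_add]
  exact Submodule.add_mem_sup (h g a ha) (h' g b hb)

lemma inv_top (X : Rp K Q) : X.Inv ⊤ := fun _ _ _ => trivial

lemma inv_bot (X : Rp K Q) : X.Inv ⊥ := fun g v hv => by
  rw [Submodule.mem_bot] at hv ⊢; rw [hv, map_zero]

/-- A homomorphism with values in an invariant subspace factors through it. -/
lemma IsHom.codRestrict {X Y : Rp K Q} {φ : X.V →ₗ[K] Y.V} (h : IsHom X Y φ)
    {W : Submodule K Y.V} (hW : Y.Inv W) (hφ : ∀ v, φ v ∈ W) :
    IsHom X (Y.sub W hW) (φ.codRestrict W hφ) := fun g v => Subtype.ext (h g v)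

/-- A homomorphism factors through a surjective homomorphism with smaller kernel. -/
lemma exists_factor {X Y Z : Rp K Q} {a : X.V →ₗ[K] Y.V} {b : X.V →ₗ[K] Z.V}
    (ha : IsHom X Y a) (hb : IsHom X Z b) (hs : Function.Surjective a)
    (hk : LinearMap.ker a ≤ LinearMap.ker b) :
    ∃ c : Y.V →ₗ[K] Z.V, IsHom Y Z c ∧ c ∘ₗ a = b := by
  obtain ⟨s, hs'⟩ := a.exists_rightInverse_of_surjective (LinearMap.range_eq_top.2 hs)
  have h1 : ∀ v, b (s (a v)) = b v := fun v => by
    have : s (a v) - v ∈ LinearMap.ker a := by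
      have := LinearMap.congr_fun hs' (a v)
      simp only [LinearMap.comp_apply, LinearMap.id_apply] at this
      simp [this]
    have := hk this
    rwa [LinearMap.mem_ker, map_sub, sub_eq_zero] at this
  refine ⟨b ∘ₗ s, fun g y => ?_, LinearMap.ext h1⟩
  obtain ⟨v, rfl⟩ := hs y
  rw [LinearMap.comp_apply, LinearMap.comp_apply, ← ha, h1, h1, hb]

/-- A homomorphism with range inside that of an injective homomorphism factors through it. -/
lemma exists_cofactor {X Y Z : Rp K Q} {i : Y.V →ₗ[K] Z.V} {b : X.V →ₗ[K] Z.V}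
    (hi : IsHom Y Z i) (hb : IsHom X Z b) (hinj : Function.Injective i)
    (hk : LinearMap.range b ≤ LinearMap.range i) :
    ∃ c : X.V →ₗ[K] Y.V, IsHom X Y c ∧ i ∘ₗ c = b := by
  obtain ⟨s, hs⟩ := i.exists_leftInverse_of_injective (LinearMap.ker_eq_bot.2 hinj)
  have h1 : ∀ v, i (s (b v)) = b v := fun v => by
    obtain ⟨y, hy⟩ := hk ⟨v, rfl⟩
    rw [← hy]
    have := LinearMap.congr_fun hs y
    simp only [LinearMap.comp_apply, LinearMap.id_apply] at this
    rw [this]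
  refine ⟨s ∘ₗ b, fun g v => hinj ?_, LinearMap.ext h1⟩
  rw [LinearMap.comp_apply, LinearMap.comp_apply, h1, hi, h1, hb]

/-- Simple representations. -/
def Simp (X : Rp K Q) : Prop := Nontrivial X.V ∧ ∀ W, X.Inv W → W = ⊥ ∨ W = ⊤

/-- Isomorphism of representations. -/
def Iso (X Y : Rp K Q) : Prop := ∃ φ : X.V ≃ₗ[K] Y.V, IsHom X Y φ

lemma Iso.refl (X : Rp K Q) : Iso X X := ⟨LinearEquiv.refl _ _, fun _ _ => rfl⟩

lemma Iso.symm {X Y : Rp K Q} : Iso X Y → Iso Y X := fun ⟨φ, h⟩ =>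
  ⟨φ.symm, fun g v => φ.injective (by
    have := h g (φ.symm v)
    simp only [LinearEquiv.coe_coe, LinearEquiv.apply_symm_apply] at this ⊢
    exact this.symm)⟩

lemma Iso.trans {X Y Z : Rp K Q} : Iso X Y → Iso Y Z → Iso X Z := fun ⟨φ, h⟩ ⟨ψ, h'⟩ =>
  ⟨φ.trans ψ, fun g v => by
    have h1 := h g v
    have h2 := h' g (φ v)
    simp only [LinearEquiv.coe_coe, LinearEquiv.trans_apply] at *
    rw [h1, h2]⟩

lemma iso_of_bij {X Y : Rp K Q} {φ : X.V →ₗ[K] Y.V} (h : IsHom X Y φ)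
    (hb : Function.Bijective φ) : Iso X Y :=
  ⟨LinearEquiv.ofBijective φ hb, h⟩

lemma Iso.tw {X Y : Rp K Q} (χ : Q →* Kˣ) : Iso X Y → Iso (X.tw χ) (Y.tw χ) := fun ⟨φ, h⟩ =>
  ⟨φ, tw_isHom.2 h⟩

lemma Iso.finrank {X Y : Rp K Q} : Iso X Y → Module.finrank K X.V = Module.finrank K Y.V :=
  fun ⟨φ, _⟩ => φ.finrank_eq

lemma tw_tw (X : Rp K Q) (χ ξ : Q →* Kˣ) : Iso ((X.tw χ).tw ξ) (X.tw (χ * ξ)) :=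
  ⟨LinearEquiv.refl _ _, fun g v => by
    change (ξ g : K) • (χ g : K) • X.ρ g v = ((χ * ξ) g : K) • X.ρ g v
    rw [smul_smul, MonoidHom.mul_apply, Units.val_mul, mul_comm]⟩

lemma tw_one (X : Rp K Q) : Iso (X.tw 1) X :=
  ⟨LinearEquiv.refl _ _, fun g v => by
    change ((1 : Q →* Kˣ) g : K) • X.ρ g v = X.ρ g v
    simp⟩

lemma Iso.nontrivial {X Y : Rp K Q} (h : Iso X Y) (hX : Nontrivial X.V) : Nontrivial Y.V := by
  obtain ⟨φ, _⟩ := h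
  exact φ.toEquiv.symm.nontrivial

lemma Iso.simp {X Y : Rp K Q} (h : Iso X Y) (hX : Simp X) : Simp Y := by
  refine ⟨h.nontrivial hX.1, fun W hW => ?_⟩
  obtain ⟨φ, hφ⟩ := h
  have hs : W = (W.comap (φ : X.V →ₗ[K] Y.V)).map (φ : X.V →ₗ[K] Y.V) := by
    rw [Submodule.map_comap_eq_of_surjective φ.surjective]
  rcases hX.2 _ (hφ.comap hW) with h0 | h0
  · left; rw [hs, h0, Submodule.map_bot]
  · right; rw [hs, h0, Submodule.map_top, LinearMap.range_eq_top]; exact φ.surjective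

lemma Simp.tw {X : Rp K Q} (hX : Simp X) (χ : Q →* Kˣ) : Simp (X.tw χ) :=
  ⟨hX.1, fun W hW => hX.2 W (tw_inv.1 hW)⟩

lemma surj_of_simp {X Y : Rp K Q} (hY : Simp Y) {φ : X.V →ₗ[K] Y.V} (h : IsHom X Y φ)
    (h0 : φ ≠ 0) : Function.Surjective φ := by
  rcases hY.2 _ h.range with h1 | h1
  · exact absurd (LinearMap.range_eq_bot.1 h1) h0
  · exact LinearMap.range_eq_top.1 h1

lemma inj_of_simp {X Y : Rp K Q} (hX : Simp X) {φ : X.V →ₗ[K] Y.V} (h : IsHom X Y φ)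
    (h0 : φ ≠ 0) : Function.Injective φ := by
  rcases hX.2 _ h.ker with h1 | h1
  · exact LinearMap.ker_eq_bot.1 h1
  · exact absurd (LinearMap.ker_eq_top.1 h1) h0

lemma iso_of_simp {X Y : Rp K Q} (hX : Simp X) (hY : Simp Y) {φ : X.V →ₗ[K] Y.V}
    (h : IsHom X Y φ) (h0 : φ ≠ 0) : Iso X Y :=
  iso_of_bij h ⟨inj_of_simp hX h h0, surj_of_simp hY h h0⟩

/-- Schur's lemma. -/
lemma schur [IsAlgClosed K] {X : Rp K Q} (hX : Simp X) {φ : X.V →ₗ[K] X.V}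
    (h : IsHom X X φ) : ∃ c : K, φ = c • LinearMap.id := by
  have := hX.1
  obtain ⟨c, hc⟩ := Module.End.exists_eigenvalue φ
  refine ⟨c, ?_⟩
  have h1 : IsHom X X (φ - c • LinearMap.id) := h.sub ((IsHom.id X).smul c)
  by_contra h0
  have := inj_of_simp hX h1 (fun h2 => h0 (sub_eq_zero.1 h2))
  obtain ⟨v, hv⟩ := hc.exists_hasEigenvector
  refine hv.2 (this ?_)
  rw [map_zero, LinearMap.sub_apply, hv.apply_eq_smul]
  simp

/-- Two homomorphisms between simple representations are linearly dependent. -/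
lemma schur_dep [IsAlgClosed K] {X Y : Rp K Q} (hX : Simp X) (hY : Simp Y)
    {φ ψ : X.V →ₗ[K] Y.V} (hφ : IsHom X Y φ) (hψ : IsHom X Y ψ) :
    ∃ a b : K, (a ≠ 0 ∨ b ≠ 0) ∧ a • φ + b • ψ = 0 := by
  by_cases h0 : φ = 0
  · exact ⟨1, 0, by simp, by simp [h0]⟩
  · let e : X.V ≃ₗ[K] Y.V := LinearEquiv.ofBijective φ ⟨inj_of_simp hX hφ h0, surj_of_simp hY hφ h0⟩
    have he : IsHom X Y e := hφ
    have hes : IsHom Y X e.symm := fun g v => e.injective (by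
      have := he g (e.symm v)
      simp only [LinearEquiv.coe_coe, LinearEquiv.apply_symm_apply] at this ⊢
      exact this.symm)
    obtain ⟨c, hc⟩ := schur hX (hes.comp hψ)
    refine ⟨c, -1, by simp, ?_⟩
    ext v
    have := congrArg e (LinearMap.congr_fun hc v)
    simp only [LinearMap.comp_apply, LinearEquiv.coe_coe, LinearEquiv.apply_symm_apply] at this
    simp only [LinearMap.smul_apply, LinearMap.id_apply, map_smul] at this
    simp only [LinearMap.add_apply, LinearMap.smul_apply, LinearMap.zero_apply, this]
    change c • φ v + (-1 : K) • c • φ v = 0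
    simp

end Rp

namespace Rp

variable {K Q : Type} [Field K] [Group Q]

/-! ### Trace maps and projectivity -/

/-- Maps of the form `∑ g, g ψ g⁻¹`. -/
def Null [Fintype Q] (X Y : Rp K Q) (φ : X.V →ₗ[K] Y.V) : Prop := ∃ ψ, φ = ∑ g, cj X Y g ψ

/-- Traces from the trivial group to the cyclic group generated by `d`. -/
def NullOn (d : Q) (X Y : Rp K Q) (φ : X.V →ₗ[K] Y.V) : Prop :=
  ∃ ψ, φ = ∑ j ∈ Finset.range (orderOf d), cj X Y (d ^ j) ψ

/-- Projective representations. -/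
def Proj [Fintype Q] (X : Rp K Q) : Prop := Null X X LinearMap.id

section Null

variable [Fintype Q] {X Y Z : Rp K Q}

lemma Null.isHom {φ : X.V →ₗ[K] Y.V} (h : Null X Y φ) : IsHom X Y φ := by
  obtain ⟨ψ, rfl⟩ := h
  rw [isHom_iff_cj]
  intro g
  rw [map_sum]
  simp_rw [← cj_mul]
  exact Fintype.sum_equiv (Equiv.mulLeft g) _ _ (fun _ => rfl)

lemma Null.comp_left {φ : X.V →ₗ[K] Y.V} (h : Null X Y φ) {α : Y.V →ₗ[K] Z.V}
    (hα : IsHom Y Z α) : Null X Z (α ∘ₗ φ) := by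
  obtain ⟨ψ, rfl⟩ := h
  refine ⟨α ∘ₗ ψ, ?_⟩
  simp_rw [cj_comp (Y := Y), hα.cj]
  ext v; simp

lemma Null.comp_right {φ : Y.V →ₗ[K] Z.V} (h : Null Y Z φ) {α : X.V →ₗ[K] Y.V}
    (hα : IsHom X Y α) : Null X Z (φ ∘ₗ α) := by
  obtain ⟨ψ, rfl⟩ := h
  refine ⟨ψ ∘ₗ α, ?_⟩
  simp_rw [cj_comp (Y := Y), hα.cj]
  ext v; simp

lemma Null.add {φ ψ : X.V →ₗ[K] Y.V} (h : Null X Y φ) (h' : Null X Y ψ) : Null X Y (φ + ψ) := by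
  obtain ⟨a, rfl⟩ := h
  obtain ⟨b, rfl⟩ := h'
  exact ⟨a + b, by simp [Finset.sum_add_distrib]⟩

lemma Null.smul {φ : X.V →ₗ[K] Y.V} (c : K) (h : Null X Y φ) : Null X Y (c • φ) := by
  obtain ⟨a, rfl⟩ := h
  exact ⟨c • a, by simp [Finset.smul_sum]⟩

lemma Null.neg {φ : X.V →ₗ[K] Y.V} (h : Null X Y φ) : Null X Y (-φ) := by
  simpa using h.smul (-1)

lemma Null.lift {A Z Y : Rp K Q} {φ : A.V →ₗ[K] Z.V} (h : Null A Z φ) {s : Y.V →ₗ[K] Z.V}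
    (hs : IsHom Y Z s) (hsurj : Function.Surjective s) :
    ∃ φ', IsHom A Y φ' ∧ s ∘ₗ φ' = φ := by
  obtain ⟨ψ, rfl⟩ := h
  obtain ⟨t, ht⟩ := s.exists_rightInverse_of_surjective (LinearMap.range_eq_top.2 hsurj)
  refine ⟨∑ g, cj A Y g (t ∘ₗ ψ), Null.isHom ⟨_, rfl⟩, ?_⟩
  have : ∀ g, s ∘ₗ cj A Y g (t ∘ₗ ψ) = cj A Z g ψ := fun g => by
    conv_lhs => rw [← hs.cj g, ← cj_comp, ← LinearMap.comp_assoc, ht, LinearMap.id_comp]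
  simp_rw [← this]
  ext v; simp

lemma Null.extend {A B Z : Rp K Q} {φ : A.V →ₗ[K] Z.V} (h : Null A Z φ) {i : A.V →ₗ[K] B.V}
    (hi : IsHom A B i) (hinj : Function.Injective i) :
    ∃ φ', IsHom B Z φ' ∧ φ' ∘ₗ i = φ := by
  obtain ⟨ψ, rfl⟩ := h
  obtain ⟨t, ht⟩ := i.exists_leftInverse_of_injective (LinearMap.ker_eq_bot.2 hinj)
  refine ⟨∑ g, cj B Z g (ψ ∘ₗ t), Null.isHom ⟨_, rfl⟩, ?_⟩
  have : ∀ g, cj B Z g (ψ ∘ₗ t) ∘ₗ i = cj A Z g ψ := fun g => by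
    conv_lhs => rw [← hi.cj g, ← cj_comp, LinearMap.comp_assoc, ht, LinearMap.comp_id]
  simp_rw [← this]
  ext v; simp

lemma Proj.null_from (hX : Proj X) {φ : X.V →ₗ[K] Y.V} (h : IsHom X Y φ) : Null X Y φ := by
  simpa using Null.comp_left hX h

lemma Proj.null_to (hY : Proj Y) {φ : X.V →ₗ[K] Y.V} (h : IsHom X Y φ) : Null X Y φ := by
  simpa using Null.comp_right hY h

/-- Summands of projectives are projective. -/
lemma Proj.of_retract (hY : Proj Y) {i : X.V →ₗ[K] Y.V} {r : Y.V →ₗ[K] X.V}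
    (hi : IsHom X Y i) (hr : IsHom Y X r) (h : r ∘ₗ i = LinearMap.id) : Proj X := by
  unfold Proj
  rw [← h]
  exact (hY.null_from hr).comp_right hi

lemma Proj.iso (hX : Proj X) (h : Iso X Y) : Proj Y := by
  obtain ⟨φ, hφ⟩ := id h
  obtain ⟨ψ, hψ⟩ := h.symm
  have hs : IsHom Y X φ.symm := fun g v => φ.injective (by
    have := hφ g (φ.symm v)
    simp only [LinearEquiv.coe_coe, LinearEquiv.apply_symm_apply] at this ⊢
    exact this.symm)
  exact hX.of_retract hs hφ (by ext; simp)

lemma tw_null {χ : Q →* Kˣ} {φ : X.V →ₗ[K] Y.V} :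
    Null (X.tw χ) (Y.tw χ) φ ↔ Null X Y φ :=
  exists_congr fun ψ => by
    have : ∀ g, cj (X.tw χ) (Y.tw χ) g ψ = cj X Y g ψ := fun g => tw_cj X Y χ g ψ
    rw [Finset.sum_congr rfl fun g _ => this g]

lemma tw_proj {χ : Q →* Kˣ} : Proj (X.tw χ) ↔ Proj X := tw_null

lemma Proj.of_subsingleton (h : ¬ Nontrivial X.V) : Proj X := by
  rw [not_nontrivial_iff_subsingleton] at h
  exact ⟨0, LinearMap.ext fun v => Subsingleton.elim _ _⟩

end Null

/-- If `s ∘ i` is bijective, then `i` is split. -/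
lemma exists_retraction {X Y : Rp K Q} {i : X.V →ₗ[K] Y.V} {s : Y.V →ₗ[K] X.V}
    (hi : IsHom X Y i) (hs : IsHom Y X s) (h : Function.Bijective (s ∘ₗ i)) :
    ∃ r : Y.V →ₗ[K] X.V, IsHom Y X r ∧ r ∘ₗ i = LinearMap.id := by
  let e := LinearEquiv.ofBijective (s ∘ₗ i) h
  have he : IsHom X X e := hs.comp hi
  have hes : IsHom X X e.symm := fun g v => e.injective (by
    have := he g (e.symm v)
    simp only [LinearEquiv.coe_coe, LinearEquiv.apply_symm_apply] at this ⊢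
    exact this.symm)
  exact ⟨e.symm ∘ₗ s, hes.comp hs, LinearMap.ext fun v => e.symm_apply_apply v⟩

section NullOn

variable {d : Q} {X Y Z : Rp K Q}

lemma sum_pow_succ {M : Type} [AddCommGroup M] (d : Q) (F : Q → M) :
    ∑ j ∈ Finset.range (orderOf d), F (d ^ (j + 1)) = ∑ j ∈ Finset.range (orderOf d), F (d ^ j) := by
  have h1 := Finset.sum_range_succ (fun j => F (d ^ j)) (orderOf d)
  have h2 := Finset.sum_range_succ' (fun j => F (d ^ j)) (orderOf d)
  rw [h1, pow_orderOf_eq_one, pow_zero] at h2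
  exact (add_right_cancel h2).symm

lemma cj_pow_eq {φ : X.V →ₗ[K] Y.V} (h : cj X Y d φ = φ) (j : ℕ) : cj X Y (d ^ j) φ = φ := by
  induction j with
  | zero => simp
  | succ j ih => rw [pow_succ, cj_mul, h, ih]

lemma NullOn.comp_left {φ : X.V →ₗ[K] Y.V} (h : NullOn d X Y φ) {α : Y.V →ₗ[K] Z.V}
    (hα : Rp.cj Y Z d α = α) : NullOn d X Z (α ∘ₗ φ) := by
  obtain ⟨ψ, rfl⟩ := h
  refine ⟨α ∘ₗ ψ, ?_⟩
  simp_rw [cj_comp (Y := Y), cj_pow_eq hα]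
  ext v; simp

lemma NullOn.comp_right {φ : Y.V →ₗ[K] Z.V} (h : NullOn d Y Z φ) {α : X.V →ₗ[K] Y.V}
    (hα : Rp.cj X Y d α = α) : NullOn d X Z (φ ∘ₗ α) := by
  obtain ⟨ψ, rfl⟩ := h
  refine ⟨ψ ∘ₗ α, ?_⟩
  simp_rw [cj_comp (Y := Y), cj_pow_eq hα]
  ext v; simp

lemma NullOn.add {φ ψ : X.V →ₗ[K] Y.V} (h : NullOn d X Y φ) (h' : NullOn d X Y ψ) :
    NullOn d X Y (φ + ψ) := by
  obtain ⟨a, rfl⟩ := h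
  obtain ⟨b, rfl⟩ := h'
  exact ⟨a + b, by simp [Finset.sum_add_distrib]⟩

lemma NullOn.smul {φ : X.V →ₗ[K] Y.V} (c : K) (h : NullOn d X Y φ) : NullOn d X Y (c • φ) := by
  obtain ⟨a, rfl⟩ := h
  exact ⟨c • a, by simp [Finset.smul_sum]⟩

lemma NullOn.neg {φ : X.V →ₗ[K] Y.V} (h : NullOn d X Y φ) : NullOn d X Y (-φ) := by
  simpa using h.smul (-1)

lemma NullOn.sub {φ ψ : X.V →ₗ[K] Y.V} (h : NullOn d X Y φ) (h' : NullOn d X Y ψ) :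
    NullOn d X Y (φ - ψ) := by
  rw [sub_eq_add_neg]; exact h.add h'.neg

end NullOn

/-! ### Cocycles -/

/-- One-cocycles with values in the space of linear maps from `X` to `Y`. -/
def IsCoc (X Y : Rp K Q) (c : Q → (X.V →ₗ[K] Y.V)) : Prop :=
  ∀ g h, c (g * h) = c g + cj X Y g (c h)

/-- One-coboundaries. -/
def IsCob (X Y : Rp K Q) (c : Q → (X.V →ₗ[K] Y.V)) : Prop :=
  ∃ b, ∀ g, c g = cj X Y g b - b

section Coc

variable {X Y Z : Rp K Q} {c c' : Q → (X.V →ₗ[K] Y.V)}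

lemma IsCoc.one (h : IsCoc X Y c) : c 1 = 0 := by
  have := h 1 1
  simpa using this

lemma IsCoc.add (h : IsCoc X Y c) (h' : IsCoc X Y c') : IsCoc X Y (c + c') := fun g g' => by
  simp only [Pi.add_apply, h g, h' g, map_add]; abel

lemma IsCoc.smul (a : K) (h : IsCoc X Y c) : IsCoc X Y (a • c) := fun g g' => by
  simp only [Pi.smul_apply, h g, map_smul, smul_add]

lemma IsCob.isCoc (h : IsCob X Y c) : IsCoc X Y c := by
  obtain ⟨b, hb⟩ := h
  intro g g'
  simp only [hb, map_sub, cj_mul]; abel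

lemma IsCoc.comp_left (h : IsCoc X Y c) {α : Y.V →ₗ[K] Z.V} (hα : IsHom Y Z α) :
    IsCoc X Z (fun g => α ∘ₗ c g) := fun g g' => by
  simp only [h g, cj_comp (Y := Y), hα.cj, LinearMap.comp_add]

lemma IsCoc.comp_right {c : Q → (Y.V →ₗ[K] Z.V)} (h : IsCoc Y Z c) {α : X.V →ₗ[K] Y.V}
    (hα : IsHom X Y α) : IsCoc X Z (fun g => c g ∘ₗ α) := fun g g' => by
  simp only [h g, cj_comp (Y := Y), hα.cj, LinearMap.add_comp]

lemma IsCoc.cob_null_left [Fintype Q] (h : IsCoc X Y c) {α : Y.V →ₗ[K] Z.V} (hα : Null Y Z α) :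
    IsCob X Z (fun g => α ∘ₗ c g) := by
  obtain ⟨ψ, rfl⟩ := hα
  refine ⟨-∑ g, cj Y Z g ψ ∘ₗ c g, fun x => ?_⟩
  have h1 : ∀ g, cj X Z x (cj Y Z g ψ ∘ₗ c g)
      = cj Y Z (x * g) ψ ∘ₗ c (x * g) - cj Y Z (x * g) ψ ∘ₗ c x := fun g => by
    rw [cj_comp (Y := Y), ← cj_mul, h x g, LinearMap.comp_add, add_sub_cancel_left]
  have h2 := Equiv.sum_comp (Equiv.mulLeft x) (fun g => cj Y Z g ψ ∘ₗ c g)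
  have h3 := Equiv.sum_comp (Equiv.mulLeft x) (fun g => cj Y Z g ψ ∘ₗ c x)
  simp only [Equiv.coe_mulLeft] at h2 h3
  rw [map_neg, map_sum]
  simp_rw [h1]
  rw [Finset.sum_sub_distrib, h2, h3]
  ext v; simp

lemma IsCoc.cob_null_right [Fintype Q] {c : Q → (Y.V →ₗ[K] Z.V)} (h : IsCoc Y Z c)
    {α : X.V →ₗ[K] Y.V} (hα : Null X Y α) : IsCob X Z (fun g => c g ∘ₗ α) := by
  obtain ⟨ψ, rfl⟩ := hα
  refine ⟨-∑ g, c g ∘ₗ cj X Y g ψ, fun x => ?_⟩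
  have h1 : ∀ g, cj X Z x (c g ∘ₗ cj X Y g ψ)
      = c (x * g) ∘ₗ cj X Y (x * g) ψ - c x ∘ₗ cj X Y (x * g) ψ := fun g => by
    rw [cj_comp (Y := Y), ← cj_mul, h x g, LinearMap.add_comp, add_sub_cancel_left]
  have h2 := Equiv.sum_comp (Equiv.mulLeft x) (fun g => c g ∘ₗ cj X Y g ψ)
  have h3 := Equiv.sum_comp (Equiv.mulLeft x) (fun g => c x ∘ₗ cj X Y g ψ)
  simp only [Equiv.coe_mulLeft] at h2 h3
  rw [map_neg, map_sum]
  simp_rw [h1]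
  rw [Finset.sum_sub_distrib, h2, h3]
  ext v; simp

lemma IsCoc.cob_of_proj_right [Fintype Q] (h : IsCoc X Y c) (hY : Proj Y) : IsCob X Y c :=
  h.cob_null_left hY

lemma IsCoc.cob_of_proj_left [Fintype Q] (h : IsCoc X Y c) (hX : Proj X) : IsCob X Y c :=
  h.cob_null_right hX

/-- The linking relation between simple representations. -/
def Linked (X Y : Rp K Q) : Prop := ∃ c, IsCoc X Y c ∧ ¬ IsCob X Y c

/-- The cocycle of an extension with a chosen linear section. -/
lemma exists_section_coc {M T : Rp K Q} {π : M.V →ₗ[K] T.V} (hπ : IsHom M T π)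
    (hs : Function.Surjective π) :
    ∃ (s : T.V →ₗ[K] M.V) (c : Q → (T.V →ₗ[K] (M.sub _ hπ.ker).V)), π ∘ₗ s = LinearMap.id ∧
      IsCoc T (M.sub _ hπ.ker) c ∧ ∀ g, (LinearMap.ker π).subtype ∘ₗ c g = cj T M g s - s := by
  obtain ⟨s, hs'⟩ := π.exists_rightInverse_of_surjective (LinearMap.range_eq_top.2 hs)
  have h1 : ∀ v, π (s v) = v := LinearMap.congr_fun hs'
  have h2 : ∀ g v, (cj T M g s - s) v ∈ LinearMap.ker π := fun g v => by
    rw [LinearMap.mem_ker, LinearMap.sub_apply, map_sub, cj_apply, hπ, h1, h1, ρ_inv_self, sub_self]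
  let c : Q → (T.V →ₗ[K] (M.sub _ hπ.ker).V) := fun g => (cj T M g s - s).codRestrict _ (h2 g)
  have h3 : ∀ g, (LinearMap.ker π).subtype ∘ₗ c g = cj T M g s - s := fun g => by
    ext v; rfl
  refine ⟨s, c, hs', fun g g' => ?_, h3⟩
  have : Function.Injective (fun φ : T.V →ₗ[K] (M.sub _ hπ.ker).V =>
      (LinearMap.ker π).subtype ∘ₗ φ) := fun φ ψ h => LinearMap.ext fun v => Subtype.ext
        (LinearMap.congr_fun h v)
  apply this
  simp only [LinearMap.comp_add, h3]
  conv_rhs => rw [← (isHom_subtype M _ hπ.ker).cj g, ← cj_comp, h3]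
  rw [map_sub, cj_mul]; abel

/-- A homomorphism on the kernel whose pushed-out cocycle is a coboundary extends. -/
lemma extend_of_cob {M T : Rp K Q} {π : M.V →ₗ[K] T.V} (hπ : IsHom M T π)
    {s : T.V →ₗ[K] M.V} {c : Q → (T.V →ₗ[K] (M.sub _ hπ.ker).V)} (hs : π ∘ₗ s = LinearMap.id)
    (hc : ∀ g, (LinearMap.ker π).subtype ∘ₗ c g = cj T M g s - s)
    {Y : Rp K Q} {q : (M.sub _ hπ.ker).V →ₗ[K] Y.V} (hq : IsHom (M.sub _ hπ.ker) Y q)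
    (hb : IsCob T Y (fun g => q ∘ₗ c g)) :
    ∃ q' : M.V →ₗ[K] Y.V, IsHom M Y q' ∧ q' ∘ₗ (LinearMap.ker π).subtype = q := by
  obtain ⟨b, hb⟩ := hb
  have h1 : ∀ v, π (s v) = v := LinearMap.congr_fun hs
  have h2 : ∀ v, (LinearMap.id - s ∘ₗ π : M.V →ₗ[K] M.V) v ∈ LinearMap.ker π := fun v => by
    simp [h1]
  let t : M.V →ₗ[K] (M.sub _ hπ.ker).V := (LinearMap.id - s ∘ₗ π).codRestrict _ h2
  have ht : ∀ v, ((t v : LinearMap.ker π) : M.V) = v - s (π v) := fun v => rfl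
  have key : ∀ g v, t (M.ρ g v) = (M.sub _ hπ.ker).ρ g (t v) + c g (π (M.ρ g v)) := fun g v => by
    apply Subtype.ext
    have e := LinearMap.congr_fun (hc g) (π (M.ρ g v))
    simp only [LinearMap.comp_apply, Submodule.subtype_apply, LinearMap.sub_apply, cj_apply] at e
    change ((t (M.ρ g v) : LinearMap.ker π) : M.V) = M.ρ g ((t v : LinearMap.ker π) : M.V)
      + (c g (π (M.ρ g v)) : LinearMap.ker π)
    rw [e, ht, ht, hπ g v, ρ_self_inv, map_sub]
    abel
  refine ⟨q ∘ₗ t + b ∘ₗ π, fun g v => ?_, ?_⟩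
  · have e := LinearMap.congr_fun (hb g) (π (M.ρ g v))
    simp only [LinearMap.comp_apply, LinearMap.sub_apply, cj_apply] at e
    simp only [LinearMap.add_apply, LinearMap.comp_apply, key, map_add, hq g, e]
    rw [hπ g v, ρ_self_inv]
    abel
  · ext v
    have hv : π v = 0 := v.2
    have : t v = v := Subtype.ext (by rw [ht, hv, map_zero, sub_zero])
    simp [this]

end Coc

end Rp

/-! ### Weights and relative traces -/

section Weights

variable {K Q : Type} [Field K] [Group Q]

lemma sum_pow_eq_ite [Fintype Q] {M : Type} [AddCommMonoid M] (d : Q) (F : Q → M) :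
    ∑ j ∈ Finset.range (orderOf d), F (d ^ j)
      = ∑ x, if x ∈ Subgroup.zpowers d then F x else 0 := by
  rw [← Finset.sum_filter]
  have : Finset.filter (fun x => x ∈ Subgroup.zpowers d) Finset.univ
      = (Finset.range (orderOf d)).image (fun j => d ^ j) := by
    ext x
    simp only [Finset.mem_filter, Finset.mem_univ, true_and]
    exact mem_zpowers_iff_mem_range_orderOf
  rw [this, Finset.sum_image]
  intro i hi j hj h
  exact pow_injOn_Iio_orderOf (Finset.mem_coe.1 hi |> Finset.mem_range.1) (Finset.mem_range.1 (Finset.mem_coe.1 hj)) h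

lemma sum_pow_inv [Fintype Q] {M : Type} [AddCommMonoid M] (d : Q) (F : Q → M) :
    ∑ j ∈ Finset.range (orderOf d), F (d ^ j)⁻¹ = ∑ j ∈ Finset.range (orderOf d), F (d ^ j) := by
  rw [sum_pow_eq_ite d F, sum_pow_eq_ite d (fun x => F x⁻¹)]
  refine Fintype.sum_equiv (Equiv.inv Q) _ _ fun x => ?_
  simp

lemma exists_weight (K : Type) [Field K] {Ω ι : Type} [Fintype ι] (S : Set Ω) (r : Setoid Ω)
    (e : ι → Ω → Ω) (hr : ∀ ω i, r ω (e i ω))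
    (h : ∀ ω ∈ S, ∀ ω', r ω ω' → ∃! i, e i ω = ω') :
    ∃ w : Ω → K, ∀ ω ∈ S, ∑ i, w (e i ω) = 1 := by
  refine ⟨fun ω => if ω = Quotient.out (Quotient.mk r ω) then 1 else 0, fun ω hω => ?_⟩
  have h1 : ∀ i, Quotient.mk r (e i ω) = Quotient.mk r ω := fun i =>
    Quotient.sound (r.symm (hr ω i))
  simp only [h1]
  obtain ⟨i, hi, hu⟩ := h ω hω (Quotient.out (Quotient.mk r ω)) (r.symm (Quotient.mk_out ω))
  rw [Finset.sum_eq_single i, if_pos hi]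
  · intro j _ hj
    rw [if_neg]
    exact fun h' => hj (hu j h')
  · simp

/-- Weights that sum to one over each coset of the cyclic group generated by `d`. -/
def IsWt (d : Q) (w : Q → K) : Prop := ∀ g, ∑ j ∈ Finset.range (orderOf d), w (g * d ^ j) = 1

lemma exists_isWt (K : Type) [Field K] [Finite Q] (d : Q) : ∃ w : Q → K, IsWt d w := by
  have hd : 0 < orderOf d := orderOf_pos d
  obtain ⟨w, hw⟩ := exists_weight K (ι := Fin (orderOf d)) (Set.univ : Set Q)
    (QuotientGroup.leftRel (Subgroup.zpowers d)) (fun j g => g * d ^ (j : ℕ))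
    (fun g j => by
      rw [QuotientGroup.leftRel_apply]
      simp)
    (fun g _ g' h => by
      rw [QuotientGroup.leftRel_apply, mem_zpowers_iff_mem_range_orderOf, Finset.mem_image] at h
      obtain ⟨j, hj, hj'⟩ := h
      refine ⟨⟨j, Finset.mem_range.1 hj⟩, by simp [hj'], fun i hi => Fin.ext ?_⟩
      refine pow_injOn_Iio_orderOf i.2 (Finset.mem_range.1 hj) ?_
      simp only [hj', ← hi, inv_mul_cancel_left])
  exact ⟨w, fun g => by rw [Finset.sum_range]; exact hw g trivial⟩

lemma pow_right_invariant {M : Type} {d : Q} {Φ : Q → M} (hΦ : ∀ g, Φ (g * d) = Φ g) (g : Q)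
    (j : ℕ) : Φ (g * d ^ j) = Φ g := by
  induction j with
  | zero => simp
  | succ j ih => rw [pow_succ, ← mul_assoc, hΦ, ih]

lemma IsWt.translate {d : Q} {w : Q → K} (h : IsWt d w) (x : Q) : IsWt d (fun g => w (x * g)) :=
  fun g => by simp_rw [← mul_assoc]; exact h _

/-- The conjugation representation on the group algebra. -/
def cjA (K Q : Type) [Field K] [Group Q] : Representation K Q (MonoidAlgebra K Q) where
  toFun g :=
    { toFun := conjActF K Q g
      map_add' := fun a b => by simp only [conjActF, mul_add, add_mul]
      map_smul' := fun c a => by simp [conjActF] }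
  map_one' := by
    apply LinearMap.ext; intro a
    change conjActF K Q 1 a = a
    simp [conjActF, ← MonoidAlgebra.one_def]
  map_mul' g h := by
    apply LinearMap.ext; intro a
    change conjActF K Q (g * h) a = conjActF K Q g (conjActF K Q h a)
    simp only [conjActF, mul_inv_rev, ← mul_assoc, MonoidAlgebra.single_mul_single, mul_one]
    simp only [mul_assoc, MonoidAlgebra.single_mul_single, mul_one]

lemma cjA_apply (g : Q) (a : MonoidAlgebra K Q) : cjA K Q g a =
    MonoidAlgebra.single g 1 * a * MonoidAlgebra.single g⁻¹ 1 := rfl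

lemma cjA_mul (g : Q) (a b : MonoidAlgebra K Q) :
    cjA K Q g (a * b) = cjA K Q g a * cjA K Q g b := by
  simp only [cjA_apply]
  have : MonoidAlgebra.single g⁻¹ (1 : K) * MonoidAlgebra.single g 1 = 1 := by
    rw [MonoidAlgebra.single_mul_single, MonoidAlgebra.one_def]; simp
  calc _ = MonoidAlgebra.single g 1 * a * 1 * b * MonoidAlgebra.single g⁻¹ 1 := by
        simp [mul_assoc]
    _ = _ := by rw [← this]; simp only [mul_assoc]

lemma cjA_coeff (g x : Q) (a : MonoidAlgebra K Q) :
    (cjA K Q g a).coeff x = a.coeff (g⁻¹ * x * g) := by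
  rw [cjA_apply]
  simp [mul_assoc]

variable [Fintype Q]

lemma IsWt.sum_inv {d : Q} {w : Q → K} (h : IsWt d w) (g : Q) :
    ∑ j ∈ Finset.range (orderOf d), w (g * (d ^ j)⁻¹) = 1 := by
  rw [← h g, sum_pow_inv d (fun x => w (g * x))]

lemma IsWt.sum_eq {d : Q} {w w' : Q → K} (h : IsWt d w) (h' : IsWt d w') {M : Type}
    [AddCommGroup M] [Module K M] {Φ : Q → M} (hΦ : ∀ g, Φ (g * d) = Φ g) :
    ∑ g, w g • Φ g = ∑ g, w' g • Φ g := by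
  have e1 : ∀ g, w g • Φ g
      = ∑ j ∈ Finset.range (orderOf d), (w' (g * d ^ j) * w g) • Φ (g * d ^ j) := fun g => by
    simp_rw [pow_right_invariant hΦ, ← Finset.sum_smul, ← Finset.sum_mul, h' g, one_mul]
  simp_rw [e1]
  rw [Finset.sum_comm]
  have e2 : ∀ j, ∑ g, (w' (g * d ^ j) * w g) • Φ (g * d ^ j)
      = ∑ g, (w' g * w (g * (d ^ j)⁻¹)) • Φ g := fun j => by
    refine Fintype.sum_equiv (Equiv.mulRight (d ^ j)) _ _ fun g => ?_
    simp
  simp_rw [e2]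
  rw [Finset.sum_comm]
  refine Finset.sum_congr rfl fun g _ => ?_
  rw [← Finset.sum_smul, ← Finset.mul_sum, h.sum_inv, mul_one]

/-- The relative trace condition with respect to the cyclic group generated by `d`. -/
def RelTr (d : Q) (f : MonoidAlgebra K Q) : Prop :=
  ∃ (a : MonoidAlgebra K Q) (w : Q → K), cjA K Q d a = a ∧ IsWt d w ∧ f = ∑ g, w g • cjA K Q g a

lemma RelTr.map {Q' : Type} [Group Q'] [Fintype Q'] {d : Q} {f : MonoidAlgebra K Q}
    (h : RelTr d f) (π : Q →* Q') (hπ : Function.Surjective π)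
    (hk : ∀ x, π x = 1 → x ∈ Subgroup.zpowers d) :
    RelTr (π d) (MonoidAlgebra.mapDomainAlgHom K K π f) := by
  obtain ⟨a, w, ha, hw, rfl⟩ := h
  have hc : ∀ g, MonoidAlgebra.mapDomainAlgHom K K π (cjA K Q g a)
      = cjA K Q' (π g) (MonoidAlgebra.mapDomainAlgHom K K π a) := fun g => by
    simp only [cjA_apply, map_mul, MonoidAlgebra.mapDomainAlgHom_apply,
      MonoidAlgebra.mapDomain_single, map_inv]
  refine ⟨MonoidAlgebra.mapDomainAlgHom K K π a, fun y => ∑ x, if π x = y then w x else 0,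
    by rw [← hc, ha], fun y => ?_, ?_⟩
  · obtain ⟨g, rfl⟩ := hπ y
    rw [← hw g, sum_pow_eq_ite d (fun x => w (g * x)),
      sum_pow_eq_ite (π d) (fun t => ∑ x, if π x = π g * t then w x else 0)]
    have e1 : ∑ x, (if x ∈ Subgroup.zpowers d then w (g * x) else 0)
        = ∑ x, if g⁻¹ * x ∈ Subgroup.zpowers d then w x else 0 :=
      Fintype.sum_equiv (Equiv.mulLeft g) _ _ fun x => by simp
    rw [e1]
    have e2 : ∀ t, (if t ∈ Subgroup.zpowers (π d) then ∑ x, (if π x = π g * t then w x else 0)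
        else 0) = ∑ x, if t = π (g⁻¹ * x) then
          (if t ∈ Subgroup.zpowers (π d) then w x else 0) else 0 := fun t => by
      split_ifs with ht
      · refine Finset.sum_congr rfl fun x _ => ?_
        congr 1
        rw [map_mul, map_inv, eq_inv_mul_iff_mul_eq]
        exact propext eq_comm
      · simp
    simp_rw [e2]
    rw [Finset.sum_comm]
    refine Finset.sum_congr rfl fun x _ => ?_
    rw [Finset.sum_ite_eq' Finset.univ]
    simp only [Finset.mem_univ, if_true]
    congr 1
    rw [eq_iff_iff]
    constructor
    · rintro h
      obtain ⟨i, hi⟩ := Subgroup.mem_zpowers_iff.1 h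
      have : (d ^ i)⁻¹ * (g⁻¹ * x) ∈ Subgroup.zpowers d := hk _ (by
        rw [map_mul, map_inv, map_zpow, hi, inv_mul_cancel])
      rwa [Subgroup.mul_mem_cancel_left _ (inv_mem (Subgroup.zpow_mem_zpowers d i))] at this
    · rintro h
      obtain ⟨i, hi⟩ := Subgroup.mem_zpowers_iff.1 h
      rw [← hi, map_zpow]
      exact Subgroup.zpow_mem_zpowers _ i
  · rw [map_sum]
    simp_rw [map_smul, hc, Finset.sum_smul]
    rw [Finset.sum_comm]
    refine Finset.sum_congr rfl fun x _ => ?_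
    simp_rw [ite_smul, zero_smul]
    rw [Finset.sum_ite_eq Finset.univ]
    simp

end Weights

namespace Rp

section Act

variable {K Q : Type} [Field K] [Group Q]

/-- The action of the group algebra. -/
def act (X : Rp K Q) : MonoidAlgebra K Q →ₐ[K] Module.End K X.V := X.ρ.asAlgebraHom

/-- The element `f` acts as the identity. -/
def InB (f : MonoidAlgebra K Q) (X : Rp K Q) : Prop := X.act f = 1

lemma act_single (X : Rp K Q) (g : Q) (c : K) : X.act (MonoidAlgebra.single g c) = c • X.ρ g :=
  Representation.asAlgebraHom_single _ _ _

lemma act_cjA (X : Rp K Q) (g : Q) (a : MonoidAlgebra K Q) :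
    X.act (cjA K Q g a) = cj X X g (X.act a) := by
  rw [cjA_apply, map_mul, map_mul, act_single, act_single, one_smul, one_smul]
  rfl

lemma act_eq_sum [Fintype Q] (X : Rp K Q) (a : MonoidAlgebra K Q) :
    X.act a = ∑ g, a.coeff g • X.ρ g := by
  conv_lhs => rw [← MonoidAlgebra.sum_coeff_single a, Finsupp.sum_fintype _ _ (by simp)]
  rw [map_sum]
  simp_rw [act_single]

lemma IsHom.act {X Y : Rp K Q} {φ : X.V →ₗ[K] Y.V} (h : IsHom X Y φ) (a : MonoidAlgebra K Q)
    (v : X.V) : φ (X.act a v) = Y.act a (φ v) := by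
  induction a using MonoidAlgebra.induction_on with
  | of g => simp [act_single, h g]
  | add a b ha hb => simp [ha, hb]
  | smul c a ha => simp [ha]

lemma InB.of_surj {X Y : Rp K Q} {f : MonoidAlgebra K Q} (hX : InB f X) {φ : X.V →ₗ[K] Y.V}
    (h : IsHom X Y φ) (hs : Function.Surjective φ) : InB f Y := by
  apply LinearMap.ext; intro v
  obtain ⟨v, rfl⟩ := hs v
  rw [← h.act, show X.act f = 1 from hX]; rfl

lemma InB.of_inj {X Y : Rp K Q} {f : MonoidAlgebra K Q} (hY : InB f Y) {φ : X.V →ₗ[K] Y.V}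
    (h : IsHom X Y φ) (hs : Function.Injective φ) : InB f X := by
  apply LinearMap.ext; intro v
  apply hs
  rw [h.act, show Y.act f = 1 from hY]; rfl

lemma InB.iso {X Y : Rp K Q} {f : MonoidAlgebra K Q} (hX : InB f X) (h : Iso X Y) : InB f Y := by
  obtain ⟨φ, h⟩ := h
  exact hX.of_surj h φ.surjective

lemma InB.tw [Fintype Q] {X : Rp K Q} {f : MonoidAlgebra K Q} (hX : InB f X) {χ : Q →* Kˣ}
    (hχ : ∀ g, f.coeff g ≠ 0 → χ g = 1) : InB f (X.tw χ) := by
  unfold InB at *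
  rw [← hX, act_eq_sum, act_eq_sum]
  refine Finset.sum_congr rfl fun g _ => ?_
  by_cases h : f.coeff g = 0
  · rw [h, zero_smul, zero_smul]
  · change f.coeff g • (χ g : K) • X.ρ g = _
    rw [hχ g h]; simp

lemma act_pull {Q' : Type} [Group Q'] (X : Rp K Q) (π : Q' →* Q) (a : MonoidAlgebra K Q') :
    (X.pull π).act a = X.act (MonoidAlgebra.mapDomainAlgHom K K π a) := by
  induction a using MonoidAlgebra.induction_on with
  | of g => simp [act_single]
  | add a b ha hb => simp only [map_add, ha, hb]
  | smul c a ha => simp only [map_smul, ha]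

/-- Central elements act by endomorphisms. -/
lemma isHom_act (X : Rp K Q) {f : MonoidAlgebra K Q} (hf : ∀ g, cjA K Q g f = f) :
    IsHom X X (X.act f) := by
  rw [isHom_iff_cj]
  intro g
  rw [← act_cjA, hf]

/-- Relative projectivity, witnessed by a trace of the identity. -/
def RelP [Fintype Q] (d : Q) (X : Rp K Q) : Prop :=
  ∃ (α : X.V →ₗ[K] X.V) (w : Q → K), cj X X d α = α ∧ IsWt d w ∧
    LinearMap.id = ∑ g, w g • cj X X g α

lemma RelTr.relP [Fintype Q] {d : Q} {f : MonoidAlgebra K Q} (h : RelTr d f) {X : Rp K Q}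
    (hX : InB f X) : RelP d X := by
  obtain ⟨a, w, ha, hw, hf⟩ := h
  refine ⟨X.act a, w, by rw [← act_cjA, ha], hw, ?_⟩
  simp_rw [← act_cjA]
  rw [show (LinearMap.id : X.V →ₗ[K] X.V) = X.act f from hX.symm, hf]
  simp

variable [Fintype Q] {d : Q} {X Y : Rp K Q}

lemma null_of_wt {w : Q → K} (hw : IsWt d w) (ψ : X.V →ₗ[K] Y.V) :
    ∑ g, w g • cj X Y g (∑ j ∈ Finset.range (orderOf d), cj X Y (d ^ j) ψ) = ∑ g, cj X Y g ψ := by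
  simp_rw [map_sum, ← cj_mul, Finset.smul_sum]
  rw [Finset.sum_comm]
  have e : ∀ j, ∑ g, w g • cj X Y (g * d ^ j) ψ = ∑ g, w (g * (d ^ j)⁻¹) • cj X Y g ψ := fun j => by
    refine Fintype.sum_equiv (Equiv.mulRight (d ^ j)) _ _ fun g => ?_
    simp
  simp_rw [e]
  rw [Finset.sum_comm]
  refine Finset.sum_congr rfl fun g _ => ?_
  rw [← Finset.sum_smul, hw.sum_inv, one_smul]

/-- Homomorphisms out of a relatively projective representation are null as soon as they are
null on the cyclic subgroup. -/
lemma RelP.null_of_nullOn (hX : RelP d X) {φ : X.V →ₗ[K] Y.V} (h : IsHom X Y φ)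
    (hn : NullOn d X Y φ) : Null X Y φ := by
  obtain ⟨α, w, hα, hw, hid⟩ := hX
  obtain ⟨ψ, hψ⟩ := hn.comp_right hα
  refine ⟨ψ, ?_⟩
  rw [← null_of_wt hw, ← hψ]
  conv_lhs => rw [← LinearMap.comp_id φ, hid]
  have : ∀ g, cj X Y g (φ ∘ₗ α) = φ ∘ₗ cj X X g α := fun g => by
    rw [cj_comp (Y := X), h.cj]
  simp_rw [this]
  ext v; simp

lemma Null.nullOn {φ : X.V →ₗ[K] Y.V} (h : Null X Y φ) : NullOn d X Y φ := by
  obtain ⟨ψ, rfl⟩ := h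
  obtain ⟨w, hw⟩ := exists_isWt K d
  refine ⟨∑ g, w g⁻¹ • cj X Y g ψ, ?_⟩
  simp_rw [map_sum, map_smul, ← cj_mul]
  rw [Finset.sum_comm]
  have h1 : ∑ x, ∑ j ∈ Finset.range (orderOf d), w x⁻¹ • cj X Y (d ^ j * x) ψ
      = ∑ j ∈ Finset.range (orderOf d), ∑ x, w (x⁻¹ * d ^ j) • cj X Y x ψ := by
    rw [Finset.sum_comm]
    refine Finset.sum_congr rfl fun j _ => ?_
    refine Fintype.sum_equiv (Equiv.mulLeft (d ^ j)) _ _ fun g => ?_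
    simp
  rw [h1, Finset.sum_comm]
  refine Finset.sum_congr rfl fun g _ => ?_
  rw [← Finset.sum_smul, hw, one_smul]

/-- Restriction of cohomology to the cyclic subgroup is injective on relatively projective
representations. -/
lemma RelP.cob_of_cobOn (hX : RelP d X) {c : Q → (X.V →ₗ[K] Y.V)} (hc : IsCoc X Y c)
    {b : X.V →ₗ[K] Y.V} (hb : c d = cj X Y d b - b) : IsCob X Y c := by
  obtain ⟨α, w, hα, hw, hid⟩ := hX
  let s : Q → (X.V →ₗ[K] Y.V) := fun g => cj X Y g b - c g
  have hs : ∀ g, s (g * d) = s g := fun g => by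
    simp only [s, hc g d, hb, cj_mul, map_sub]; abel
  have hs' : ∀ h g, cj X Y h (s g) = s (h * g) + c h := fun h g => by
    simp only [s, hc h g, cj_mul, map_sub]; abel
  refine ⟨∑ g, w g • (s g ∘ₗ cj X X g α), fun h => ?_⟩
  let Φ : Q → (X.V →ₗ[K] Y.V) := fun g => s g ∘ₗ cj X X g α
  have hΦ : ∀ g, Φ (g * d) = Φ g := fun g => by
    simp only [Φ, hs, cj_mul, hα]
  have e1 : ∀ g, cj X Y h (s g ∘ₗ cj X X g α) = Φ (h * g) + c h ∘ₗ cj X X (h * g) α := fun g => by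
    rw [cj_comp (Y := X), hs', ← cj_mul, LinearMap.add_comp]
  simp_rw [map_sum, map_smul, e1, smul_add, Finset.sum_add_distrib]
  have e2 : ∑ g, w g • Φ (h * g) = ∑ g, w (h⁻¹ * g) • Φ g :=
    Fintype.sum_equiv (Equiv.mulLeft h) _ _ fun g => by simp
  have e3 : ∑ g, w g • (c h ∘ₗ cj X X (h * g) α) = c h := by
    have : cj X X h LinearMap.id = LinearMap.id := (IsHom.id X).cj h
    conv_rhs => rw [← LinearMap.comp_id (c h), ← this, hid]
    simp_rw [map_sum, map_smul, ← cj_mul]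
    ext v; simp
  rw [e2, e3, (hw.translate h⁻¹).sum_eq hw hΦ]
  simp [Φ]

lemma IsCoc.cobOn_of_nullOn_left {Z : Rp K Q} {c : Q → (X.V →ₗ[K] Y.V)} (hc : IsCoc X Y c)
    {α : Y.V →ₗ[K] Z.V} (hα : NullOn d Y Z α) : ∃ b, α ∘ₗ c d = cj X Z d b - b := by
  obtain ⟨ψ, rfl⟩ := hα
  let F : Q → (X.V →ₗ[K] Z.V) := fun g => cj Y Z g ψ ∘ₗ c g
  let F' : Q → (X.V →ₗ[K] Z.V) := fun g => cj Y Z g ψ ∘ₗ c d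
  refine ⟨-∑ j ∈ Finset.range (orderOf d), F (d ^ j), ?_⟩
  have h1 : ∀ j, cj X Z d (F (d ^ j)) = F (d ^ (j + 1)) - F' (d ^ (j + 1)) := fun j => by
    simp only [F, F']
    rw [cj_comp (Y := Y), ← cj_mul, pow_succ', hc d, LinearMap.comp_add, add_sub_cancel_left]
  rw [map_neg, map_sum]
  simp_rw [h1]
  rw [Finset.sum_sub_distrib, sum_pow_succ d F, sum_pow_succ d F']
  ext v; simp [F']

lemma IsCoc.cobOn_of_nullOn_right {Z : Rp K Q} {c : Q → (Y.V →ₗ[K] Z.V)} (hc : IsCoc Y Z c)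
    {α : X.V →ₗ[K] Y.V} (hα : NullOn d X Y α) : ∃ b, c d ∘ₗ α = cj X Z d b - b := by
  obtain ⟨ψ, rfl⟩ := hα
  let F : Q → (X.V →ₗ[K] Z.V) := fun g => c g ∘ₗ cj X Y g ψ
  let F' : Q → (X.V →ₗ[K] Z.V) := fun g => c d ∘ₗ cj X Y g ψ
  refine ⟨-∑ j ∈ Finset.range (orderOf d), F (d ^ j), ?_⟩
  have h1 : ∀ j, cj X Z d (F (d ^ j)) = F (d ^ (j + 1)) - F' (d ^ (j + 1)) := fun j => by
    simp only [F, F']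
    rw [cj_comp (Y := Y), ← cj_mul, pow_succ', hc d, LinearMap.add_comp, add_sub_cancel_left]
  rw [map_neg, map_sum]
  simp_rw [h1]
  rw [Finset.sum_sub_distrib, sum_pow_succ d F, sum_pow_succ d F']
  ext v; simp [F']

end Act

end Rp

/-! ### The normalizer of the bottom layer of a cyclic `p`-group -/

section Local

variable {K Q : Type} [Field K] [Group Q] [Fintype Q]

/-- Weighted sums over a set on which the cyclic group acts freely from both sides are traces. -/
lemma exists_trace_of_free {M : Type} [AddCommGroup M] [Module K M] (τ : Representation K Q M)
    {d : Q} {Φ : Q → M} (hr : ∀ g, Φ (g * d) = Φ g) (hl : ∀ g, Φ (d * g) = τ d (Φ g))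
    {w : Q → K} (hw : IsWt d w) (S : Set Q) (hSl : ∀ g, d * g ∈ S ↔ g ∈ S)
    (hSr : ∀ g, g * d ∈ S ↔ g ∈ S)
    (hfree : ∀ g ∈ S, ∀ x ∈ Subgroup.zpowers d, ∀ y ∈ Subgroup.zpowers d, x * g * y = g → x = 1) :
    ∃ u, ∑ g, (if g ∈ S then w g • Φ g else 0) =
      ∑ j ∈ Finset.range (orderOf d), τ (d ^ j) u := by
  have hd : 0 < orderOf d := orderOf_pos d
  obtain ⟨w2, hw2⟩ := exists_weight K (ι := Fin (orderOf d) × Fin (orderOf d)) S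
    (DoubleCoset.setoid (Subgroup.zpowers d : Set Q) (Subgroup.zpowers d : Set Q))
    (fun i g => d ^ (i.1 : ℕ) * g * d ^ (i.2 : ℕ))
    (fun g i => by
      rw [DoubleCoset.rel_iff]
      exact ⟨_, Subgroup.npow_mem_zpowers d i.1, _, Subgroup.npow_mem_zpowers d i.2, rfl⟩)
    (fun g hg g' h => by
      rw [DoubleCoset.rel_iff] at h
      obtain ⟨x, hx, y, hy, rfl⟩ := h
      obtain ⟨i, hi, rfl⟩ := Finset.mem_image.1 (mem_zpowers_iff_mem_range_orderOf.1 hx)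
      obtain ⟨j, hj, rfl⟩ := Finset.mem_image.1 (mem_zpowers_iff_mem_range_orderOf.1 hy)
      refine ⟨(⟨i, Finset.mem_range.1 hi⟩, ⟨j, Finset.mem_range.1 hj⟩), rfl, ?_⟩
      rintro ⟨i', j'⟩ h
      have e1 : (d ^ i)⁻¹ * d ^ (i' : ℕ) * g * (d ^ (j' : ℕ) * (d ^ j)⁻¹) = g := by
        have : d ^ (i' : ℕ) * g * d ^ (j' : ℕ) = d ^ i * g * d ^ j := h
        calc _ = (d ^ i)⁻¹ * (d ^ (i' : ℕ) * g * d ^ (j' : ℕ)) * (d ^ j)⁻¹ := by group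
          _ = _ := by rw [this]; group
      have e2 := hfree g hg _ (mul_mem (inv_mem hx) (Subgroup.npow_mem_zpowers d i')) _
        (mul_mem (Subgroup.npow_mem_zpowers d j') (inv_mem hy)) e1
      rw [e2, one_mul] at e1
      have e3 := mul_eq_left.1 e1
      exact Prod.ext
        (Fin.ext (pow_injOn_Iio_orderOf i'.2 (Finset.mem_range.1 hi) (inv_mul_eq_one.1 e2).symm))
        (Fin.ext (pow_injOn_Iio_orderOf j'.2 (Finset.mem_range.1 hj) (mul_inv_eq_one.1 e3))))
  simp_rw [Fintype.sum_prod_type] at hw2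
  have hSr' : ∀ g (j : ℕ), g * d ^ j ∈ S ↔ g ∈ S := fun g j => by
    induction j with
    | zero => simp
    | succ j ih => rw [pow_succ, ← mul_assoc, hSr, ih]
  have hSl' : ∀ g (j : ℕ), d ^ j * g ∈ S ↔ g ∈ S := fun g j => by
    induction j with
    | zero => simp
    | succ j ih => rw [pow_succ', mul_assoc, hSl, ih]
  have hl' : ∀ g (j : ℕ), Φ (d ^ j * g) = τ (d ^ j) (Φ g) := fun g j => by
    induction j with
    | zero => simp
    | succ j ih => rw [pow_succ', mul_assoc, hl, ih, map_mul]; rfl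
  let w1 : Q → K := fun g => if g ∈ S then ∑ i ∈ Finset.range (orderOf d), w2 (d ^ i * g) else w g
  have hw1 : IsWt d w1 := fun g => by
    by_cases hg : g ∈ S
    · simp only [w1, hSr', if_pos hg]
      rw [Finset.sum_comm, ← hw2 g hg, Finset.sum_range]
      refine Finset.sum_congr rfl fun i _ => ?_
      rw [Finset.sum_range]
      simp only [mul_assoc]
    · simp only [w1, hSr', if_neg hg]
      exact hw g
  let Φ' : Q → M := fun g => if g ∈ S then Φ g else 0
  have hΦ' : ∀ g, Φ' (g * d) = Φ' g := fun g => by simp only [Φ', hSr, hr]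
  have e0 : ∀ w : Q → K, ∀ g, (if g ∈ S then w g • Φ g else 0) = w g • Φ' g := fun w g => by
    simp only [Φ']; split_ifs <;> simp
  refine ⟨∑ g, w2 g • Φ' g, ?_⟩
  simp_rw [e0]
  rw [hw.sum_eq hw1 hΦ', ← sum_pow_inv d (fun x => τ x (∑ g, w2 g • Φ' g))]
  have e1 : ∀ g, w1 g • Φ' g = ∑ i ∈ Finset.range (orderOf d), w2 (d ^ i * g) • Φ' g := fun g => by
    simp only [w1, Φ']
    split_ifs
    · rw [Finset.sum_smul]
    · simp
  simp_rw [e1]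
  rw [Finset.sum_comm]
  refine Finset.sum_congr rfl fun i _ => ?_
  rw [map_sum]
  refine Fintype.sum_equiv (Equiv.mulLeft (d ^ i)) _ _ fun g => ?_
  simp only [Equiv.coe_mulLeft, map_smul, Φ', hSl', hl']
  congr 1
  split_ifs
  · rw [← Module.End.mul_apply, ← map_mul]; simp
  · simp

/-- The data of a cyclic group `⟨d⟩` with a smallest non-trivial subgroup `⟨z⟩`. -/
structure Bot (K : Type) [Field K] (d z : Q) : Prop where
  mem : z ∈ Subgroup.zpowers d
  le : ∀ x ∈ Subgroup.zpowers d, x ≠ 1 → z ∈ Subgroup.zpowers x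
  ne : z ≠ 1
  char : (orderOf z : K) = 0

variable {d z : Q}

/-- The normalizer of `⟨z⟩`. -/
abbrev Nz (z : Q) : Subgroup Q := Subgroup.normalizer (Subgroup.zpowers z : Set Q)

lemma Bot.comm (h : Bot K d z) {x : Q} (hx : x ∈ Subgroup.zpowers d) : z * x = x * z := by
  obtain ⟨i, rfl⟩ := Subgroup.mem_zpowers_iff.1 hx
  obtain ⟨j, rfl⟩ := Subgroup.mem_zpowers_iff.1 h.mem
  rw [← zpow_add, ← zpow_add, add_comm]

lemma mem_Nz_of_comm {x : Q} (h : z * x = x * z) : x ∈ Nz z := by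
  apply Subgroup.centralizer_le_normalizer
  rw [Subgroup.mem_centralizer_iff]
  intro y hy
  obtain ⟨j, rfl⟩ := Subgroup.mem_zpowers_iff.1 hy
  exact (show Commute z x from h).zpow_left j

lemma Bot.d_mem (h : Bot K d z) : d ∈ Nz z := mem_Nz_of_comm (h.comm (Subgroup.mem_zpowers d))

lemma Bot.free (h : Bot K d z) {g x : Q} (hg : g ∉ Nz z) (hx : x ∈ Subgroup.zpowers d)
    (hy : g⁻¹ * x * g ∈ Subgroup.zpowers d) : x = 1 := by
  by_contra hx1
  apply hg
  have h1 : z ∈ Subgroup.zpowers x := h.le x hx hx1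
  have h2 : g⁻¹ * z * g ∈ Subgroup.zpowers d := by
    obtain ⟨j, hj⟩ := Subgroup.mem_zpowers_iff.1 h1
    have : g⁻¹ * z * g = (g⁻¹ * x * g) ^ j := by
      rw [← hj]; simpa using (conj_zpow (i := j) (a := g⁻¹) (b := x)).symm
    rw [this]; exact zpow_mem hy j
  have h3 : z ∈ Subgroup.zpowers (g⁻¹ * z * g) := h.le _ h2 (fun h0 => h.ne (by
    simpa [mul_assoc, inv_mul_eq_one] using h0))
  have h4 : Subgroup.zpowers z = Subgroup.zpowers (g⁻¹ * z * g) := by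
    refine Subgroup.eq_of_le_of_card_ge (by rwa [Subgroup.zpowers_le]) ?_
    rw [Nat.card_zpowers, Nat.card_zpowers]
    have := orderOf_injective (MulAut.conj g⁻¹).toMonoidHom (MulAut.conj g⁻¹).injective z
    simp at this
    rw [this]
  rw [← inv_mem_iff (x := g), Subgroup.mem_normalizer_iff]
  intro y
  have h5 : Subgroup.zpowers (g⁻¹ * z * g) = (Subgroup.zpowers z).map (MulAut.conj g⁻¹).toMonoidHom := by
    rw [MonoidHom.map_zpowers]; simp
  conv_rhs => rw [h4, h5]
  rw [Subgroup.mem_map]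
  constructor
  · intro hy'; exact ⟨y, hy', by simp⟩
  · rintro ⟨y', hy', he⟩
    have : y' = y := by simpa using he
    rwa [← this]

/-- The part of an element supported on the centralizer of `z`. -/
def flt (K : Type) [Field K] (z : Q) : MonoidAlgebra K Q →ₗ[K] MonoidAlgebra K Q where
  toFun a := ∑ x, MonoidAlgebra.single x (if z * x = x * z then a.coeff x else 0)
  map_add' a b := by
    rw [← Finset.sum_add_distrib]
    refine Finset.sum_congr rfl fun x _ => ?_
    rw [← MonoidAlgebra.single_add]; split_ifs <;> simp
  map_smul' c a := by
    rw [Finset.smul_sum]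
    refine Finset.sum_congr rfl fun x _ => ?_
    split_ifs <;> simp

lemma sum_single_coeff (F : Q → K) (y : Q) :
    (∑ x, MonoidAlgebra.single x (F x)).coeff y = F y := by
  rw [MonoidAlgebra.coeff_sum, Finsupp.finsetSum_apply]
  simp [Finsupp.single_apply]

lemma flt_coeff (a : MonoidAlgebra K Q) (x : Q) :
    (flt K z a).coeff x = if z * x = x * z then a.coeff x else 0 :=
  sum_single_coeff _ x

lemma flt_cjA {g : Q} (hg : g ∈ Nz z) (a : MonoidAlgebra K Q) :
    flt K z (cjA K Q g a) = cjA K Q g (flt K z a) := by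
  ext x
  rw [flt_coeff, cjA_coeff, cjA_coeff, flt_coeff]
  have key : ∀ g ∈ Nz z, ∀ x, z * x = x * z → z * (g⁻¹ * x * g) = g⁻¹ * x * g * z := by
    intro g hg x hx
    have h1 : g * z * g⁻¹ ∈ Subgroup.zpowers z :=
      (Subgroup.mem_normalizer_iff.1 hg z).1 (Subgroup.mem_zpowers z)
    obtain ⟨j, hj⟩ := Subgroup.mem_zpowers_iff.1 h1
    have h2 : z ^ j * x = x * z ^ j := (show Commute z x from hx).zpow_left j
    rw [hj] at h2
    calc z * (g⁻¹ * x * g) = g⁻¹ * (g * z * g⁻¹ * x) * g := by group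
      _ = _ := by rw [h2]; group
  have : z * x = x * z ↔ z * (g⁻¹ * x * g) = g⁻¹ * x * g * z := by
    refine ⟨key g hg x, fun h => ?_⟩
    have := key g⁻¹ (inv_mem hg) _ h
    simpa [mul_assoc] using this
  simp only [this]

lemma Bot.sum_eq_zero (h : Bot K d z) {M : Type} [AddCommGroup M] [Module K M] {F : Q → M}
    (hF : ∀ y ∈ Subgroup.zpowers d, F (y * z) = F y) :
    ∑ j ∈ Finset.range (orderOf d), F (d ^ j) = 0 := by
  rw [sum_pow_eq_ite]
  let F' : Q → M := fun x => if x ∈ Subgroup.zpowers d then F x else 0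
  have hF' : ∀ g, F' (g * z) = F' g := fun g => by
    simp only [F', Subgroup.mul_mem_cancel_right _ h.mem]
    split_ifs with hg
    · exact hF g hg
    · rfl
  change ∑ x, F' x = 0
  obtain ⟨w, hw⟩ := exists_isWt K z
  have e1 : ∀ x, F' x = ∑ j ∈ Finset.range (orderOf z), w (x * z ^ j) • F' (x * z ^ j) := fun x => by
    simp_rw [pow_right_invariant hF', ← Finset.sum_smul, hw x, one_smul]
  rw [Finset.sum_congr rfl fun x _ => e1 x]
  rw [Finset.sum_comm]
  have e2 : ∀ j, ∑ x, w (x * z ^ j) • F' (x * z ^ j) = ∑ x, w x • F' x := fun j =>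
    Fintype.sum_equiv (Equiv.mulRight (z ^ j)) _ _ fun x => by simp
  simp_rw [e2, Finset.sum_const, Finset.card_range]
  rw [← Nat.cast_smul_eq_nsmul K, h.char, zero_smul]

lemma Bot.flt_tr (h : Bot K d z) (u : MonoidAlgebra K Q) :
    flt K z (∑ j ∈ Finset.range (orderOf d), cjA K Q (d ^ j) u) = 0 := by
  ext x
  rw [flt_coeff]
  split_ifs with hx
  · rw [MonoidAlgebra.coeff_sum, Finsupp.finsetSum_apply]
    simp_rw [cjA_coeff]
    rw [h.sum_eq_zero (F := fun y => u.coeff (y⁻¹ * x * y))]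
    · rfl
    · intro y hy
      rw [← h.comm hy]
      congr 1
      calc (z * y)⁻¹ * x * (z * y) = y⁻¹ * (z⁻¹ * (x * z)) * y := by group
        _ = _ := by rw [← hx]; group
  · rfl

lemma Bot.sub_flt (h : Bot K d z) {a : MonoidAlgebra K Q} (ha : cjA K Q d a = a) :
    ∃ u, a - flt K z a = ∑ j ∈ Finset.range (orderOf d), cjA K Q (d ^ j) u := by
  have hd : 0 < orderOf d := orderOf_pos d
  let r : Setoid Q :=
    { r := fun x y => ∃ t ∈ Subgroup.zpowers d, t⁻¹ * x * t = y
      iseqv :=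
        { refl := fun x => ⟨1, one_mem _, by simp⟩
          symm := by
            rintro x y ⟨t, ht, rfl⟩
            exact ⟨t⁻¹, inv_mem ht, by group⟩
          trans := by
            rintro x y w ⟨t, ht, rfl⟩ ⟨t', ht', rfl⟩
            exact ⟨t * t', mul_mem ht ht', by group⟩ } }
  obtain ⟨w, hw⟩ := exists_weight K (ι := Fin (orderOf d)) {x : Q | ¬ z * x = x * z} r
    (fun i x => (d ^ (i : ℕ))⁻¹ * x * d ^ (i : ℕ))
    (fun x i => ⟨_, Subgroup.npow_mem_zpowers d i, rfl⟩)
    (fun x hx y hxy => by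
      obtain ⟨t, ht, rfl⟩ := hxy
      obtain ⟨i, hi, rfl⟩ := Finset.mem_image.1 (mem_zpowers_iff_mem_range_orderOf.1 ht)
      refine ⟨⟨i, Finset.mem_range.1 hi⟩, rfl, fun j hj => ?_⟩
      refine Fin.ext (pow_injOn_Iio_orderOf j.2 (Finset.mem_range.1 hi) ?_)
      have hj' : (d ^ (j : ℕ))⁻¹ * x * d ^ (j : ℕ) = (d ^ i)⁻¹ * x * d ^ i := hj
      by_contra hne
      apply hx
      have hc : Commute (d ^ (j : ℕ) * (d ^ i)⁻¹) x := by
        change d ^ (j : ℕ) * (d ^ i)⁻¹ * x = x * (d ^ (j : ℕ) * (d ^ i)⁻¹)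
        calc d ^ (j : ℕ) * (d ^ i)⁻¹ * x = d ^ (j : ℕ) * ((d ^ i)⁻¹ * x * d ^ i) * (d ^ i)⁻¹ := by
              group
          _ = _ := by rw [← hj']; group
      have hz := h.le _ (mul_mem (Subgroup.npow_mem_zpowers d j) (inv_mem ht))
        (fun h0 => hne (mul_inv_eq_one.1 h0))
      obtain ⟨l, hl⟩ := Subgroup.mem_zpowers_iff.1 hz
      rw [← hl]
      exact hc.zpow_left l)
  have ha' : ∀ j x, a.coeff ((d ^ j)⁻¹ * x * d ^ j) = a.coeff x := fun j x => by
    have : cjA K Q (d ^ j) a = a := by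
      induction j with
      | zero => simp
      | succ j ih => rw [pow_succ, map_mul, Module.End.mul_apply, ha, ih]
    rw [← cjA_coeff, this]
  have hc : ∀ j x, (z * ((d ^ j)⁻¹ * x * d ^ j) = (d ^ j)⁻¹ * x * d ^ j * z) ↔ z * x = x * z :=
    fun j x => by
    have hz := h.comm (Subgroup.npow_mem_zpowers d j)
    have hz' := h.comm (inv_mem (Subgroup.npow_mem_zpowers d j))
    have e1 : z * ((d ^ j)⁻¹ * x * d ^ j) = (d ^ j)⁻¹ * (z * x) * d ^ j := by
      rw [← mul_assoc, ← mul_assoc, hz']; group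
    have e2 : (d ^ j)⁻¹ * x * d ^ j * z = (d ^ j)⁻¹ * (x * z) * d ^ j := by
      rw [mul_assoc _ (d ^ j) z, ← hz]; group
    rw [e1, e2]; simp
  refine ⟨∑ x, MonoidAlgebra.single x (if z * x = x * z then 0 else w x * a.coeff x), ?_⟩
  ext x
  rw [MonoidAlgebra.coeff_sub, Finsupp.sub_apply, flt_coeff, MonoidAlgebra.coeff_sum,
    Finsupp.finsetSum_apply]
  simp_rw [cjA_coeff, sum_single_coeff, ha', hc]
  split_ifs with hx
  · simp
  · rw [← Finset.sum_mul, Finset.sum_range, hw x hx]; simp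

lemma flt_flt_mul (a b : MonoidAlgebra K Q) :
    flt K z (flt K z a * flt K z b) = flt K z a * flt K z b := by
  have e : ∀ a, flt K z a = ∑ x, MonoidAlgebra.single x (if z * x = x * z then a.coeff x else 0) :=
    fun _ => rfl
  rw [e a, e b, Finset.sum_mul_sum, map_sum]
  refine Finset.sum_congr rfl fun x _ => ?_
  rw [map_sum]
  refine Finset.sum_congr rfl fun y _ => ?_
  rw [MonoidAlgebra.single_mul_single]
  ext t
  rw [flt_coeff]
  by_cases h1 : z * x = x * z
  · by_cases h2 : z * y = y * z
    · split_ifs with ht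
      · rfl
      · rw [MonoidAlgebra.coeff_single, Finsupp.single_apply, if_neg]
        rintro rfl
        exact ht (show Commute z (x * y) from Commute.mul_right h1 h2)
    · simp [h2]
  · simp [h1]

lemma Bot.flt_mul (h : Bot K d z) {a b : MonoidAlgebra K Q} (ha : cjA K Q d a = a)
    (hb : cjA K Q d b = b) : flt K z (a * b) = flt K z a * flt K z b := by
  obtain ⟨u, hu⟩ := h.sub_flt ha
  obtain ⟨v, hv⟩ := h.sub_flt hb
  have hfa : cjA K Q d (flt K z a) = flt K z a := by rw [← flt_cjA h.d_mem, ha]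
  have hpow : ∀ {c : MonoidAlgebra K Q}, cjA K Q d c = c → ∀ j : ℕ, cjA K Q (d ^ j) c = c := by
    intro c hc j
    induction j with
    | zero => simp
    | succ j ih => rw [pow_succ, map_mul, Module.End.mul_apply, hc, ih]
  have e1 : flt K z ((a - flt K z a) * b) = 0 := by
    rw [hu, Finset.sum_mul]
    have : ∀ j, cjA K Q (d ^ j) u * b = cjA K Q (d ^ j) (u * b) := fun j => by
      rw [cjA_mul, hpow hb]
    simp_rw [this]
    exact h.flt_tr _
  have e2 : flt K z (flt K z a * (b - flt K z b)) = 0 := by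
    rw [hv, Finset.mul_sum]
    have : ∀ j, flt K z a * cjA K Q (d ^ j) v = cjA K Q (d ^ j) (flt K z a * v) := fun j => by
      rw [cjA_mul, hpow hfa]
    simp_rw [this]
    exact h.flt_tr _
  have : a * b = (a - flt K z a) * b + flt K z a * (b - flt K z b) + flt K z a * flt K z b := by
    noncomm_ring
  rw [this, map_add, map_add, e1, e2, flt_flt_mul, zero_add, zero_add]

/-- Restriction of coefficients to a subgroup. -/
def resA (H : Subgroup Q) : MonoidAlgebra K Q →ₗ[K] MonoidAlgebra K H where
  toFun a := ∑ x : H, MonoidAlgebra.single x (a.coeff x)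
  map_add' a b := by simp [Finset.sum_add_distrib, MonoidAlgebra.single_add]
  map_smul' c a := by simp [Finset.smul_sum]

lemma resA_coeff (H : Subgroup Q) (a : MonoidAlgebra K Q) (x : H) :
    (resA H a).coeff x = a.coeff x := sum_single_coeff _ x

lemma resA_cjA (H : Subgroup Q) (h : H) (a : MonoidAlgebra K Q) :
    resA H (cjA K Q (h : Q) a) = cjA K H h (resA H a) := by
  ext x
  rw [resA_coeff, cjA_coeff, cjA_coeff, resA_coeff]
  rfl

lemma sum_subgroup {M : Type} [AddCommGroup M] (H : Subgroup Q) (F : Q → M) :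
    ∑ g : H, F g = ∑ g, if g ∈ H then F g else 0 := by
  rw [← Finset.sum_filter]
  exact (Finset.sum_subtype _ (by simp) F).symm

lemma mapDomain_resA (H : Subgroup Q) {a : MonoidAlgebra K Q} (ha : ∀ x, x ∉ H → a.coeff x = 0) :
    MonoidAlgebra.mapDomainAlgHom K K H.subtype (resA H a) = a := by
  change MonoidAlgebra.mapDomainAlgHom K K H.subtype (∑ x : H, MonoidAlgebra.single x (a.coeff x)) = a
  rw [map_sum]
  simp only [MonoidAlgebra.mapDomainAlgHom_apply, MonoidAlgebra.mapDomain_single,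
    Subgroup.subtype_apply]
  rw [sum_subgroup H (fun x => MonoidAlgebra.single x (a.coeff x))]
  have : ∀ g, (if g ∈ H then MonoidAlgebra.single g (a.coeff g) else 0)
      = MonoidAlgebra.single g (a.coeff g) := fun g => by
    split_ifs with hg
    · rfl
    · rw [ha g hg]; simp
  simp_rw [this]
  ext x
  rw [sum_single_coeff]

end Local

/-! ### Passage to the normalizer -/

section Passage

variable {K Q : Type} [Field K] [Group Q] [Fintype Q] {d z : Q}

lemma Bot.Nz_left (h : Bot K d z) (g : Q) : d * g ∈ Nz z ↔ g ∈ Nz z :=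
  Subgroup.mul_mem_cancel_left _ h.d_mem

lemma Bot.Nz_right (h : Bot K d z) (g : Q) : g * d ∈ Nz z ↔ g ∈ Nz z :=
  Subgroup.mul_mem_cancel_right _ h.d_mem

/-- A relative trace differs by a trace from the partial sum over the normalizer. -/
lemma Bot.exists_trace (h : Bot K d z) {M : Type} [AddCommGroup M] [Module K M]
    (τ : Representation K Q M) {w : Q → K} (hw : IsWt d w) {a : M} (ha : τ d a = a) :
    ∃ u, ∑ g, w g • τ g a - ∑ g, (if g ∈ Nz z then w g • τ g a else 0)
      = ∑ j ∈ Finset.range (orderOf d), τ (d ^ j) u := by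
  obtain ⟨u, hu⟩ := exists_trace_of_free τ (d := d) (Φ := fun g => τ g a) (w := w)
    (fun g => by simp only [map_mul, Module.End.mul_apply, ha])
    (fun g => by simp only [map_mul, Module.End.mul_apply]) hw {g | g ∉ Nz z}
    (fun g => not_congr (h.Nz_left g)) (fun g => not_congr (h.Nz_right g))
    (fun g hg x hx y hy hxy => h.free (g := g) hg hx (by
      have : g⁻¹ * x * g = y⁻¹ := by
        rw [← mul_left_inj y, inv_mul_cancel, mul_assoc, mul_assoc, ← mul_assoc x, hxy]; simp
      rw [this]; exact inv_mem hy))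
  refine ⟨u, ?_⟩
  rw [← hu, ← Finset.sum_sub_distrib]
  refine Finset.sum_congr rfl fun g _ => ?_
  by_cases hg : g ∈ Nz z <;> simp [hg]

/-- The local block element. -/
structure LocalElt (d z : Q) (hd : d ∈ Nz z) (f : MonoidAlgebra K Q)
    (ε : MonoidAlgebra K (Nz z)) : Prop where
  central : ∀ g, cjA K (Nz z) g ε = ε
  idem : ε * ε = ε
  relTr : RelTr (⟨d, hd⟩ : Nz z) ε
  supp : ∀ x : Nz z, ε.coeff x ≠ 0 → z * (x : Q) = x * z
  null : ∀ X : Rp K Q, Rp.InB f X →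
    Rp.NullOn d X X (LinearMap.id - (X.pull (Nz z).subtype).act ε)
  lift : ∀ X Y : Rp K Q, Rp.InB f X → Rp.InB f Y → ∀ ψ : X.V →ₗ[K] Y.V,
    Rp.IsHom (X.pull (Nz z).subtype) (Y.pull (Nz z).subtype) ψ →
      ∃ φ : X.V →ₗ[K] Y.V, Rp.IsHom X Y φ ∧ Rp.NullOn d X Y (φ - ψ)

lemma Bot.exists_localElt (h : Bot K d z) {f : MonoidAlgebra K Q} (hf : ∀ g, cjA K Q g f = f)
    (hi : f * f = f) (htr : RelTr d f) :
    ∃ ε, LocalElt d z h.d_mem f ε := by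
  obtain ⟨a, w, ha, hw, hfa⟩ := htr
  obtain ⟨u1, hu1⟩ := h.exists_trace (cjA K Q) hw ha
  obtain ⟨u2, hu2⟩ := h.sub_flt (hf d)
  rw [← hfa] at hu1
  set A1 := ∑ g, (if g ∈ Nz z then w g • cjA K Q g a else 0) with hA1
  have hsum : ∀ u v : MonoidAlgebra K Q, (∑ j ∈ Finset.range (orderOf d), cjA K Q (d ^ j) u)
      - ∑ j ∈ Finset.range (orderOf d), cjA K Q (d ^ j) v
      = ∑ j ∈ Finset.range (orderOf d), cjA K Q (d ^ j) (u - v) := fun u v => by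
    simp only [map_sub, Finset.sum_sub_distrib]
  have hfA : A1 - flt K z f = ∑ j ∈ Finset.range (orderOf d), cjA K Q (d ^ j) (u2 - u1) := by
    rw [← hsum, ← hu1, ← hu2]; abel
  have hcent : ∀ x, x ∉ Nz z → ∀ b, (flt K z b).coeff x = 0 := fun x hx b => by
    rw [flt_coeff, if_neg]
    exact fun hx' => hx (mem_Nz_of_comm hx')
  have heq : flt K z f = ∑ g, (if g ∈ Nz z then w g • cjA K Q g (flt K z a) else 0) := by
    have e1 : flt K z f = flt K z A1 := by
      have := congrArg (flt K z) hu1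
      rw [h.flt_tr, map_sub, sub_eq_zero] at this
      exact this
    rw [e1, hA1, map_sum]
    refine Finset.sum_congr rfl fun g _ => ?_
    split_ifs with hg
    · rw [map_smul, flt_cjA hg]
    · rw [map_zero]
  have hmap : MonoidAlgebra.mapDomainAlgHom K K (Nz z).subtype (resA (Nz z) (flt K z f))
      = flt K z f := mapDomain_resA _ fun x hx => hcent x hx f
  have hact : ∀ X : Rp K Q, (X.pull (Nz z).subtype).act (resA (Nz z) (flt K z f))
      = X.act (flt K z f) := fun X => by rw [Rp.act_pull, hmap]
  have hpow : ∀ (X : Rp K Q) (u : MonoidAlgebra K Q),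
      X.act (∑ j ∈ Finset.range (orderOf d), cjA K Q (d ^ j) u)
      = ∑ j ∈ Finset.range (orderOf d), Rp.cj X X (d ^ j) (X.act u) := fun X u => by
    rw [map_sum]; simp_rw [Rp.act_cjA]
  refine ⟨resA (Nz z) (flt K z f), fun g => ?_, ?_, ?_, fun x hx => ?_, fun X hX => ?_,
    fun X Y hX hY ψ hψ => ?_⟩
  · rw [← resA_cjA, ← flt_cjA g.2, hf]
  · have hinj : Function.Injective (MonoidAlgebra.mapDomainAlgHom K K (Nz z).subtype) := by
      intro x y hxy
      exact MonoidAlgebra.mapDomain_injective (Subgroup.subtype_injective _) hxy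
    apply hinj
    rw [map_mul, hmap, ← h.flt_mul (hf d) (hf d), hi]
  · refine ⟨resA (Nz z) (flt K z a), fun x => w x, ?_, fun g => ?_, ?_⟩
    · rw [← resA_cjA, ← flt_cjA h.d_mem, ha]
    · rw [Subgroup.orderOf_mk]
      exact hw g
    · have e : ∀ g : Nz z, w g • cjA K (Nz z) g (resA (Nz z) (flt K z a))
          = resA (Nz z) (w g • cjA K Q g (flt K z a)) := fun g => by rw [map_smul, resA_cjA]
      simp_rw [e]
      rw [← map_sum, sum_subgroup (Nz z) (fun g => w g • cjA K Q g (flt K z a)), ← heq]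
  · rw [resA_coeff, flt_coeff] at hx
    by_contra h0
    exact hx (if_neg h0)
  · rw [hact]
    refine ⟨X.act u2, ?_⟩
    rw [← hpow, ← hu2, map_sub, show X.act f = 1 from hX]
    rfl
  · obtain ⟨v, hv⟩ := h.exists_trace (Rp.cj X Y) hw (a := ψ ∘ₗ X.act a) (by
      rw [Rp.cj_comp (Y := X), ← Rp.act_cjA, ha]
      congr 1
      exact hψ.cj (⟨d, h.d_mem⟩ : Nz z))
    have e1 : ∑ g, (if g ∈ Nz z then w g • Rp.cj X Y g (ψ ∘ₗ X.act a) else 0)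
        = ψ ∘ₗ X.act A1 := by
      rw [hA1, map_sum]
      have : ∀ g, (if g ∈ Nz z then w g • Rp.cj X Y g (ψ ∘ₗ X.act a) else 0)
          = ψ ∘ₗ X.act (if g ∈ Nz z then w g • cjA K Q g a else 0) := fun g => by
        split_ifs with hg
        · rw [Rp.cj_comp (Y := X), ← Rp.act_cjA, map_smul, LinearMap.comp_smul]
          congr 2
          exact hψ.cj (⟨g, hg⟩ : Nz z)
        · rw [map_zero, LinearMap.comp_zero]
      simp_rw [this]
      ext y; simp
    rw [e1] at hv
    have hψd : Rp.cj X Y d ψ = ψ := hψ.cj (⟨d, h.d_mem⟩ : Nz z)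
    refine ⟨∑ g, w g • Rp.cj X Y g (ψ ∘ₗ X.act a), ?_, ?_⟩
    · rw [Rp.isHom_iff_cj]
      intro x
      simp_rw [map_sum, map_smul, ← Rp.cj_mul]
      have hΦ : ∀ g, Rp.cj X Y (g * d) (ψ ∘ₗ X.act a) = Rp.cj X Y g (ψ ∘ₗ X.act a) := fun g => by
        rw [Rp.cj_mul, Rp.cj_comp (Y := X) d, ← Rp.act_cjA, ha, hψd]
      have e := (hw.translate x⁻¹).sum_eq hw (Φ := fun g => Rp.cj X Y g (ψ ∘ₗ X.act a)) hΦ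
      rw [← e]
      exact Fintype.sum_equiv (Equiv.mulLeft x) _ _ fun g => by simp
    · have e2 : ψ ∘ₗ X.act A1 - ψ
          = ψ ∘ₗ X.act (A1 - flt K z f) - ψ ∘ₗ X.act (f - flt K z f) := by
        rw [← LinearMap.comp_sub, ← map_sub]
        have : A1 - flt K z f - (f - flt K z f) = A1 - f := by abel
        rw [this, map_sub, show X.act f = 1 from hX, LinearMap.comp_sub]
        rfl
      have e3 : ∑ g, w g • Rp.cj X Y g (ψ ∘ₗ X.act a) - ψ
          = (∑ g, w g • Rp.cj X Y g (ψ ∘ₗ X.act a) - ψ ∘ₗ X.act A1)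
            + (ψ ∘ₗ X.act (A1 - flt K z f) - ψ ∘ₗ X.act (f - flt K z f)) := by
        rw [← e2]; abel
      rw [e3]
      refine Rp.NullOn.add ⟨v, hv⟩ (Rp.NullOn.sub ?_ ?_)
      · exact Rp.NullOn.comp_left ⟨X.act (u2 - u1), by rw [hfA, hpow]⟩ hψd
      · exact Rp.NullOn.comp_left ⟨X.act u2, by rw [hu2, hpow]⟩ hψd

end Passage

/-! ### Projective covers and local representations -/

namespace Rp

section Covers

variable {K Q : Type} [Field K] [Group Q] [Fintype Q] {X Y Z T : Rp K Q}
  {f : MonoidAlgebra K Q}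

/-- The regular-type representation on functions `Q → X`. -/
abbrev ind (X : Rp K Q) : Rp K Q where
  V := Q → X.V
  ρ :=
    { toFun := fun g =>
        { toFun := fun F x => F (x * g)
          map_add' := fun _ _ => rfl
          map_smul' := fun _ _ => rfl }
      map_one' := by
        apply LinearMap.ext; intro F; funext x
        change F (x * 1) = F x
        rw [mul_one]
      map_mul' := fun g h => by
        apply LinearMap.ext; intro F; funext x
        change F (x * (g * h)) = F (x * g * h)
        rw [mul_assoc] }

lemma proj_ind (X : Rp K Q) : Proj X.ind := by
  let ψ : X.ind.V →ₗ[K] X.ind.V :=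
    LinearMap.single K (fun _ : Q => X.V) 1 ∘ₗ LinearMap.proj 1
  refine ⟨ψ, ?_⟩
  apply LinearMap.ext; intro F
  have h1 : ∀ g x, (cj X.ind X.ind g ψ F : Q → X.V) x = if x = g⁻¹ then F g⁻¹ else 0 :=
    fun g x => by
    refine (congrFun (cj_apply X.ind X.ind g ψ F) x).trans ?_
    change (Pi.single 1 (F (1 * g⁻¹)) : Q → X.V) (x * g) = _
    rw [Pi.single_apply]
    simp only [mul_eq_one_iff_eq_inv, one_mul]
  refine Eq.trans ?_ (LinearMap.sum_apply _ _ _).symm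
  funext x
  refine Eq.trans ?_ (Finset.sum_apply (M := fun _ => X.V) x Finset.univ
    fun g => cj X.ind X.ind g ψ F).symm
  refine Eq.trans ?_ (Finset.sum_congr rfl fun g _ => (h1 g x).symm)
  rw [Finset.sum_eq_single x⁻¹]
  · simp
  · intro g _ hg
    rw [if_neg]
    rintro rfl; exact hg (inv_inv g).symm
  · simp

lemma exists_inj_ind (X : Rp K Q) :
    ∃ j : X.V →ₗ[K] X.ind.V, IsHom X X.ind j ∧ Function.Injective j := by
  refine ⟨LinearMap.pi fun x => X.ρ x, fun g v => funext fun x => ?_, fun v w h => ?_⟩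
  · change X.ρ x (X.ρ g v) = X.ρ (x * g) v
    rw [ρ_mul]
  · have : X.ρ 1 v = X.ρ 1 w := congrFun h 1
    simpa using this

lemma exists_surj_ind (X : Rp K Q) :
    ∃ s : X.ind.V →ₗ[K] X.V, IsHom X.ind X s ∧ Function.Surjective s := by
  let s : X.ind.V →ₗ[K] X.V := ∑ x, X.ρ x⁻¹ ∘ₗ LinearMap.proj x
  have hs : ∀ F, s F = ∑ x, X.ρ x⁻¹ (F x) := fun F => by simp [s]
  refine ⟨s, fun g F => ?_, fun v => ⟨(Pi.single 1 v : Q → X.V), ?_⟩⟩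
  · refine (hs _).trans (Eq.trans ?_ (congrArg (X.ρ g) (hs F)).symm)
    rw [map_sum]
    refine Fintype.sum_equiv (Equiv.mulRight g) _ _ fun x => ?_
    change X.ρ x⁻¹ (F (x * g)) = X.ρ g (X.ρ (x * g)⁻¹ (F (x * g)))
    rw [← ρ_mul]
    simp
  · refine (hs _).trans ?_
    rw [Finset.sum_eq_single 1]
    · simp
    · intro x _ hx
      rw [Pi.single_eq_of_ne hx, map_zero]
    · simp

/-- The part of a representation on which the central idempotent `f` acts as the identity. -/
lemma exists_cut (hf : ∀ g, cjA K Q g f = f) (hi : f * f = f) (M : Rp K Q) :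
    ∃ (M' : Rp K Q) (i : M'.V →ₗ[K] M.V) (r : M.V →ₗ[K] M'.V), InB f M' ∧ IsHom M' M i ∧
      IsHom M M' r ∧ r ∘ₗ i = LinearMap.id ∧ i ∘ₗ r = M.act f := by
  have hh := isHom_act M hf
  have hff : ∀ v, M.act f (M.act f v) = M.act f v := fun v => by
    rw [← Module.End.mul_apply, ← map_mul, hi]
  have hr := hh.codRestrict hh.range (fun v => LinearMap.mem_range_self _ v)
  have hri : (M.act f).codRestrict _ (fun v => LinearMap.mem_range_self (M.act f) v) ∘ₗ
      (LinearMap.range (M.act f)).subtype = LinearMap.id := by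
    apply LinearMap.ext; rintro ⟨_, v, rfl⟩
    exact Subtype.ext (hff v)
  have hir : (LinearMap.range (M.act f)).subtype ∘ₗ
      (M.act f).codRestrict _ (fun v => LinearMap.mem_range_self (M.act f) v) = M.act f := rfl
  refine ⟨M.sub _ hh.range, Submodule.subtype _, _, ?_, isHom_subtype _ _ _, hr, hri, hir⟩
  apply LinearMap.ext; intro v
  apply Subtype.ext
  have := (isHom_subtype M _ hh.range).act f v
  refine this.trans ?_
  obtain ⟨_, v, rfl⟩ := v
  exact hff v

lemma exists_proj_surj (hf : ∀ g, cjA K Q g f = f) (hi : f * f = f) (hX : InB f X) :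
    ∃ (P : Rp K Q) (s : P.V →ₗ[K] X.V), Proj P ∧ InB f P ∧ IsHom P X s ∧
      Function.Surjective s := by
  obtain ⟨s, hs, hsurj⟩ := exists_surj_ind X
  obtain ⟨P, i, r, hP, hhi, hr, hri, hir⟩ := exists_cut hf hi X.ind
  refine ⟨P, s ∘ₗ i, (proj_ind X).of_retract hhi hr hri, hP, hs.comp hhi, fun x => ?_⟩
  obtain ⟨m, rfl⟩ := hsurj x
  refine ⟨r m, ?_⟩
  have : i (r m) = X.ind.act f m := LinearMap.congr_fun hir m
  rw [LinearMap.comp_apply, this, hs.act, show X.act f = 1 from hX]; rfl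

lemma exists_proj_inj (hf : ∀ g, cjA K Q g f = f) (hi : f * f = f) (hX : InB f X) :
    ∃ (E : Rp K Q) (j : X.V →ₗ[K] E.V), Proj E ∧ InB f E ∧ IsHom X E j ∧
      Function.Injective j := by
  obtain ⟨j, hj, hinj⟩ := exists_inj_ind X
  obtain ⟨P, i, r, hP, hhi, hr, hri, hir⟩ := exists_cut hf hi X.ind
  refine ⟨P, r ∘ₗ j, (proj_ind X).of_retract hhi hr hri, hP, hr.comp hj, ?_⟩
  rw [← LinearMap.ker_eq_bot, LinearMap.ker_eq_bot']
  intro x hx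
  have : i (r (j x)) = X.ind.act f (j x) := LinearMap.congr_fun hir _
  rw [show r (j x) = 0 from hx, map_zero, ← hj.act, show X.act f = 1 from hX] at this
  exact hinj (by rw [map_zero]; exact this.symm)

/-- Every proper invariant subspace is contained in the kernel of a simple quotient. -/
lemma exists_simple_quot_le {W : Submodule K X.V} (hW : X.Inv W) (h : W ≠ ⊤) :
    ∃ (S : Rp K Q) (q : X.V →ₗ[K] S.V), Simp S ∧ IsHom X S q ∧ Function.Surjective q ∧
      W ≤ LinearMap.ker q := by
  have hex : ∃ n, ∃ W' : Submodule K X.V, X.Inv W' ∧ W ≤ W' ∧ W' ≠ ⊤ ∧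
    Module.finrank K W' + n = Module.finrank K X.V :=
    ⟨Module.finrank K X.V - Module.finrank K W, W, hW, le_rfl, h,
      Nat.add_sub_of_le (Submodule.finrank_le W)⟩
  obtain ⟨m, hm, hmin⟩ : ∃ m, (∃ W' : Submodule K X.V, X.Inv W' ∧ W ≤ W' ∧ W' ≠ ⊤ ∧
    Module.finrank K W' + m = Module.finrank K X.V) ∧ ∀ n < m, ¬ ∃ W' : Submodule K X.V,
      X.Inv W' ∧ W ≤ W' ∧ W' ≠ ⊤ ∧ Module.finrank K W' + n = Module.finrank K X.V :=
    ⟨Nat.find hex, Nat.find_spec hex, fun n hn => Nat.find_min hex hn⟩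
  obtain ⟨W', hW', hle, hne, hdim⟩ := hm
  refine ⟨X.quo W' hW', W'.mkQ, ⟨?_, fun U hU => ?_⟩, isHom_mkQ _ _ _, W'.mkQ_surjective, by simpa⟩
  · exact Submodule.Quotient.nontrivial_iff.2 hne
  · have hU' := (isHom_mkQ X W' hW').comap hU
    have hle' : W' ≤ U.comap W'.mkQ := fun v hv => by
      have h0 : W'.mkQ v = 0 := (Submodule.Quotient.mk_eq_zero W').2 hv
      rw [Submodule.mem_comap, h0]; exact zero_mem _
    by_cases htop : U.comap W'.mkQ = ⊤
    · right
      rw [← Submodule.map_comap_eq_of_surjective W'.mkQ_surjective U, htop, Submodule.map_top,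
        Submodule.range_mkQ]
    · left
      by_contra hbot
      have hlt : W' < U.comap W'.mkQ := lt_of_le_of_ne hle' fun h => hbot (by
        rw [← Submodule.map_comap_eq_of_surjective W'.mkQ_surjective U, ← h, eq_bot_iff,
          Submodule.map_le_iff_le_comap, Submodule.comap_bot, Submodule.ker_mkQ])
      have h1 := Submodule.finrank_lt_finrank_of_lt hlt
      have h2 := Submodule.finrank_le (U.comap W'.mkQ)
      exact hmin (Module.finrank K X.V - Module.finrank K (U.comap W'.mkQ)) (by omega)
        ⟨_, hU', hle.trans hle', htop, by omega⟩

/-- Representations with a unique maximal subrepresentation, the kernel of `π : X → T`. -/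
structure Loc (X T : Rp K Q) (π : X.V →ₗ[K] T.V) : Prop where
  hom : IsHom X T π
  simp : Simp T
  surj : Function.Surjective π
  le : ∀ W, X.Inv W → W ≠ ⊤ → W ≤ LinearMap.ker π

variable {π : X.V →ₗ[K] T.V}

lemma Loc.ne_zero (h : Loc X T π) : π ≠ 0 := by
  rintro rfl
  have := h.simp.1
  obtain ⟨t, ht⟩ := exists_ne (0 : T.V)
  obtain ⟨x, hx⟩ := h.surj t
  exact ht (by simpa using hx.symm)

lemma Loc.nontrivial (h : Loc X T π) : Nontrivial X.V := by
  have := h.simp.1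
  exact h.surj.nontrivial

lemma Loc.ker_ne_top (h : Loc X T π) : LinearMap.ker π ≠ ⊤ := fun h0 =>
  h.ne_zero (LinearMap.ker_eq_top.1 h0)

lemma Loc.surj_of (h : Loc X T π) {φ : Z.V →ₗ[K] X.V} (hφ : IsHom Z X φ) (h0 : π ∘ₗ φ ≠ 0) :
    Function.Surjective φ := by
  rw [← LinearMap.range_eq_top]
  by_contra h1
  apply h0
  apply LinearMap.ext; intro v
  exact h.le _ hφ.range h1 (LinearMap.mem_range_self φ v)

lemma Loc.of_surj (h : Loc X T π) {q : X.V →ₗ[K] Y.V} (hq : IsHom X Y q)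
    (hs : Function.Surjective q) (hY : Nontrivial Y.V) : ∃ π', Loc Y T π' ∧ π' ∘ₗ q = π := by
  have h1 : LinearMap.ker q ≠ ⊤ := fun h0 => by
    obtain ⟨y, hy⟩ := exists_ne (0 : Y.V)
    obtain ⟨x, rfl⟩ := hs y
    exact hy (by rw [LinearMap.ker_eq_top.1 h0]; rfl)
  obtain ⟨π', hπ', hc⟩ := exists_factor hq h.hom hs (h.le _ hq.ker h1)
  have hc' : ∀ x, π' (q x) = π x := LinearMap.congr_fun hc
  refine ⟨π', ⟨hπ', h.simp, fun t => ?_, fun W hW hW1 => ?_⟩, hc⟩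
  · obtain ⟨x, rfl⟩ := h.surj t
    exact ⟨q x, hc' x⟩
  · have h2 : W.comap q ≠ ⊤ := fun h0 => hW1 (by
      rw [← Submodule.map_comap_eq_of_surjective hs W, h0, Submodule.map_top]
      exact LinearMap.range_eq_top.2 hs)
    intro y hy
    obtain ⟨x, rfl⟩ := hs y
    have : x ∈ LinearMap.ker π := h.le _ (hq.comap hW) h2 hy
    rw [LinearMap.mem_ker, hc']; exact this

lemma Loc.top_unique (h : Loc X T π) {S : Rp K Q} (hS : Simp S) {q : X.V →ₗ[K] S.V}
    (hq : IsHom X S q) (h0 : q ≠ 0) :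
    Iso T S ∧ LinearMap.ker q = LinearMap.ker π ∧ Loc X S q := by
  have hs := surj_of_simp hS hq h0
  obtain ⟨π', hL, hc⟩ := h.of_surj hq hs hS.1
  have hinj := inj_of_simp hS hL.hom hL.ne_zero
  have hk : LinearMap.ker q = LinearMap.ker π := by
    rw [← hc, LinearMap.ker_comp_of_ker_eq_bot _ (LinearMap.ker_eq_bot.2 hinj)]
  exact ⟨(iso_of_simp hS h.simp hL.hom hL.ne_zero).symm, hk,
    hq, hS, hs, fun W hW h1 => hk ▸ h.le W hW h1⟩

lemma Loc.tw (h : Loc X T π) (χ : Q →* Kˣ) : Loc (X.tw χ) (T.tw χ) π :=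
  ⟨tw_isHom.2 h.hom, h.simp.tw χ, h.surj, fun W hW => h.le W (tw_inv.1 hW)⟩

lemma Proj.lift (hX : Proj X) {φ : X.V →ₗ[K] Z.V} (h : IsHom X Z φ) {s : Y.V →ₗ[K] Z.V}
    (hs : IsHom Y Z s) (hsurj : Function.Surjective s) : ∃ φ', IsHom X Y φ' ∧ s ∘ₗ φ' = φ :=
  (hX.null_from h).lift hs hsurj

lemma InB.sub (hX : InB f X) {W : Submodule K X.V} (hW : X.Inv W) : InB f (X.sub W hW) :=
  hX.of_inj (isHom_subtype X W hW) Subtype.val_injective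

/-- Fitting's lemma. -/
lemma exists_fitting {θ : X.V →ₗ[K] X.V} (hθ : IsHom X X θ) : ∃ n, 1 ≤ n ∧
    ∃ r : X.V →ₗ[K] (X.sub _ (hθ.pow n).range).V, IsHom X (X.sub _ (hθ.pow n).range) r ∧
      r ∘ₗ (LinearMap.range (θ ^ n)).subtype = LinearMap.id := by
  obtain ⟨a, ha⟩ := Filter.eventually_atTop.1 (LinearMap.eventually_isCompl_ker_pow_range_pow θ)
  obtain ⟨n, hn, hc⟩ : ∃ n, 1 ≤ n ∧ IsCompl (LinearMap.ker (θ ^ n)) (LinearMap.range (θ ^ n)) :=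
    ⟨max a 1, le_max_right _ _, ha _ (le_max_left _ _)⟩
  refine ⟨n, hn, exists_retraction (isHom_subtype X _ (hθ.pow n).range)
    ((hθ.pow n).codRestrict (hθ.pow n).range fun v => LinearMap.mem_range_self _ v) ?_⟩
  have hinj : Function.Injective ((θ ^ n).codRestrict (LinearMap.range (θ ^ n))
      (fun v => LinearMap.mem_range_self _ v) ∘ₗ (LinearMap.range (θ ^ n)).subtype) := by
    rw [← LinearMap.ker_eq_bot, LinearMap.ker_eq_bot']
    intro v hv
    apply Subtype.ext
    have h1 : (v : X.V) ∈ LinearMap.ker (θ ^ n) := congrArg Subtype.val hv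
    exact Submodule.disjoint_def.1 hc.disjoint _ h1 v.2
  exact ⟨hinj, LinearMap.injective_iff_surjective.1 hinj⟩

/-- Existence of projective covers of simple representations. -/
lemma exists_cover (hf : ∀ g, cjA K Q g f = f) (hi : f * f = f) (hT : Simp T) (hB : InB f T) :
    ∃ (P : Rp K Q) (π : P.V →ₗ[K] T.V), Proj P ∧ InB f P ∧ Loc P T π := by
  have hex : ∃ n, ∃ (P : Rp K Q) (s : P.V →ₗ[K] T.V), Module.finrank K P.V = n ∧ Proj P ∧
      InB f P ∧ IsHom P T s ∧ Function.Surjective s := by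
    obtain ⟨P, s, h⟩ := exists_proj_surj hf hi hB
    exact ⟨_, P, s, rfl, h⟩
  obtain ⟨P, s, hn, hP, hPB, hs, hsurj⟩ := Nat.find_spec hex
  refine ⟨P, s, hP, hPB, hs, hT, hsurj, fun W hW hW1 => ?_⟩
  by_contra hle
  have h0 : s ∘ₗ W.subtype ≠ 0 := fun h0 => hle fun v hv => LinearMap.congr_fun h0 ⟨v, hv⟩
  have hh := hs.comp (isHom_subtype P W hW)
  obtain ⟨φ, hφ, hc⟩ := hP.lift hs hh (surj_of_simp hT hh h0)
  have hθ : IsHom P P (W.subtype ∘ₗ φ) := (isHom_subtype P W hW).comp hφ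
  obtain ⟨n, hn1, r, hr, hri⟩ := exists_fitting hθ
  have hpow : ∀ (n : ℕ) v, s (((W.subtype ∘ₗ φ) ^ n) v) = s v := fun n v => by
    induction n with
    | zero => rfl
    | succ n ih =>
      rw [pow_succ', Module.End.mul_apply]
      exact (LinearMap.congr_fun hc _).trans ih
  have h1 : Nat.find hex ≤ Module.finrank K (LinearMap.range ((W.subtype ∘ₗ φ) ^ n)) :=
    Nat.find_min' hex ⟨P.sub _ (hθ.pow n).range, s ∘ₗ Submodule.subtype _, rfl,
      hP.of_retract (isHom_subtype _ _ _) hr hri, hPB.sub _, hs.comp (isHom_subtype _ _ _),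
      fun t => by
        obtain ⟨v, rfl⟩ := hsurj t
        exact ⟨⟨_, LinearMap.mem_range_self _ v⟩, hpow n v⟩⟩
  rw [← hn] at h1
  have h2 := Submodule.eq_top_of_finrank_eq (le_antisymm (Submodule.finrank_le _) h1)
  apply hW1
  rw [eq_top_iff, ← h2]
  rintro _ ⟨v, rfl⟩
  obtain ⟨m, rfl⟩ := Nat.exists_eq_add_of_le' hn1
  rw [pow_succ', Module.End.mul_apply]
  exact (φ _).2

end Covers

end Rp

/-! ### Blocks whose simple representations are linked by twisting -/

namespace Rp

section Nakayama

variable {K Q : Type} [Field K] [Group Q] [Fintype Q] {X Y Z T T' : Rp K Q}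
  {f : MonoidAlgebra K Q} {χ : Q →* Kˣ} {π : X.V →ₗ[K] T.V}

lemma tw_pow_zero (X : Rp K Q) (χ : Q →* Kˣ) : Iso (X.tw (χ ^ 0)) X := by
  rw [show χ ^ 0 = 1 from by ext; simp]
  exact tw_one X

lemma tw_pow_succ (X : Rp K Q) (χ : Q →* Kˣ) (a : ℕ) :
    Iso ((X.tw χ).tw (χ ^ a)) (X.tw (χ ^ (a + 1))) := by
  rw [show χ ^ (a + 1) = χ * χ ^ a from by ext; simp [pow_succ']]
  exact tw_tw X χ _

lemma Simp.ne_zero_of_surj (hT : Simp T) (hs : Function.Surjective π) : π ≠ 0 := by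
  rintro rfl
  have := hT.1
  obtain ⟨t, ht⟩ := exists_ne (0 : T.V)
  obtain ⟨x, hx⟩ := hs t
  exact ht (by simpa using hx.symm)

/-- The simple representations in `f` extend only their twists by `χ`, and in an essentially
unique way. -/
structure Nak (f : MonoidAlgebra K Q) (χ : Q →* Kˣ) : Prop where
  central : ∀ g, cjA K Q g f = f
  idem : f * f = f
  triv : ∀ g, f.coeff g ≠ 0 → χ g = 1
  link : ∀ S S' : Rp K Q, Simp S → Simp S' → InB f S → InB f S' → Linked S S' → Iso (S.tw χ) S'
  dep : ∀ S S' : Rp K Q, Simp S → Simp S' → InB f S → InB f S' → ∀ c c', IsCoc S S' c →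
    IsCoc S S' c' → ∃ a b : K, (a ≠ 0 ∨ b ≠ 0) ∧ IsCob S S' (a • c + b • c')

lemma Nak.ker_loc (hN : Nak f χ) (hX : Loc X T π) (hB : InB f X) (h0 : LinearMap.ker π ≠ ⊥) :
    ∃ T' π', Loc (X.sub _ hX.hom.ker) T' π' ∧ Iso (T.tw χ) T' := by
  obtain ⟨s, c, hs, hc, hcs⟩ := exists_section_coc hX.hom hX.surj
  have hBT : InB f T := hB.of_surj hX.hom hX.surj
  have key : ∀ (S : Rp K Q) (q : (X.sub _ hX.hom.ker).V →ₗ[K] S.V), Simp S →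
      IsHom (X.sub _ hX.hom.ker) S q → IsCob T S (fun g => q ∘ₗ c g) → q = 0 := by
    intro S q hS hq hb
    obtain ⟨q', hq', he⟩ := extend_of_cob hX.hom hs hcs hq hb
    by_cases h1 : q' = 0
    · rw [← he, h1]; rfl
    · have h2 := (hX.top_unique hS hq' h1).2.1
      rw [← he]
      apply LinearMap.ext; intro v
      have h3 : (v : X.V) ∈ LinearMap.ker q' := h2.symm.le v.2
      exact h3
  have hb : (⊥ : Submodule K (X.sub _ hX.hom.ker).V) ≠ ⊤ := fun h => h0 (by
    rw [Submodule.eq_bot_iff]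
    intro v hv
    have : (⟨v, hv⟩ : LinearMap.ker π) ∈ (⊥ : Submodule K (X.sub _ hX.hom.ker).V) := by
      rw [h]; trivial
    exact congrArg Subtype.val ((Submodule.mem_bot K).1 this))
  have main : ∀ (S : Rp K Q) (q : (X.sub _ hX.hom.ker).V →ₗ[K] S.V), Simp S →
      IsHom (X.sub _ hX.hom.ker) S q → Function.Surjective q → InB f S ∧ Iso (T.tw χ) S := by
    intro S q hS hq hsq
    have hBS : InB f S := (hB.sub hX.hom.ker).of_surj hq hsq
    exact ⟨hBS, hN.link _ _ hX.simp hS hBT hBS ⟨_, hc.comp_left hq, fun hb' =>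
      hS.ne_zero_of_surj hsq (key S q hS hq hb')⟩⟩
  obtain ⟨S, q, hS, hq, hsq, -⟩ := exists_simple_quot_le (inv_bot (X.sub _ hX.hom.ker)) hb
  obtain ⟨hBS, hiso⟩ := main S q hS hq hsq
  refine ⟨S, q, ⟨hq, hS, hsq, fun W hW hW1 => ?_⟩, hiso⟩
  obtain ⟨S', q', hS', hq', hsq', hle⟩ := exists_simple_quot_le hW hW1
  obtain ⟨-, hiso'⟩ := main S' q' hS' hq' hsq'
  obtain ⟨φ, hφ⟩ := hiso'.symm.trans hiso
  have hφq := hφ.comp hq'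
  obtain ⟨a, b, hab, hcob⟩ := hN.dep _ _ hX.simp hS hBT hBS _ _ (hc.comp_left hq)
    (hc.comp_left hφq)
  have h1 := key S (a • q + b • (φ ∘ₗ q')) hS ((hq.smul a).add (hφq.smul b)) (by
    convert hcob using 1
    funext g
    simp [LinearMap.add_comp, LinearMap.smul_comp])
  have ha : a ≠ 0 := by
    rintro rfl
    have hb0 : b ≠ 0 := by simpa using hab
    rw [zero_smul, zero_add, smul_eq_zero] at h1
    have h2 := h1.resolve_left hb0
    refine hS'.ne_zero_of_surj hsq' (LinearMap.ext fun v => φ.injective ?_)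
    simpa using LinearMap.congr_fun h2 v
  intro v hv
  have h2 : a • q v + b • φ (q' v) = 0 := LinearMap.congr_fun h1 v
  rw [show q' v = 0 from hle hv, map_zero, smul_zero, add_zero, smul_eq_zero] at h2
  exact h2.resolve_left ha

lemma Loc.iso (hX : Loc X T π) (h : Iso X Y) : ∃ π', Loc Y T π' := by
  obtain ⟨φ, hφ⟩ := h
  obtain ⟨π', h, -⟩ := hX.of_surj hφ φ.surjective (Iso.nontrivial ⟨φ, hφ⟩ hX.nontrivial)
  exact ⟨π', h⟩

lemma Nak.sub_loc (hN : Nak f χ) (hX : Loc X T π) (hB : InB f X) {j : Y.V →ₗ[K] X.V}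
    (hj : IsHom Y X j) (hinj : Function.Injective j) (hY : Nontrivial Y.V) :
    ∃ (a : ℕ) (T' : Rp K Q) (π' : Y.V →ₗ[K] T'.V), Loc Y T' π' ∧ Iso (T.tw (χ ^ a)) T' := by
  obtain ⟨n, hn⟩ : ∃ n, Module.finrank K X.V ≤ n := ⟨_, le_rfl⟩
  induction n generalizing X T with
  | zero =>
    have := hX.nontrivial
    have := Module.finrank_pos (R := K) (M := X.V)
    omega
  | succ n ih =>
    by_cases hs : Function.Surjective j
    · obtain ⟨π', h⟩ := hX.iso (iso_of_bij hj ⟨hinj, hs⟩).symm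
      exact ⟨0, T, π', h, tw_pow_zero T χ⟩
    · have hle := hX.le _ hj.range fun h => hs (LinearMap.range_eq_top.1 h)
      have h0 : LinearMap.ker π ≠ ⊥ := fun h0 => by
        obtain ⟨y, hy⟩ := exists_ne (0 : Y.V)
        apply hy
        apply hinj
        rw [map_zero, ← Submodule.mem_bot K, ← h0]
        exact hle (LinearMap.mem_range_self j y)
      obtain ⟨T1, π1, hL, hiso⟩ := hN.ker_loc hX hB h0
      have hlt := Submodule.finrank_lt hX.ker_ne_top
      have hjk := hj.codRestrict hX.hom.ker fun v => hle (LinearMap.mem_range_self j v)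
      obtain ⟨a, T', π', hL', hiso'⟩ := ih hL (hB.sub _) hjk
        (fun v w h => hinj (congrArg Subtype.val h)) (by
          change Module.finrank K (LinearMap.ker π) ≤ n
          omega)
      refine ⟨a + 1, T', π', hL', ?_⟩
      exact (tw_pow_succ T χ a).symm.trans ((hiso.tw _).trans hiso')

lemma Nak.chain (hN : Nak f χ) (hX : Loc X T π) (hB : InB f X) {W W' : Submodule K X.V}
    (hW : X.Inv W) (hW' : X.Inv W') : W ≤ W' ∨ W' ≤ W := by
  by_cases hnt : Nontrivial (W ⊔ W' : Submodule K X.V)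
  · obtain ⟨-, T', π', hL, -⟩ := hN.sub_loc hX hB (isHom_subtype X _ (hW.sup hW'))
      Subtype.val_injective hnt
    have hh := isHom_subtype X _ (hW.sup hW')
    by_cases h1 : W.comap (W ⊔ W').subtype = ⊤
    · right
      intro v hv
      have : (⟨v, Submodule.mem_sup_right hv⟩ : (W ⊔ W' : Submodule K X.V)) ∈
        W.comap (W ⊔ W').subtype := h1 ▸ trivial
      exact this
    by_cases h2 : W'.comap (W ⊔ W').subtype = ⊤
    · left
      intro v hv
      have : (⟨v, Submodule.mem_sup_left hv⟩ : (W ⊔ W' : Submodule K X.V)) ∈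
        W'.comap (W ⊔ W').subtype := h2 ▸ trivial
      exact this
    exfalso
    have h3 := hL.le _ (hh.comap hW) h1
    have h4 := hL.le _ (hh.comap hW') h2
    apply hL.ker_ne_top
    rw [eq_top_iff]
    rintro ⟨v, hv⟩ -
    obtain ⟨w, hw, w', hw', rfl⟩ := Submodule.mem_sup.1 hv
    have h5 : (⟨w, Submodule.mem_sup_left hw⟩ : (W ⊔ W' : Submodule K X.V)) ∈
      LinearMap.ker π' := h3 hw
    have h6 : (⟨w', Submodule.mem_sup_right hw'⟩ : (W ⊔ W' : Submodule K X.V)) ∈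
      LinearMap.ker π' := h4 hw'
    exact add_mem h5 h6
  · left
    intro v hv
    have : (⟨v, Submodule.mem_sup_left hv⟩ : (W ⊔ W' : Submodule K X.V)) = 0 := by
      rw [not_nontrivial_iff_subsingleton] at hnt
      exact Subsingleton.elim _ _
    rw [show v = 0 from congrArg Subtype.val this]
    exact zero_mem _

lemma Nak.compare (hN : Nak f χ) (hX : Loc X T π) (hB : InB f X) {π' : Y.V →ₗ[K] T'.V}
    (hY : Loc Y T' π') (hT : Iso T T') :
    (∃ s : X.V →ₗ[K] Y.V, IsHom X Y s ∧ Function.Surjective s) ∨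
      ∃ s : Y.V →ₗ[K] X.V, IsHom Y X s ∧ Function.Surjective s := by
  obtain ⟨P, πP, hP, hPB, hL⟩ :=
    exists_cover hN.central hN.idem hX.simp (hB.of_surj hX.hom hX.surj)
  obtain ⟨φ, hφ⟩ := hT
  obtain ⟨α, hα, hα'⟩ := hP.lift hL.hom hX.hom hX.surj
  obtain ⟨β, hβ, hβ'⟩ := hP.lift (hφ.comp hL.hom) hY.hom hY.surj
  have hαs := hX.surj_of hα (hα' ▸ hL.ne_zero)
  have hβs := hY.surj_of hβ (by
    rw [hβ']
    exact hY.simp.ne_zero_of_surj (φ.surjective.comp hL.surj))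
  rcases hN.chain hL hPB hα.ker hβ.ker with h | h
  · obtain ⟨s, hs, he⟩ := exists_factor hα hβ hαs h
    refine Or.inl ⟨s, hs, fun y => ?_⟩
    obtain ⟨x, rfl⟩ := hβs y
    exact ⟨α x, LinearMap.congr_fun he x⟩
  · obtain ⟨s, hs, he⟩ := exists_factor hβ hα hβs h
    refine Or.inr ⟨s, hs, fun y => ?_⟩
    obtain ⟨x, rfl⟩ := hαs y
    exact ⟨β x, LinearMap.congr_fun he x⟩

lemma Loc.not_null (hf : ∀ g, cjA K Q g f = f) (hi : f * f = f) (hX : Loc X T π) (hB : InB f X)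
    (hnp : ¬ Proj X) {S : Rp K Q} (hS : Simp S) {t : X.V →ₗ[K] S.V} (ht : IsHom X S t)
    (h0 : t ≠ 0) : ¬ Null X S t := fun hn => by
  obtain ⟨-, -, hXS⟩ := hX.top_unique hS ht h0
  obtain ⟨P, πP, hP, -, hL⟩ := exists_cover hf hi hS (hB.of_surj ht hXS.surj)
  obtain ⟨t', ht', he⟩ := hn.lift hL.hom hL.surj
  have hs := hL.surj_of ht' (he ▸ h0)
  obtain ⟨σ, hσ, hσ'⟩ := hP.lift (IsHom.id P) ht' hs
  have hσs : Function.Surjective σ := hXS.surj_of hσ (by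
    rw [← he, LinearMap.comp_assoc, hσ', LinearMap.comp_id]; exact hL.ne_zero)
  have hinj : Function.Injective t' := fun x y hxy => by
    obtain ⟨x, rfl⟩ := hσs x
    obtain ⟨y, rfl⟩ := hσs y
    have h1 : ∀ w, t' (σ w) = w := LinearMap.congr_fun hσ'
    rw [h1, h1] at hxy; rw [hxy]
  exact hnp (hP.iso (iso_of_bij ht' ⟨hinj, hs⟩).symm)

lemma Nak.exists_nonnull (hN : Nak f χ) (hX : Loc X T π) (hB : InB f X) (hnp : ¬ Proj X)
    {π' : Y.V →ₗ[K] T'.V} (hY : Loc Y T' π') (hB' : InB f Y) (hnp' : ¬ Proj Y) (hT : Iso T T') :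
    (∃ s : X.V →ₗ[K] Y.V, IsHom X Y s ∧ ¬ Null X Y s) ∨
      ∃ s : Y.V →ₗ[K] X.V, IsHom Y X s ∧ ¬ Null Y X s := by
  rcases hN.compare hX hB hY hT with ⟨s, hs, hsurj⟩ | ⟨s, hs, hsurj⟩
  · exact Or.inl ⟨s, hs, fun h => hX.not_null hN.central hN.idem hB hnp hY.simp
      (hY.hom.comp hs) (hY.simp.ne_zero_of_surj (hY.surj.comp hsurj)) (h.comp_left hY.hom)⟩
  · exact Or.inr ⟨s, hs, fun h => hY.not_null hN.central hN.idem hB' hnp' hX.simp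
      (hX.hom.comp hs) (hX.simp.ne_zero_of_surj (hX.surj.comp hsurj)) (h.comp_left hX.hom)⟩

end Nakayama

end Rp

/-! ### Local summands -/

namespace Rp

section Summands

variable {K Q : Type} [Field K] [Group Q] [Fintype Q] {X Y Z T T' : Rp K Q}
  {f : MonoidAlgebra K Q} {χ : Q →* Kˣ} {π : X.V →ₗ[K] T.V}

lemma bot_ne_top (h : Nontrivial X.V) : (⊥ : Submodule K X.V) ≠ ⊤ := fun h0 => by
  obtain ⟨x, hx⟩ := exists_ne (0 : X.V)
  exact hx ((Submodule.mem_bot K).1 (h0 ▸ trivial))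

/-- The complementary summand of a retract. -/
lemma exists_complement {i : X.V →ₗ[K] Y.V} {r : Y.V →ₗ[K] X.V} (hi : IsHom X Y i)
    (hr : IsHom Y X r) (hri : r ∘ₗ i = LinearMap.id) :
    ∃ ρ : Y.V →ₗ[K] (Y.sub _ hr.ker).V, IsHom Y (Y.sub _ hr.ker) ρ ∧
      ρ ∘ₗ (LinearMap.ker r).subtype = LinearMap.id ∧
      ∀ v, ((ρ v : LinearMap.ker r) : Y.V) = v - i (r v) := by
  have h1 : ∀ x, r (i x) = x := LinearMap.congr_fun hri
  have h2 : ∀ v, (LinearMap.id - i ∘ₗ r : Y.V →ₗ[K] Y.V) v ∈ LinearMap.ker r := fun v => by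
    rw [LinearMap.mem_ker, LinearMap.sub_apply, map_sub, LinearMap.comp_apply, h1]
    exact sub_self _
  refine ⟨(LinearMap.id - i ∘ₗ r).codRestrict _ h2,
    ((IsHom.id Y).sub (hi.comp hr)).codRestrict hr.ker h2, ?_, fun v => rfl⟩
  apply LinearMap.ext; rintro ⟨v, hv⟩
  apply Subtype.ext
  change v - i (r v) = v
  rw [show r v = 0 from hv, map_zero, sub_zero]

/-- A local representation that embeds in a projective one embeds in a local projective one. -/
lemma Nak.exists_embed (hN : Nak f χ) (hX : Loc X T π) (hB : InB f X) {E : Rp K Q}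
    {m : X.V →ₗ[K] E.V} (hE : Proj E) (hEB : InB f E) (hm : IsHom X E m)
    (hinj : Function.Injective m) :
    ∃ (P S : Rp K Q) (π' : P.V →ₗ[K] S.V) (m' : X.V →ₗ[K] P.V), Loc P S π' ∧ Proj P ∧
      InB f P ∧ IsHom X P m' ∧ Function.Injective m' := by
  obtain ⟨n, hn⟩ : ∃ n, Module.finrank K E.V ≤ n := ⟨_, le_rfl⟩
  have hXn := hX.nontrivial
  induction n generalizing E with
  | zero =>
    have := hinj.nontrivial
    have := Module.finrank_pos (R := K) (M := E.V)
    omega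
  | succ n ih =>
    obtain ⟨S, q, hS, hq, hqs, -⟩ := exists_simple_quot_le (inv_bot E) (bot_ne_top hinj.nontrivial)
    obtain ⟨P, πP, hP, hPB, hL⟩ := exists_cover hN.central hN.idem hS (hEB.of_surj hq hqs)
    obtain ⟨φ, hφ, hφq⟩ := hE.lift hq hL.hom hL.surj
    have hφs := hL.surj_of hφ (hφq ▸ hS.ne_zero_of_surj hqs)
    obtain ⟨σ, hσ, hσφ⟩ := hP.lift (IsHom.id P) hφ hφs
    obtain ⟨ρ, hρ, hρi, hρv⟩ := exists_complement hσ hφ hσφ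
    have hdisj : ∀ x, φ (m x) = 0 → ρ (m x) = 0 → x = 0 := fun x h1 h2 => by
      have h3 := hρv (m x)
      rw [h2, h1, map_zero, sub_zero] at h3
      exact hinj (by rw [map_zero]; exact h3.symm)
    rcases hN.chain hX hB (hφ.comp hm).ker (hρ.comp hm).ker with h | h
    · refine ⟨P, S, πP, φ ∘ₗ m, hL, hP, hPB, hφ.comp hm, ?_⟩
      rw [← LinearMap.ker_eq_bot, LinearMap.ker_eq_bot']
      exact fun x hx => hdisj x hx (h hx)
    · refine ih (hE.of_retract (isHom_subtype _ _ _) hρ hρi) (hEB.sub _) (hρ.comp hm) ?_ ?_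
      · rw [← LinearMap.ker_eq_bot, LinearMap.ker_eq_bot']
        exact fun x hx => hdisj x (h hx) hx
      · have := hL.nontrivial
        have h1 : LinearMap.ker φ ≠ ⊤ := fun h1 => by
          obtain ⟨y, hy⟩ := exists_ne (0 : P.V)
          obtain ⟨e, rfl⟩ := hφs y
          have : e ∈ LinearMap.ker φ := h1 ▸ trivial
          exact hy this
        have h2 := Submodule.finrank_lt h1
        change Module.finrank K (LinearMap.ker φ) ≤ n
        omega

lemma Nak.exists_summand (hN : Nak f χ) (hB : InB f Y) (hY : Nontrivial Y.V) :
    ∃ (X T : Rp K Q) (π : X.V →ₗ[K] T.V) (i : X.V →ₗ[K] Y.V) (r : Y.V →ₗ[K] X.V), Loc X T π ∧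
      InB f X ∧ IsHom X Y i ∧ IsHom Y X r ∧ r ∘ₗ i = LinearMap.id := by
  have hrange : ∀ (P S : Rp K Q) (π' : P.V →ₗ[K] S.V) (g : P.V →ₗ[K] Y.V), Loc P S π' →
      ∀ hg : IsHom P Y g, g ≠ 0 → ∃ π'', Loc (Y.sub _ hg.range) S π'' := by
    intro P S π' g hL hg h0
    obtain ⟨π'', h, -⟩ := hL.of_surj (Y := Y.sub _ hg.range) (q := g.rangeRestrict)
      (hg.codRestrict hg.range fun v => LinearMap.mem_range_self g v) g.surjective_rangeRestrict (by
        obtain ⟨v, hv⟩ := DFunLike.ne_iff.1 h0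
        exact ⟨⟨g v, LinearMap.mem_range_self g v⟩, 0, fun h => hv (congrArg Subtype.val h)⟩)
    exact ⟨π'', h⟩
  have hex : ∃ n, ∃ (X T : Rp K Q) (π : X.V →ₗ[K] T.V) (i : X.V →ₗ[K] Y.V), Loc X T π ∧
      IsHom X Y i ∧ Function.Injective i ∧ Module.finrank K X.V + n = Module.finrank K Y.V := by
    obtain ⟨S, q, hS, hq, hqs, -⟩ := exists_simple_quot_le (inv_bot Y) (bot_ne_top hY)
    obtain ⟨P, πP, hP, hPB, hL⟩ := exists_cover hN.central hN.idem hS (hB.of_surj hq hqs)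
    obtain ⟨g, hg, hgq⟩ := hP.lift hL.hom hq hqs
    obtain ⟨π'', h⟩ := hrange P S πP g hL hg (by
      rintro rfl
      exact hL.ne_zero (by rw [← hgq, LinearMap.comp_zero]))
    exact ⟨_, _, S, π'', _, h, isHom_subtype _ _ _, Subtype.val_injective,
      Nat.add_sub_of_le (Submodule.finrank_le (LinearMap.range g))⟩
  obtain ⟨X, T, π, j, hX, hj, hinj, hdim⟩ := Nat.find_spec hex
  have hXB := hB.of_inj hj hinj
  obtain ⟨E, m, hE, hEB, hm, hminj⟩ := exists_proj_inj hN.central hN.idem hXB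
  obtain ⟨P, S, πP, m', hP, hPp, hPB, hm', hminj'⟩ := hN.exists_embed hX hXB hE hEB hm hminj
  obtain ⟨g, hg, hgj⟩ := (hPp.null_to hm').extend hj hinj
  have hle : LinearMap.range m' ≤ LinearMap.range g := by
    rw [← hgj]; exact LinearMap.range_comp_le_range _ _
  have hXn := hX.nontrivial
  obtain ⟨x, hx⟩ := exists_ne (0 : X.V)
  obtain ⟨-, S', π', hL', -⟩ := hN.sub_loc hP hPB (isHom_subtype P _ hg.range)
    Subtype.val_injective ⟨⟨m' x, hle (LinearMap.mem_range_self _ x)⟩, 0, fun h => hx (hminj'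
      (by rw [map_zero]; exact congrArg Subtype.val h))⟩
  have hg' := hg.codRestrict hg.range fun v => LinearMap.mem_range_self g v
  have hg's : Function.Surjective g.rangeRestrict := g.surjective_rangeRestrict
  obtain ⟨P', πP', hPp', -, hLP'⟩ := exists_cover hN.central hN.idem hL'.simp
    ((hPB.sub hg.range).of_surj hL'.hom hL'.surj)
  obtain ⟨h, hh, hhe⟩ := hPp'.lift hLP'.hom (hL'.hom.comp hg') (hL'.surj.comp hg's)
  have hgh : Function.Surjective (g.rangeRestrict ∘ₗ h) := hL'.surj_of (hg'.comp hh) (by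
    rw [← LinearMap.comp_assoc]; exact hhe ▸ hLP'.ne_zero)
  obtain ⟨π'', hL''⟩ := hrange P' S' πP' h hLP' hh (by
    rintro rfl
    exact hLP'.ne_zero (by rw [← hhe, LinearMap.comp_zero]))
  have h1 : Module.finrank K (LinearMap.range g) ≤ Module.finrank K (LinearMap.range h) := by
    have hs : Function.Surjective
        (g.rangeRestrict ∘ₗ (LinearMap.range h).subtype) := fun y => by
      obtain ⟨x, rfl⟩ := hgh y
      exact ⟨⟨h x, LinearMap.mem_range_self h x⟩, rfl⟩
    exact LinearMap.finrank_le_finrank_of_surjective hs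
  have h2 : Nat.find hex ≤ Module.finrank K Y.V - Module.finrank K (LinearMap.range h) :=
    Nat.find_min' hex ⟨_, S', π'', _, hL'', isHom_subtype _ _ _, Subtype.val_injective,
      Nat.add_sub_of_le (Submodule.finrank_le (LinearMap.range h))⟩
  have h3 := Submodule.finrank_le (LinearMap.range h)
  have h4 := LinearMap.finrank_range_of_inj hminj'
  have heq := Submodule.eq_of_le_of_finrank_le hle (by omega)
  obtain ⟨r, hr, hre⟩ := exists_cofactor hm' hg hminj' heq.ge
  refine ⟨X, T, π, j, r, hX, hXB, hj, hr, LinearMap.ext fun v => hminj' ?_⟩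
  exact (LinearMap.congr_fun hre (j v)).trans (LinearMap.congr_fun hgj v)

lemma Nak.exists_nonproj_summand (hN : Nak f χ) (hB : InB f Y) (hY : ¬ Proj Y) :
    ∃ (X T : Rp K Q) (π : X.V →ₗ[K] T.V) (i : X.V →ₗ[K] Y.V) (r : Y.V →ₗ[K] X.V), Loc X T π ∧
      ¬ Proj X ∧ InB f X ∧ IsHom X Y i ∧ IsHom Y X r ∧ r ∘ₗ i = LinearMap.id := by
  obtain ⟨n, hn⟩ : ∃ n, Module.finrank K Y.V ≤ n := ⟨_, le_rfl⟩
  induction n generalizing Y with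
  | zero =>
    refine absurd (Proj.of_subsingleton fun h => ?_) hY
    have := Module.finrank_pos (R := K) (M := Y.V)
    omega
  | succ n ih =>
    have hnt : Nontrivial Y.V := by
      by_contra h
      exact hY (Proj.of_subsingleton h)
    obtain ⟨X, T, π, i, r, hX, hXB, hi, hr, hri⟩ := hN.exists_summand hB hnt
    by_cases hXp : Proj X
    · obtain ⟨ρ, hρ, hρi, hρv⟩ := exists_complement hi hr hri
      have hs := isHom_subtype Y _ hr.ker
      have hc : ¬ Proj (Y.sub _ hr.ker) := fun hp => hY (by
        have h1 := ((hXp.null_from hi).comp_right hr).add ((hp.null_from hs).comp_right hρ)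
        have h2 : i ∘ₗ r + (LinearMap.ker r).subtype ∘ₗ ρ = LinearMap.id := by
          apply LinearMap.ext; intro v
          change i (r v) + ((ρ v : LinearMap.ker r) : Y.V) = v
          rw [hρv, add_sub_cancel]
        rw [Proj, ← h2]; exact h1)
      obtain ⟨X', T', π', i', r', hX', hXp', hXB', hi', hr', hri'⟩ := ih (hB.sub hr.ker) hc (by
        have h1 : LinearMap.ker r ≠ ⊤ := fun h1 => by
          have := hX.nontrivial
          obtain ⟨x, hx⟩ := exists_ne (0 : X.V)
          have h2 : i x ∈ LinearMap.ker r := h1 ▸ trivial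
          exact hx ((LinearMap.congr_fun hri x).symm.trans h2)
        have h2 := Submodule.finrank_lt h1
        change Module.finrank K (LinearMap.ker r) ≤ n
        omega)
      refine ⟨X', T', π', (LinearMap.ker r).subtype ∘ₗ i', r' ∘ₗ ρ, hX', hXp', hXB',
        hs.comp hi', hr'.comp hρ, ?_⟩
      apply LinearMap.ext; intro v
      exact (congrArg r' (LinearMap.congr_fun hρi (i' v))).trans (LinearMap.congr_fun hri' v)
    · exact ⟨X, T, π, i, r, hX, hXp, hXB, hi, hr, hri⟩

/-- A representation whose stable endomorphisms are scalars is stably local. -/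
lemma Nak.exists_core (hN : Nak f χ) (hB : InB f Y) (hY : ¬ Proj Y)
    (hend : ∀ θ, IsHom Y Y θ → ∃ c : K, Null Y Y (θ - c • LinearMap.id)) :
    ∃ (X T : Rp K Q) (π : X.V →ₗ[K] T.V) (i : X.V →ₗ[K] Y.V) (r : Y.V →ₗ[K] X.V), Loc X T π ∧
      ¬ Proj X ∧ InB f X ∧ IsHom X Y i ∧ IsHom Y X r ∧ r ∘ₗ i = LinearMap.id ∧
      Null Y Y (LinearMap.id - i ∘ₗ r) := by
  obtain ⟨X, T, π, i, r, hX, hXp, hXB, hi, hr, hri⟩ := hN.exists_nonproj_summand hB hY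
  refine ⟨X, T, π, i, r, hX, hXp, hXB, hi, hr, hri, ?_⟩
  obtain ⟨c, hc⟩ := hend _ (hi.comp hr)
  have h1 : ∀ x, r (i x) = x := LinearMap.congr_fun hri
  by_cases h0 : c = 0
  · rw [h0, zero_smul, sub_zero] at hc
    refine absurd ?_ hXp
    have h2 := (hc.comp_left hr).comp_right hi
    rw [Proj]
    convert h2 using 1
    apply LinearMap.ext; intro v
    simp [h1]
  · have h2 := (hc.comp_left ((IsHom.id Y).sub (hi.comp hr))).smul (-c⁻¹)
    convert h2 using 1
    apply LinearMap.ext; intro v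
    simp [h1, smul_sub, smul_smul, h0]

end Summands

end Rp

/-! ### Extensions between stably local representations -/

namespace Rp

section Cores

variable {K Q : Type} [Field K] [Group Q] [Fintype Q] {X Y Z T T' P P' : Rp K Q}
  {f : MonoidAlgebra K Q} {χ : Q →* Kˣ} {π : X.V →ₗ[K] T.V} {p : P.V →ₗ[K] X.V}

lemma Nak.twist_eq (hN : Nak f χ) (hX : Loc X T π) (hB : InB f X) (hXp : ¬ Proj X)
    (ha : ∀ u, IsHom (X.tw χ) X u → ¬ Function.Surjective u → Null (X.tw χ) X u)
    (hP : Proj P) (hPB : InB f P) (hp : IsHom P X p) (hps : Function.Surjective p)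
    (hL : Loc P T (π ∘ₗ p)) :
    LinearMap.ker π = ⊥ ∨ (Iso (X.tw χ) (P.sub _ hL.hom.ker) ∧ Simp (P.sub _ hp.ker)) := by
  by_cases h0 : LinearMap.ker π = ⊥
  · exact Or.inl h0
  right
  obtain ⟨T₁, π₁, hK, hT₁⟩ := hN.ker_loc hX hB h0
  have hXχ := hX.tw χ
  have hBχ := hB.tw hN.triv
  have hlt := Submodule.finrank_lt hX.ker_ne_top
  obtain ⟨u, hu, hus⟩ : ∃ u : X.V →ₗ[K] (X.sub _ hX.hom.ker).V,
      IsHom (X.tw χ) (X.sub _ hX.hom.ker) u ∧ Function.Surjective u := by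
    rcases hN.compare hXχ hBχ hK hT₁ with h | ⟨s, -, hs⟩
    · exact h
    · have := LinearMap.finrank_le_finrank_of_surjective hs
      exact absurd hlt (not_lt.2 this)
  have hsub := isHom_subtype X _ hX.hom.ker
  have hnull := ha _ (hsub.comp hu) fun hs => hX.ker_ne_top (by
    rw [eq_top_iff]
    intro x _
    obtain ⟨y, rfl⟩ := hs x
    exact (u y).2)
  obtain ⟨u', hu', hpu⟩ := hnull.lift hp hps
  have hpu' : ∀ x, p (u' x) = u x := LinearMap.congr_fun hpu
  have hmem : ∀ x, u' x ∈ LinearMap.ker (π ∘ₗ p) := fun x => by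
    rw [LinearMap.mem_ker, LinearMap.comp_apply, hpu']
    exact (u x).2
  have hnt := hK.nontrivial
  obtain ⟨k, hk⟩ := exists_ne (0 : LinearMap.ker π)
  obtain ⟨x, rfl⟩ := hus k
  have hPK : LinearMap.ker (π ∘ₗ p) ≠ ⊥ := fun h => hk (Subtype.ext (by
    have h1 : u' x = 0 := (Submodule.mem_bot K).1 (h.le (hmem x))
    rw [← hpu', h1, map_zero]; rfl))
  obtain ⟨T₂, π₂, hK₂, hT₂⟩ := hN.ker_loc hL hPB hPK
  have hu'' := hu'.codRestrict hL.hom.ker hmem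
  have hpk := hp.comp (isHom_subtype P _ hL.hom.ker)
  have hu''s : Function.Surjective (u'.codRestrict _ hmem) := by
    by_contra hns
    have h1 := hK₂.le _ hu''.range fun h => hns (LinearMap.range_eq_top.1 h)
    have h2 := hK₂.le _ hpk.ker fun h => hk (Subtype.ext (by
      have : (⟨u' x, hmem x⟩ : LinearMap.ker (π ∘ₗ p)) ∈
        LinearMap.ker (p ∘ₗ (LinearMap.ker (π ∘ₗ p)).subtype) := by rw [h]; trivial
      exact (hpu' x).symm.trans this))
    apply hK₂.ker_ne_top
    rw [eq_top_iff]
    rintro v -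
    obtain ⟨w, hw⟩ := hus ⟨p v, v.2⟩
    have h3 : v - u'.codRestrict _ hmem w ∈
        LinearMap.ker (p ∘ₗ (LinearMap.ker (π ∘ₗ p)).subtype) := by
      rw [LinearMap.mem_ker]
      change p (v - u' w) = 0
      rw [map_sub, hpu', hw]
      exact sub_self _
    have h4 := add_mem (h2 h3) (h1 (LinearMap.mem_range_self _ w))
    rwa [sub_add_cancel] at h4
  have hR : Nontrivial (LinearMap.ker p) := by
    by_contra h
    have hb : LinearMap.ker p = ⊥ := by
      rw [Submodule.eq_bot_iff]
      intro v hv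
      rw [not_nontrivial_iff_subsingleton] at h
      exact congrArg Subtype.val (Subsingleton.elim (⟨v, hv⟩ : LinearMap.ker p) 0)
    exact hXp (hP.iso (iso_of_bij hp ⟨LinearMap.ker_eq_bot.1 hb, hps⟩))
  obtain ⟨a, T₃, π₃, hL₃, hT₃⟩ := hN.sub_loc hL hPB (isHom_subtype P _ hp.ker)
    Subtype.val_injective hR
  have hd₃ : Module.finrank K T.V = Module.finrank K T₃.V := hT₃.finrank
  have h1 := LinearMap.finrank_range_add_finrank_ker (π ∘ₗ p)
  have h2 := LinearMap.finrank_range_add_finrank_ker p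
  rw [LinearMap.range_eq_top.2 hL.surj, finrank_top] at h1
  rw [LinearMap.range_eq_top.2 hps, finrank_top] at h2
  have h3 : Module.finrank K T₃.V ≤ Module.finrank K (LinearMap.ker p) :=
    LinearMap.finrank_le_finrank_of_surjective hL₃.surj
  have h4 : Module.finrank K (LinearMap.ker (π ∘ₗ p)) ≤ Module.finrank K X.V :=
    LinearMap.finrank_le_finrank_of_surjective hu''s
  have h5 : Module.finrank K X.V = Module.finrank K (LinearMap.ker (π ∘ₗ p)) := by omega
  have h6 : Module.finrank K (LinearMap.ker p) = Module.finrank K T₃.V := by omega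
  exact ⟨iso_of_bij hu'' ⟨(LinearMap.injective_iff_surjective_of_finrank_eq_finrank h5).2 hu''s,
    hu''s⟩, (iso_of_bij hL₃.hom ⟨(LinearMap.injective_iff_surjective_of_finrank_eq_finrank h6).2
    hL₃.surj, hL₃.surj⟩).symm.simp hL₃.simp⟩

lemma Loc.simp_of_ker (hX : Loc X T π) (h : LinearMap.ker π = ⊥) : Simp X :=
  (iso_of_bij hX.hom ⟨LinearMap.ker_eq_bot.1 h, hX.surj⟩).symm.simp hX.simp

lemma Loc.factor (hX : Loc X T π) {S : Rp K Q} (hS : Simp S) {t : X.V →ₗ[K] S.V}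
    (ht : IsHom X S t) : ∃ s, IsHom T S s ∧ s ∘ₗ π = t := by
  refine exists_factor hX.hom ht hX.surj ?_
  by_cases h : t = 0
  · rw [h, LinearMap.ker_zero]; exact le_top
  · exact (hX.top_unique hS ht h).2.1.ge

lemma Loc.hom_dep [IsAlgClosed K] (hX : Loc X T π) {S : Rp K Q} (hS : Simp S)
    {t t' : X.V →ₗ[K] S.V} (ht : IsHom X S t) (ht' : IsHom X S t') :
    ∃ a b : K, (a ≠ 0 ∨ b ≠ 0) ∧ a • t + b • t' = 0 := by
  obtain ⟨s, hs, rfl⟩ := hX.factor hS ht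
  obtain ⟨s', hs', rfl⟩ := hX.factor hS ht'
  obtain ⟨a, b, hab, h⟩ := schur_dep hX.simp hS hs hs'
  refine ⟨a, b, hab, ?_⟩
  rw [← LinearMap.smul_comp, ← LinearMap.smul_comp, ← LinearMap.add_comp, h, LinearMap.zero_comp]

/-- A linear invariant with values in a one-dimensional space of homomorphisms that detects
whether cocycles are coboundaries. -/
lemma Loc.coc_dep [IsAlgClosed K] {X' A S : Rp K Q} {πA : A.V →ₗ[K] T.V} (hA : Loc A T πA)
    (hS : Simp S) (Rl : (Q → (X.V →ₗ[K] X'.V)) → (A.V →ₗ[K] S.V) → Prop)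
    (hex : ∀ c, IsCoc X X' c → ∃ t, IsHom A S t ∧ Rl c t)
    (hlin : ∀ c c' t t' (a b : K), Rl c t → Rl c' t' → Rl (a • c + b • c') (a • t + b • t'))
    (h0 : ∀ c, Rl c 0 → IsCob X X' c) :
    (Linked X X' → ∃ t, IsHom A S t ∧ t ≠ 0) ∧ ∀ c c', IsCoc X X' c → IsCoc X X' c' →
      ∃ a b : K, (a ≠ 0 ∨ b ≠ 0) ∧ IsCob X X' (a • c + b • c') := by
  constructor
  · rintro ⟨c, hc, hnc⟩
    obtain ⟨t, ht, hr⟩ := hex c hc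
    exact ⟨t, ht, fun h => hnc (h0 c (h ▸ hr))⟩
  · intro c c' hc hc'
    obtain ⟨t, ht, hr⟩ := hex c hc
    obtain ⟨t', ht', hr'⟩ := hex c' hc'
    obtain ⟨a, b, hab, h⟩ := hA.hom_dep hS ht ht'
    exact ⟨a, b, hab, h0 _ (h ▸ hlin _ _ _ _ a b hr hr')⟩

section Cover

variable {X' : Rp K Q}

/-- `b` trivializes the inflation of `c` along the cover `p`. -/
def CovCob (p : P.V →ₗ[K] X.V) (c : Q → (X.V →ₗ[K] X'.V)) (b : P.V →ₗ[K] X'.V) : Prop :=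
  ∀ g, c g ∘ₗ p = cj P X' g b - b

lemma CovCob.lin {c c' : Q → (X.V →ₗ[K] X'.V)} {b b' : P.V →ₗ[K] X'.V} (h : CovCob p c b)
    (h' : CovCob p c' b') (x y : K) : CovCob p (x • c + y • c') (x • b + y • b') := fun g => by
  simp only [Pi.add_apply, Pi.smul_apply, LinearMap.add_comp, LinearMap.smul_comp, h g, h' g,
    map_add, map_smul, smul_sub]
  abel

lemma CovCob.isHom {c : Q → (X.V →ₗ[K] X'.V)} {b : P.V →ₗ[K] X'.V} (h : CovCob p c b)
    (hp : IsHom P X p) : IsHom (P.sub _ hp.ker) X' (b ∘ₗ (LinearMap.ker p).subtype) := fun g v => by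
  have h1 := LinearMap.congr_fun (h g) (P.ρ g v)
  have h2 : p (P.ρ g v) = 0 := hp.ker g v v.2
  rw [LinearMap.comp_apply, h2, map_zero, LinearMap.sub_apply, cj_apply, ρ_self_inv] at h1
  exact (sub_eq_zero.1 h1.symm).symm

lemma CovCob.isCob {c : Q → (X.V →ₗ[K] X'.V)} {b e : P.V →ₗ[K] X'.V} (h : CovCob p c b)
    (hp : IsHom P X p) (hps : Function.Surjective p) (he : IsHom P X' e)
    (heq : ∀ v, p v = 0 → b v = e v) : IsCob X X' c := by
  obtain ⟨σ, hσ⟩ := LinearMap.exists_rightInverse_of_surjective p (LinearMap.range_eq_top.2 hps)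
  have hσ' : ∀ x, p (σ x) = x := LinearMap.congr_fun hσ
  have hβ : (b - e) ∘ₗ σ ∘ₗ p = b - e := by
    apply LinearMap.ext; intro v
    have h1 := heq (σ (p v) - v) (by rw [map_sub, hσ', sub_self])
    rw [map_sub, map_sub] at h1
    change b (σ (p v)) - e (σ (p v)) = b v - e v
    rw [sub_eq_sub_iff_sub_eq_sub]; exact h1
  refine ⟨(b - e) ∘ₗ σ, fun g => ?_⟩
  have h2 : c g ∘ₗ p = (cj X X' g ((b - e) ∘ₗ σ) - (b - e) ∘ₗ σ) ∘ₗ p := by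
    have h3 : cj X X' g ((b - e) ∘ₗ σ) ∘ₗ p = cj P X' g (b - e) := by
      have h4 := cj_comp (X := P) g ((b - e) ∘ₗ σ) p
      rw [hp.cj g, LinearMap.comp_assoc, hβ] at h4
      exact h4.symm
    rw [LinearMap.sub_comp, h3, LinearMap.comp_assoc, hβ, h g, map_sub, he.cj]
    abel
  apply LinearMap.ext; intro x
  obtain ⟨v, rfl⟩ := hps x
  exact LinearMap.congr_fun h2 v

lemma IsCoc.exists_covCob {c : Q → (X.V →ₗ[K] X'.V)} (hc : IsCoc X X' c) (hp : IsHom P X p)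
    (hP : Proj P) : ∃ b, CovCob p c b :=
  (hc.comp_right hp).cob_of_proj_left hP

end Cover

/-- The linking of stably local representations whose non-surjective homomorphisms from their
twists vanish stably. -/
lemma Nak.link_core [IsAlgClosed K] (hN : Nak f χ) {X' : Rp K Q} {π' : X'.V →ₗ[K] T'.V}
    (hX : Loc X T π) (hB : InB f X) (hXp : ¬ Proj X)
    (ha : ∀ u, IsHom (X.tw χ) X u → ¬ Function.Surjective u → Null (X.tw χ) X u)
    (hX' : Loc X' T' π') (hB' : InB f X') (hXp' : ¬ Proj X')
    (ha' : ∀ u, IsHom (X'.tw χ) X' u → ¬ Function.Surjective u → Null (X'.tw χ) X' u) :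
    (Linked X X' → (∃ u, IsHom (X.tw χ) X' u ∧ ¬ Null (X.tw χ) X' u) ∨
      ∃ u, IsHom X' (X.tw χ) u ∧ ¬ Null X' (X.tw χ) u) ∧
    ∀ c c', IsCoc X X' c → IsCoc X X' c' →
      ∃ a b : K, (a ≠ 0 ∨ b ≠ 0) ∧ IsCob X X' (a • c + b • c') := by
  have cover : ∀ {Y S : Rp K Q} {η : Y.V →ₗ[K] S.V}, Loc Y S η → InB f Y →
      ∃ (P : Rp K Q) (p : P.V →ₗ[K] Y.V), Proj P ∧ InB f P ∧ IsHom P Y p ∧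
        Function.Surjective p ∧ Loc P S (η ∘ₗ p) := by
    intro Y S η hY hYB
    obtain ⟨P, πP, hP, hPB, hL⟩ :=
      exists_cover hN.central hN.idem hY.simp (hYB.of_surj hY.hom hY.surj)
    obtain ⟨p, hp, hpe⟩ := hP.lift hL.hom hY.hom hY.surj
    exact ⟨P, p, hP, hPB, hp, hY.surj_of hp (hpe ▸ hL.ne_zero), hpe ▸ hL⟩
  obtain ⟨P, p, hP, hPB, hp, hps, hL⟩ := cover hX hB
  by_cases hs' : LinearMap.ker π' = ⊥
  · have hXs' := hX'.simp_of_ker hs'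
    rcases hN.twist_eq hX hB hXp ha hP hPB hp hps hL with hs | ⟨⟨φ, hφ⟩, hR⟩
    · have hXs := hX.simp_of_ker hs
      refine ⟨fun hl => Or.inl ?_, hN.dep _ _ hXs hXs' hB hB'⟩
      obtain ⟨φ, hφ⟩ := hN.link _ _ hXs hXs' hB hB' hl
      refine ⟨φ, hφ, fun h => hXp' ?_⟩
      obtain ⟨ψ, hψ, he⟩ := exists_factor hφ (IsHom.id _) φ.surjective (by
        rw [LinearMap.ker_eq_bot.2 φ.injective]; exact bot_le)
      have h2 : Proj (X.tw χ) := by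
        have := h.comp_left hψ
        rwa [he] at this
      exact h2.iso ⟨φ, hφ⟩
    · have hLR : Loc (P.sub _ hp.ker) (P.sub _ hp.ker) LinearMap.id :=
        ⟨IsHom.id _, hR, fun v => ⟨v, rfl⟩, fun W hW h => by
          rw [(hR.2 W hW).resolve_right h]; exact bot_le⟩
      have hmain := hLR.coc_dep hXs' (X := X)
        (fun c t => ∃ b, CovCob p c b ∧ t = b ∘ₗ (LinearMap.ker p).subtype)
        (fun c hc => by
          obtain ⟨b, hb⟩ := hc.exists_covCob hp hP
          exact ⟨_, hb.isHom hp, b, hb, rfl⟩)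
        (by
          rintro c c' _ _ a b ⟨e, he, rfl⟩ ⟨e', he', rfl⟩
          exact ⟨_, he.lin he' a b, rfl⟩)
        (by
          rintro c ⟨b, hb, h0⟩
          exact hb.isCob hp hps (IsHom.zero _ _) fun v hv =>
            (LinearMap.congr_fun h0 ⟨v, hv⟩).symm)
      refine ⟨fun hl => Or.inr ?_, hmain.2⟩
      obtain ⟨t, ht, ht0⟩ := hmain.1 hl
      obtain ⟨ψ, hψ⟩ := (iso_of_simp hR hXs' ht ht0).symm
      obtain ⟨φ', hφ'⟩ : Iso (P.sub _ hL.hom.ker) (X.tw χ) := Iso.symm ⟨φ, hφ⟩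
      have hRK : LinearMap.ker p ≤ LinearMap.ker (π ∘ₗ p) := fun v hv => by
        rw [LinearMap.mem_ker, LinearMap.comp_apply, show p v = 0 from hv, map_zero]
      have hι := (isHom_subtype P _ hp.ker).codRestrict hL.hom.ker fun v => hRK v.2
      refine ⟨_, (hφ'.comp hι).comp hψ, fun hn => ?_⟩
      obtain ⟨ψ', hψ', hψe⟩ : ∃ ψ', IsHom (P.sub _ hp.ker) X' ψ' ∧ ψ.toLinearMap ∘ₗ ψ' =
          LinearMap.id := exists_cofactor hψ (IsHom.id _) ψ.injective (by
            rw [LinearMap.range_eq_top.2 ψ.surjective]; exact le_top)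
      obtain ⟨φ'', hφ'', hφe⟩ := exists_factor hφ' (IsHom.id _) φ'.surjective (by
        rw [LinearMap.ker_eq_bot.2 φ'.injective]; exact bot_le)
      have hn' := (hn.comp_right hψ').comp_left hφ''
      obtain ⟨e, he, hee⟩ := hn'.extend (isHom_subtype P _ hp.ker) Subtype.val_injective
      have hee' : ∀ v : LinearMap.ker p, ((e v : LinearMap.ker (π ∘ₗ p)) : P.V) = v := fun v => by
        have h1 : φ'' (φ' ((LinearMap.ker p).subtype.codRestrict _ (fun v => hRK v.2)
          (ψ (ψ' v)))) = e v := (LinearMap.congr_fun hee v).symm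
        have h2 : ψ (ψ' v) = v := LinearMap.congr_fun hψe v
        rw [show φ'' (φ' _) = _ from LinearMap.congr_fun hφe _, h2] at h1
        exact (congrArg Subtype.val h1).symm
      have hein : LinearMap.ker e = ⊥ := by
        rcases hN.chain hL hPB he.ker hp.ker with h | h
        · rw [Submodule.eq_bot_iff]
          intro v hv
          have h1 := hee' ⟨v, h hv⟩
          rw [show e v = 0 from hv] at h1
          exact h1.symm
        · exfalso
          have := hR.1
          obtain ⟨v, hv⟩ := exists_ne (0 : LinearMap.ker p)
          apply hv
          have h1 := hee' v
          rw [show e v = 0 from h v.2] at h1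
          exact Subtype.ext h1.symm
      have h1 := LinearMap.finrank_le_finrank_of_injective (LinearMap.ker_eq_bot.1 hein)
      exact absurd (Submodule.finrank_lt hL.ker_ne_top) (not_lt.2 h1)
  · obtain ⟨P', p', hP', hPB', hp', hps', hL'⟩ := cover hX' hB'
    obtain ⟨⟨φ, hφ⟩, -⟩ :=
      (hN.twist_eq hX' hB' hXp' ha' hP' hPB' hp' hps' hL').resolve_left hs'
    have hL'' := hL'.tw χ⁻¹
    have hP'' : Proj (P'.tw χ⁻¹) := tw_proj.2 hP'
    let ι : X'.V →ₗ[K] P'.V := (LinearMap.ker (π' ∘ₗ p')).subtype ∘ₗ φ.toLinearMap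
    have hι : IsHom X' (P'.tw χ⁻¹) ι := fun g v => by
      have h1 := hφ g v
      have h2 : ι ((χ g : K) • X'.ρ g v) = P'.ρ g (ι v) := congrArg Subtype.val h1
      rw [map_smul] at h2
      rw [tw_ρ, ← h2, smul_smul, MonoidHom.inv_apply, Units.inv_mul, one_smul]
    have hιinj : Function.Injective ι := fun v w h => φ.injective (Subtype.ext h)
    have hιr : LinearMap.range ι = LinearMap.ker (π' ∘ₗ p') := by
      rw [LinearMap.range_comp, LinearMap.range_eq_top.2 φ.surjective, Submodule.map_top,
        Submodule.range_subtype]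
    have hmain := hL.coc_dep hL''.simp (X := X) (X' := X')
      (fun c t => ∃ b E, CovCob p c b ∧ IsHom P (P'.tw χ⁻¹) E ∧
        (∀ v, p v = 0 → E v = ι (b v)) ∧ t = (π' ∘ₗ p') ∘ₗ E)
      (fun c hc => by
        obtain ⟨b, hb⟩ := hc.exists_covCob hp hP
        obtain ⟨E, hE, hEe⟩ := (hP''.null_to (hι.comp (hb.isHom hp))).extend
          (isHom_subtype P _ hp.ker) Subtype.val_injective
        exact ⟨_, hL''.hom.comp hE, b, E, hb, hE,
          fun v hv => LinearMap.congr_fun hEe ⟨v, hv⟩, rfl⟩)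
      (by
        rintro c c' _ _ a a' ⟨b, E, hb, hE, he, rfl⟩ ⟨b', E', hb', hE', he', rfl⟩
        refine ⟨_, a • E + a' • E', hb.lin hb' a a', (hE.smul a).add (hE'.smul a'),
          fun v hv => ?_, ?_⟩
        · simp only [LinearMap.add_apply, LinearMap.smul_apply, map_add, map_smul, he v hv,
            he' v hv]
        · rw [LinearMap.comp_add, LinearMap.comp_smul, LinearMap.comp_smul])
      (by
        rintro c ⟨b, E, hb, hE, he, h0⟩
        obtain ⟨e, hhe, hee⟩ := exists_cofactor hι hE hιinj (by
          rw [hιr]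
          rintro _ ⟨v, rfl⟩
          exact (LinearMap.congr_fun h0 v).symm)
        exact hb.isCob hp hps hhe fun v hv => hιinj
          ((he v hv).symm.trans (LinearMap.congr_fun hee v).symm))
    refine ⟨fun hl => ?_, hmain.2⟩
    obtain ⟨t, ht, ht0⟩ := hmain.1 hl
    have h1 : Iso (T.tw χ) T' := by
      refine (((hL.top_unique hL''.simp ht ht0).1.tw χ).trans (tw_tw _ _ _)).trans ?_
      rw [show χ⁻¹ * χ = 1 from by ext; simp]
      exact tw_one _
    exact hN.exists_nonnull (hX.tw χ) (hB.tw hN.triv) (fun h => hXp (tw_proj.1 h)) hX' hB' hXp' h1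

end Cores

end Rp

/-! ### Local packages of simple modules -/

namespace Rp

section Packages

variable {K Q : Type} [Field K] [Group Q] [Fintype Q] {d z : Q}

lemma nullOn_pull {N : Subgroup Q} (hd : d ∈ N) {X Y : Rp K Q} {φ : X.V →ₗ[K] Y.V}
    (h : NullOn (⟨d, hd⟩ : N) (X.pull N.subtype) (Y.pull N.subtype) φ) : NullOn d X Y φ := by
  obtain ⟨ψ, hψ⟩ := h
  refine ⟨ψ, hψ.trans ?_⟩
  rw [show orderOf (⟨d, hd⟩ : N) = orderOf d from Subgroup.orderOf_mk d hd]
  rfl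

lemma nullOn_comp {N : Subgroup Q} (hd : d ∈ N) {X Y : Rp K Q} {A B : Rp K N}
    {φ : X.V →ₗ[K] Y.V} (h : NullOn d X Y φ) {α : Y.V →ₗ[K] B.V} {β : A.V →ₗ[K] X.V}
    (hα : IsHom (Y.pull N.subtype) B α) (hβ : IsHom A (X.pull N.subtype) β) :
    NullOn (⟨d, hd⟩ : N) A B (α ∘ₗ φ ∘ₗ β) := by
  have h1 : NullOn (⟨d, hd⟩ : N) (X.pull N.subtype) (Y.pull N.subtype) φ := by
    obtain ⟨ψ, hψ⟩ := h
    refine ⟨ψ, hψ.trans ?_⟩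
    rw [show orderOf (⟨d, hd⟩ : N) = orderOf d from Subgroup.orderOf_mk d hd]
    rfl
  exact (h1.comp_right (hβ.cj _)).comp_left (hα.cj _)

/-- A non-projective local module over `N` attached to a module over `Q`. -/
structure Pkg {N : Subgroup Q} (hd : d ∈ N) (ε : MonoidAlgebra K N) (S : Rp K Q)
    {X T : Rp K N} (π : X.V →ₗ[K] T.V) (i : X.V →ₗ[K] S.V) (r : S.V →ₗ[K] X.V) : Prop where
  loc : Loc X T π
  np : ¬ Proj X
  inB : InB ε X
  hi : IsHom X (S.pull N.subtype) i
  hr : IsHom (S.pull N.subtype) X r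
  ri : r ∘ₗ i = LinearMap.id
  null : NullOn d S S (LinearMap.id - i ∘ₗ r)

variable {f : MonoidAlgebra K Q} {hd : d ∈ Nz z} {ε : MonoidAlgebra K (Nz z)}
  {χ : Nz z →* Kˣ}

lemma exists_pkg [IsAlgClosed K] (hε : LocalElt d z hd f ε) (hN : Nak ε χ) (htr : RelTr d f)
    {S : Rp K Q} (hS : Simp S) (hB : InB f S) (hnp : ¬ Proj S) :
    ∃ (X T : Rp K (Nz z)) (π : X.V →ₗ[K] T.V) (i : X.V →ₗ[K] S.V) (r : S.V →ₗ[K] X.V),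
      Pkg hd ε S π i r := by
  obtain ⟨M, i0, r0, hMB, hi0, hr0, hri0, hir0⟩ :=
    exists_cut hε.central hε.idem (S.pull (Nz z).subtype)
  have hn0 : NullOn d S S (LinearMap.id - i0 ∘ₗ r0) := by
    rw [hir0]; exact hε.null S hB
  have hM : ¬ Proj M := fun hP => hnp (by
    have h1 : Null (S.pull (Nz z).subtype) (S.pull (Nz z).subtype) (i0 ∘ₗ r0) := by
      have := (Null.comp_right hP hr0).comp_left hi0
      rwa [LinearMap.id_comp] at this
    have h1' := h1.nullOn (d := ⟨d, hd⟩)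
    have h2 : NullOn d S S (i0 ∘ₗ r0) := by
      apply nullOn_pull hd
      exact h1'
    have h3 : NullOn d S S LinearMap.id := by simpa using hn0.add h2
    exact (RelTr.relP htr hB).null_of_nullOn (IsHom.id S) h3)
  obtain ⟨X, T, π, i, r, hL, hXp, hXB, hi, hr, hri, hir⟩ := hN.exists_core hMB hM (fun θ hθ => by
    obtain ⟨φ, hφ, hφn⟩ := hε.lift S S hB hB _ (hi0.comp (hθ.comp hr0))
    obtain ⟨c, rfl⟩ := schur hS hφ
    refine ⟨c, (RelTr.relP hε.relTr hMB).null_of_nullOn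
      (hθ.sub ((IsHom.id M).smul c)) ?_⟩
    have h1 := (nullOn_comp hd hφn hr0 hi0).neg
    convert h1 using 1
    apply LinearMap.ext; intro v
    have h2 := LinearMap.congr_fun hri0
    simp only [LinearMap.comp_apply, LinearMap.id_apply] at h2
    simp [h2])
  refine ⟨X, T, π, i0 ∘ₗ i, r ∘ₗ r0, hL, hXp, hXB, hi0.comp hi, hr.comp hr0, ?_, ?_⟩
  · rw [LinearMap.comp_assoc, ← LinearMap.comp_assoc i, hri0, LinearMap.id_comp, hri]
  · have h0 := ((hir.comp_right hr0).comp_left hi0).nullOn (d := ⟨d, hd⟩)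
    have h1 : NullOn d S S (i0 ∘ₗ (LinearMap.id - i ∘ₗ r) ∘ₗ r0) := by
      apply nullOn_pull hd
      exact h0
    convert hn0.add h1 using 1
    apply LinearMap.ext; intro v
    simp

section Two

variable {S S' : Rp K Q} {X T X' T' : Rp K (Nz z)} {π : X.V →ₗ[K] T.V} {i : X.V →ₗ[K] S.V}
  {r : S.V →ₗ[K] X.V} {π' : X'.V →ₗ[K] T'.V} {i' : X'.V →ₗ[K] S'.V} {r' : S'.V →ₗ[K] X'.V}

lemma Pkg.lift (hε : LocalElt d z hd f ε) (hP : Pkg hd ε S π i r)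
    (hP' : Pkg hd ε S' π' i' r') (hB : InB f S) (hB' : InB f S') {u : X.V →ₗ[K] X'.V}
    (hu : IsHom X X' u) : ∃ φ, IsHom S S' φ ∧ Null X X' (r' ∘ₗ φ ∘ₗ i - u) := by
  obtain ⟨φ, hφ, hn⟩ := hε.lift S S' hB hB' _ (hP'.hi.comp (hu.comp hP.hr))
  have hφ' : IsHom (S.pull (Nz z).subtype) (S'.pull (Nz z).subtype) φ := fun g v => hφ g v
  refine ⟨φ, hφ, (RelTr.relP hε.relTr hP.inB).null_of_nullOn
    ((hP'.hr.comp (hφ'.comp hP.hi)).sub hu) ?_⟩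
  convert nullOn_comp hd hn hP'.hr hP.hi using 1
  apply LinearMap.ext; intro v
  have h1 := LinearMap.congr_fun hP.ri
  have h2 := LinearMap.congr_fun hP'.ri
  simp only [LinearMap.comp_apply, LinearMap.id_apply] at h1 h2
  simp [h1, h2]

lemma Pkg.iso_of_nonnull (hε : LocalElt d z hd f ε) (hP : Pkg hd ε S π i r)
    (hP' : Pkg hd ε S' π' i' r') (hS : Simp S) (hS' : Simp S') (hB : InB f S) (hB' : InB f S')
    {u : X.V →ₗ[K] X'.V} (hu : IsHom X X' u) (hn : ¬ Null X X' u) : Iso S S' := by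
  obtain ⟨φ, hφ, h⟩ := hP.lift hε hP' hB hB' hu
  refine iso_of_simp hS hS' hφ fun h0 => hn ?_
  rw [h0, LinearMap.zero_comp, LinearMap.comp_zero, zero_sub] at h
  simpa using h.neg

lemma Pkg.coc (hP : Pkg hd ε S π i r) (hP' : Pkg hd ε S' π' i' r')
    {c : Q → (S.V →ₗ[K] S'.V)} (hc : IsCoc S S' c) :
    IsCoc X X' (fun g : Nz z => r' ∘ₗ c g ∘ₗ i) := by
  have h0 : IsCoc (S.pull (Nz z).subtype) (S'.pull (Nz z).subtype) (fun g : Nz z => c g) :=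
    fun g h => hc g h
  exact (h0.comp_right hP.hi).comp_left hP'.hr

lemma Pkg.isCob (htr : RelTr d f) (hP : Pkg hd ε S π i r) (hP' : Pkg hd ε S' π' i' r')
    (hB : InB f S) {c : Q → (S.V →ₗ[K] S'.V)} (hc : IsCoc S S' c)
    (h : IsCob X X' (fun g : Nz z => r' ∘ₗ c g ∘ₗ i)) : IsCob S S' c := by
  obtain ⟨b, hb⟩ := h
  obtain ⟨b1, hb1⟩ := hc.cobOn_of_nullOn_right hP.null
  obtain ⟨b2, hb2⟩ := hc.cobOn_of_nullOn_left hP'.null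
  have hir : cj S S d (i ∘ₗ r) = i ∘ₗ r := (hP.hi.comp hP.hr).cj (⟨d, hd⟩ : Nz z)
  have hir' : cj S' S' d (i' ∘ₗ r') = i' ∘ₗ r' := (hP'.hi.comp hP'.hr).cj (⟨d, hd⟩ : Nz z)
  refine (RelTr.relP htr hB).cob_of_cobOn hc (b := b1 + b2 ∘ₗ (i ∘ₗ r) + i' ∘ₗ b ∘ₗ r) ?_
  have h3 : i' ∘ₗ (r' ∘ₗ c d ∘ₗ i) ∘ₗ r = cj S S' d (i' ∘ₗ b ∘ₗ r) - i' ∘ₗ b ∘ₗ r := by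
    have h4 : r' ∘ₗ c d ∘ₗ i = _ := hb ⟨d, hd⟩
    have h5 : cj S S' d (i' ∘ₗ b ∘ₗ r) = i' ∘ₗ cj X X' (⟨d, hd⟩ : Nz z) b ∘ₗ r := by
      have h6 : cj (S.pull (Nz z).subtype) (S'.pull (Nz z).subtype) (⟨d, hd⟩ : Nz z)
          (i' ∘ₗ b ∘ₗ r) = i' ∘ₗ cj X X' (⟨d, hd⟩ : Nz z) b ∘ₗ r := by
        rw [cj_comp (Y := X'), cj_comp (Y := X), hP'.hi.cj, hP.hr.cj]
      exact h6
    rw [h5, h4]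
    apply LinearMap.ext; intro v; simp
  have h7 : cj S S' d (b2 ∘ₗ (i ∘ₗ r)) = cj S S' d b2 ∘ₗ (i ∘ₗ r) := by
    rw [cj_comp (Y := S), hir]
  rw [map_add, map_add, h7]
  have e1 : c d = c d ∘ₗ (LinearMap.id - i ∘ₗ r)
      + (LinearMap.id - i' ∘ₗ r') ∘ₗ c d ∘ₗ (i ∘ₗ r)
      + i' ∘ₗ (r' ∘ₗ c d ∘ₗ i) ∘ₗ r := by
    apply LinearMap.ext; intro v; simp
  rw [← LinearMap.comp_assoc, hb2, hb1, h3] at e1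
  rw [e1, LinearMap.sub_comp]
  abel

end Two

/-- The twist of a package by the restriction of a character of the whole group. -/
lemma Pkg.tw {ξ : Q →* Kˣ} {S : Rp K Q} {X T : Rp K (Nz z)} {π : X.V →ₗ[K] T.V}
    {i : X.V →ₗ[K] S.V} {r : S.V →ₗ[K] X.V} (hP : Pkg hd ε S π i r)
    (hξ : ∀ g : Nz z, ε.coeff g ≠ 0 → ξ g = 1) :
    Pkg (S := S.tw ξ) (X := X.tw (ξ.comp (Nz z).subtype)) (T := T.tw (ξ.comp (Nz z).subtype))
      hd ε π i r where
  loc := hP.loc.tw _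
  np := fun h => hP.np (tw_proj.1 h)
  inB := hP.inB.tw fun g hg => hξ g hg
  hi := fun g v => by
    change i ((ξ g : K) • X.ρ g v) = (ξ g : K) • S.ρ g (i v)
    rw [map_smul, hP.hi g v]; rfl
  hr := fun g v => by
    change r ((ξ g : K) • S.ρ g v) = (ξ g : K) • X.ρ g (r v)
    rw [map_smul, ← hP.hr g v]; rfl
  ri := hP.ri
  null := by
    obtain ⟨ψ, hψ⟩ := hP.null
    exact ⟨ψ, hψ.trans (Finset.sum_congr rfl fun j _ => (tw_cj S S ξ (d ^ j) ψ).symm)⟩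

/-- A stable map from a twist of the local module to itself is surjective or zero. -/
lemma Pkg.null_of_not_surj (hε : LocalElt d z hd f ε) {ξ : Q →* Kˣ} {S : Rp K Q}
    {X T : Rp K (Nz z)} {π : X.V →ₗ[K] T.V} {i : X.V →ₗ[K] S.V} {r : S.V →ₗ[K] X.V}
    (hP : Pkg hd ε S π i r) (hξ : ∀ g : Nz z, ε.coeff g ≠ 0 → ξ g = 1) (hS : Simp S)
    (hB : InB f S) (hB' : InB f (S.tw ξ)) (u : X.V →ₗ[K] X.V)
    (hu : IsHom (X.tw (ξ.comp (Nz z).subtype)) X u) (hs : ¬ Function.Surjective u) :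
    Null (X.tw (ξ.comp (Nz z).subtype)) X u := by
  by_contra hn
  have hPt := hP.tw (ξ := ξ) hξ
  obtain ⟨φ, hφ, h⟩ := hPt.lift hε hP hB' hB hu
  have hφ0 : φ ≠ 0 := fun h0 => hn (by
    rw [h0, LinearMap.zero_comp, LinearMap.comp_zero, zero_sub] at h
    simpa using h.neg)
  have hbij : Function.Bijective φ := ⟨inj_of_simp (hS.tw ξ) hφ hφ0, surj_of_simp hS hφ hφ0⟩
  have hπu : π ∘ₗ u = 0 := by
    by_contra h0
    exact hs (hP.loc.surj_of (Z := X.tw (ξ.comp (Nz z).subtype)) hu h0)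
  have h1 : π ∘ₗ (r ∘ₗ φ ∘ₗ i - u) = 0 := by
    by_contra h0
    exact hPt.loc.not_null hε.central hε.idem hPt.inB hPt.np hP.loc.simp
      (hP.loc.hom.comp h.isHom) h0 (h.comp_left hP.loc.hom)
  rw [LinearMap.comp_sub, hπu, sub_zero] at h1
  let e := LinearEquiv.ofBijective φ hbij
  have hφe : ∀ v, φ (e.symm v) = v := e.apply_symm_apply
  have he : IsHom S (S.tw ξ) (e.symm : S.V →ₗ[K] S.V) := fun g v => hbij.1 (by
    rw [hφ]
    change φ (e.symm (S.ρ g v)) = S.ρ g (φ (e.symm v))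
    rw [hφe, hφe])
  have he' : IsHom (S.pull (Nz z).subtype) ((S.tw ξ).pull (Nz z).subtype)
      (e.symm : S.V →ₗ[K] S.V) := fun g v => he g v
  have hφ' : IsHom ((S.tw ξ).pull (Nz z).subtype) (S.pull (Nz z).subtype) φ := fun g v => hφ g v
  have h2 : NullOn d S S (φ ∘ₗ (LinearMap.id - i ∘ₗ r) ∘ₗ (e.symm : S.V →ₗ[K] S.V)) :=
    (hPt.null.comp_right (he.cj d)).comp_left (hφ.cj d)
  have h3 := nullOn_comp hd h2 hP.hr hP.hi
  have h4 : Null X X (LinearMap.id - (r ∘ₗ φ ∘ₗ i) ∘ₗ (r ∘ₗ (e.symm : S.V →ₗ[K] S.V) ∘ₗ i)) := by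
    refine (RelTr.relP hε.relTr hP.inB).null_of_nullOn ((IsHom.id X).sub
      ((hP.hr.comp (hφ'.comp hPt.hi)).comp (hPt.hr.comp (he'.comp hP.hi)))) ?_
    convert h3 using 1
    apply LinearMap.ext; intro v
    have h5 := LinearMap.congr_fun hP.ri
    simp only [LinearMap.comp_apply, LinearMap.id_apply] at h5
    simp [h5, hφe]
  have h6 : Null X T π := by
    have h7 := h4.comp_left hP.loc.hom
    rwa [LinearMap.comp_sub, ← LinearMap.comp_assoc _ _ π, h1, LinearMap.zero_comp, sub_zero,
      LinearMap.comp_id] at h7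
  exact hP.loc.not_null hε.central hε.idem hP.inB hP.np hP.loc.simp hP.loc.hom
    hP.loc.ne_zero h6

end Packages

end Rp

/-! ### Descent to a quotient -/

namespace Rp

section Descent

variable {K Q : Type} [Field K] [Group Q]

/-- The representation of `Q / Z` on which `Q` acts as on `X`. -/
abbrev desc (X : Rp K Q) (Z : Subgroup Q) [Z.Normal] (h : ∀ z ∈ Z, X.ρ z = 1) :
    Rp K (Q ⧸ Z) where
  V := X.V
  ρ := QuotientGroup.lift Z X.ρ h

variable {X Y : Rp K Q} {Z : Subgroup Q} [Z.Normal] {hX : ∀ z ∈ Z, X.ρ z = 1}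
  {hY : ∀ z ∈ Z, Y.ρ z = 1}

lemma desc_inv {W : Submodule K X.V} : (X.desc Z hX).Inv W ↔ X.Inv W :=
  ⟨fun h g => h (g : Q ⧸ Z), fun h q => by
    obtain ⟨g, rfl⟩ := QuotientGroup.mk_surjective q
    exact h g⟩

lemma Simp.desc (h : Simp X) : Simp (X.desc Z hX) := ⟨h.1, fun W hW => h.2 W (desc_inv.1 hW)⟩

lemma InB.desc {f : MonoidAlgebra K Q} (h : InB f X) :
    InB (MonoidAlgebra.mapDomainAlgHom K K (QuotientGroup.mk' Z) f) (X.desc Z hX) := by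
  have h1 := act_pull (X.desc Z hX) (QuotientGroup.mk' Z) f
  exact h1.symm.trans h

/-- A cocycle vanishing on `Z` descends. -/
lemma IsCoc.exists_desc {c : Q → (X.V →ₗ[K] Y.V)} (hc : IsCoc X Y c) (h0 : ∀ z ∈ Z, c z = 0) :
    ∃ c' : Q ⧸ Z → (X.V →ₗ[K] Y.V), IsCoc (X.desc Z hX) (Y.desc Z hY) c' ∧
      ∀ g : Q, c' g = c g := by
  refine ⟨Quotient.lift c fun a b hab => ?_, ?_, fun g => rfl⟩
  · have h1 : a⁻¹ * b ∈ Z := QuotientGroup.leftRel_apply.1 hab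
    have h2 := hc a (a⁻¹ * b)
    rw [mul_inv_cancel_left, h0 _ h1, map_zero, add_zero] at h2
    exact h2.symm
  · intro q q'
    obtain ⟨g, rfl⟩ := QuotientGroup.mk_surjective q
    obtain ⟨g', rfl⟩ := QuotientGroup.mk_surjective q'
    exact hc g g'

lemma isCob_of_desc {c : Q → (X.V →ₗ[K] Y.V)} {c' : Q ⧸ Z → (X.V →ₗ[K] Y.V)}
    (h : IsCob (X.desc Z hX) (Y.desc Z hY) c') (he : ∀ g : Q, c' g = c g) : IsCob X Y c := by
  obtain ⟨b, hb⟩ := h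
  exact ⟨b, fun g => (he g).symm.trans (hb g)⟩

end Descent

end Rp

/-! ### Normal cyclic subgroups of prime order -/

section NormalCase

variable {K Q : Type} [Field K] [Group Q] [Fintype Q] {p n : ℕ} [Fact p.Prime] [CharP K p]

lemma orderOf_pow_prime {d : Q} (h : orderOf d = p ^ (n + 1)) : orderOf (d ^ p ^ n) = p := by
  have hp : p.Prime := Fact.out
  rw [orderOf_pow_of_dvd (pow_ne_zero _ hp.ne_zero) (h ▸ pow_dvd_pow p (Nat.le_succ n)), h,
    pow_succ, Nat.mul_div_cancel_left _ (pow_pos hp.pos n)]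

lemma bot_of_orderOf {d : Q} (h : orderOf d = p ^ (n + 1)) : Bot K d (d ^ p ^ n) := by
  have hp : p.Prime := Fact.out
  have hz := orderOf_pow_prime h
  refine ⟨Subgroup.npow_mem_zpowers d _, fun x hx hx1 => ?_, fun h1 => ?_, ?_⟩
  · obtain ⟨i, rfl⟩ : ∃ i : ℕ, d ^ i = x := by
      simpa using (mem_zpowers_iff_mem_range_orderOf.1 hx) |> fun h => by
        obtain ⟨i, -, hi⟩ := Finset.mem_image.1 h
        exact ⟨i, hi⟩
    obtain ⟨k, hk, hke⟩ := (Nat.dvd_prime_pow hp).1 (Nat.gcd_dvd_right i (p ^ (n + 1)))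
    have hkn : k ≤ n := by
      by_contra hlt
      have hk' : k = n + 1 := by omega
      apply hx1
      rw [← orderOf_dvd_iff_pow_eq_one, h, ← hk', ← hke]
      exact Nat.gcd_dvd_left _ _
    have h2 : d ^ p ^ k ∈ Subgroup.zpowers (d ^ i) := by
      refine ⟨Nat.gcdA i (p ^ (n + 1)), ?_⟩
      have h3 := Nat.gcd_eq_gcd_ab i (p ^ (n + 1))
      rw [hke] at h3
      change (d ^ i) ^ _ = _
      rw [← zpow_natCast d (p ^ k), h3, zpow_add, zpow_mul, zpow_mul, zpow_natCast, zpow_natCast,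
        ← h, pow_orderOf_eq_one, one_zpow, mul_one]
    rw [show d ^ p ^ n = (d ^ p ^ k) ^ p ^ (n - k) from by
      rw [← pow_mul, ← pow_add, Nat.add_sub_cancel' hkn]]
    exact pow_mem h2 _
  · rw [h1, orderOf_one] at hz
    exact hp.one_lt.ne hz
  · rw [hz, CharP.cast_eq_zero]

/-- The cyclic subgroup of order `p` in `⟨d⟩` is normal and `χ` describes the conjugation. -/
structure NormCyc (p n : ℕ) (d : Q) (χ : Q →* Kˣ) : Prop where
  ord : orderOf d = p ^ (n + 1)
  act : ∀ g, ∃ a : ℕ, g * d ^ p ^ n * g⁻¹ = (d ^ p ^ n) ^ a ∧ (χ g : K) = a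

variable {d : Q} {χ : Q →* Kˣ}

lemma NormCyc.normal (h : NormCyc p n d χ) : (Subgroup.zpowers (d ^ p ^ n)).Normal := by
  refine ⟨fun x hx g => ?_⟩
  obtain ⟨i, rfl⟩ := Subgroup.mem_zpowers_iff.1 hx
  obtain ⟨a, ha, -⟩ := h.act g
  rw [← conj_zpow, ha]
  exact zpow_mem (pow_mem (Subgroup.mem_zpowers _) _) _

lemma NormCyc.eq_one (h : NormCyc p n d χ) {g : Q} (hg : d ^ p ^ n * g = g * d ^ p ^ n) :
    χ g = 1 := by
  obtain ⟨a, ha, hc⟩ := h.act g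
  ext
  rw [hc, Units.val_one]
  rw [← hg, mul_inv_cancel_right] at ha
  have h1 : (d ^ p ^ n) ^ 1 = (d ^ p ^ n) ^ a := by rw [pow_one]; exact ha
  rw [pow_eq_pow_iff_modEq, orderOf_pow_prime h.ord] at h1
  have h2 := (CharP.natCast_eq_natCast K p).2 h1
  rw [← h2, Nat.cast_one]

namespace Rp

variable {X Y : Rp K Q}

lemma _root_.ProfiniteBlocks.NormCyc.triv (h : NormCyc p n d χ) (hX : Simp X) :
    X.ρ (d ^ p ^ n) = 1 := by
  set z := d ^ p ^ n with hz
  have : Nontrivial X.V := hX.1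
  have : CharP (Module.End K X.V) p := charP_of_injective_algebraMap
    (algebraMap K (Module.End K X.V)).injective p
  have h1 : (X.ρ z - 1) ^ p = 0 := by
    rw [sub_pow_char_of_commute _ (Commute.one_right _), one_pow, ← map_pow,
      ← orderOf_pow_prime h.ord, pow_orderOf_eq_one, map_one, sub_self]
  have hinv : X.Inv (LinearMap.ker (X.ρ z - 1)) := fun g v hv => by
    obtain ⟨a, ha, -⟩ := h.act g⁻¹
    rw [inv_inv] at ha
    have hv1 : X.ρ z v = v := by
      rw [LinearMap.mem_ker, LinearMap.sub_apply] at hv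
      exact sub_eq_zero.1 hv
    have hv2 : ∀ b : ℕ, X.ρ (z ^ b) v = v := fun b => by
      induction b with
      | zero => rw [pow_zero, map_one]; rfl
      | succ b ih => rw [pow_succ, ρ_mul, hv1, ih]
    rw [LinearMap.mem_ker, LinearMap.sub_apply, sub_eq_zero]
    change X.ρ z (X.ρ g v) = X.ρ g v
    rw [← ρ_mul, show z * g = g * z ^ a from by rw [← ha, ← hz]; group, ρ_mul, hv2]
  rcases hX.2 _ hinv with h2 | h2
  · exfalso
    have h3 : Function.Injective ((X.ρ z - 1) ^ p : Module.End K X.V) := by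
      rw [Module.End.coe_pow]
      exact (LinearMap.ker_eq_bot.1 h2).iterate p
    obtain ⟨v, hv⟩ := exists_ne (0 : X.V)
    exact hv (h3 (by rw [h1]; simp))
  · exact sub_eq_zero.1 (LinearMap.ker_eq_top.1 h2)

lemma rho_one_of_mem {z : Q} (h : X.ρ z = 1) : ∀ x ∈ Subgroup.zpowers z, X.ρ x = 1 :=
  fun x hx => by
    have h1 : Subgroup.zpowers z ≤ MonoidHom.ker (X.ρ.toHomUnits) := by
      rw [Subgroup.zpowers_le, MonoidHom.mem_ker]
      ext1; exact h
    have h2 := MonoidHom.mem_ker.1 (h1 hx)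
    exact congrArg Units.val h2

variable {c : Q → (X.V →ₗ[K] Y.V)}

lemma IsCoc.map_pow (hc : IsCoc X Y c) {z : Q} (hX : X.ρ z = 1) (hY : Y.ρ z = 1) (a : ℕ) :
    c (z ^ a) = (a : K) • c z := by
  have hz : ∀ φ, cj X Y z φ = φ := fun φ => by
    have h2 : X.ρ z⁻¹ = 1 := rho_one_of_mem hX _ (inv_mem (Subgroup.mem_zpowers z))
    ext v; rw [cj_apply, hY, h2]; rfl
  induction a with
  | zero => rw [pow_zero, hc.one, Nat.cast_zero, zero_smul]
  | succ a ih => rw [pow_succ', hc, hz, ih, Nat.cast_succ, add_smul, one_smul, add_comm]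

lemma IsCoc.isHom_tw (hc : IsCoc X Y c) (h : NormCyc p n d χ) (hX : Simp X) (hY : Simp Y) :
    IsHom (X.tw χ) Y (c (d ^ p ^ n)) := by
  set z := d ^ p ^ n with hz
  have hXz := h.triv hX
  have hYz := h.triv hY
  have key : ∀ g, cj X Y g (c z) = (χ g : K) • c z := fun g => by
    obtain ⟨a, ha, hχ⟩ := h.act g
    rw [← hz] at ha
    have h1 : g * z = z ^ a * g := by rw [← ha]; group
    have h2 : ∀ φ, cj X Y (z ^ a) φ = φ := fun φ => by
      have h3 := rho_one_of_mem hXz _ (inv_mem (pow_mem (Subgroup.mem_zpowers z) a))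
      have h4 := rho_one_of_mem hYz _ (pow_mem (Subgroup.mem_zpowers z) a)
      ext v; rw [cj_apply, h3, h4]; rfl
    have h5 := hc g z
    rw [h1, hc, h2, hc.map_pow hXz hYz, add_comm] at h5
    rw [hχ]; exact (add_left_cancel h5).symm
  intro g v
  have h1 := LinearMap.congr_fun (key g) (X.ρ g v)
  rw [cj_apply, ← ρ_mul, inv_mul_cancel, map_one] at h1
  rw [tw_ρ, map_smul]
  exact h1.symm

lemma IsCoc.map_pow_sum (hc : IsCoc X Y c) (d : Q) (m : ℕ) :
    c (d ^ m) = ∑ j ∈ Finset.range m, cj X Y (d ^ j) (c d) := by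
  induction m with
  | zero => rw [pow_zero, hc.one, Finset.sum_range_zero]
  | succ m ih => rw [pow_succ, hc, ih, Finset.sum_range_succ]

lemma _root_.ProfiniteBlocks.NormCyc.triv_of_mem (h : NormCyc p n d χ) (hX : Simp X)
    {Z : Subgroup Q} (hZ : Z = Subgroup.zpowers (d ^ p ^ n)) : ∀ x ∈ Z, X.ρ x = 1 :=
  fun x hx => rho_one_of_mem (h.triv hX) x (hZ ▸ hx)

variable {f : MonoidAlgebra K Q} {Z : Subgroup Q} [Z.Normal]

lemma orderOf_mk (hZ : Z = Subgroup.zpowers (d ^ p ^ n)) (h : orderOf d = p ^ (n + 1)) :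
    orderOf (d : Q ⧸ Z) = p ^ n := by
  have hp : p.Prime := Fact.out
  cases n with
  | zero =>
    rw [pow_zero, orderOf_eq_one_iff, QuotientGroup.eq_one_iff, hZ]
    simp
  | succ m =>
    refine orderOf_eq_prime_pow (fun h1 => ?_) ?_
    · have h2 : d ^ p ^ m ∈ Z := (QuotientGroup.eq_one_iff _).1 h1
      rw [hZ] at h2
      have h3 := Subgroup.zpowers_le.2 h2
      have h4 := Subgroup.card_le_of_le h3
      rw [Nat.card_zpowers, Nat.card_zpowers, orderOf_pow_prime h,
        orderOf_pow_of_dvd (pow_ne_zero _ hp.ne_zero) (h ▸ pow_dvd_pow p (by omega)), h,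
        Nat.pow_div (by omega) hp.pos, show m + 1 + 1 - m = 2 from by omega] at h4
      have := hp.one_lt
      nlinarith
    · refine (QuotientGroup.eq_one_iff (d ^ p ^ (m + 1))).2 ?_
      rw [hZ]; exact Subgroup.mem_zpowers _

lemma relTr_mk (hZ : Z = Subgroup.zpowers (d ^ p ^ n)) (hf : RelTr d f) :
    RelTr (QuotientGroup.mk' Z d) (MonoidAlgebra.mapDomainAlgHom K K (QuotientGroup.mk' Z) f) :=
  ProfiniteBlocks.RelTr.map hf _ (QuotientGroup.mk'_surjective _) fun x hx => by
    have h1 := (QuotientGroup.eq_one_iff x).1 hx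
    rw [hZ] at h1
    exact Subgroup.zpowers_le.2 (Subgroup.npow_mem_zpowers d _) h1

lemma proj_desc_of_nullOn (h : NormCyc p n d χ) (hZ : Z = Subgroup.zpowers (d ^ p ^ n))
    (hX : Simp X) (hf : RelTr d f) (hB : InB f X) (ψ : X.V →ₗ[K] X.V)
    (hψ : LinearMap.id = ∑ j ∈ Finset.range (p ^ n), cj X X (d ^ j) ψ) :
    Proj (X.desc Z (h.triv_of_mem hX hZ)) := by
  refine RelP.null_of_nullOn (RelTr.relP (relTr_mk hZ hf) hB.desc) (IsHom.id _) ⟨ψ, ?_⟩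
  rw [show orderOf (QuotientGroup.mk' Z d) = p ^ n from orderOf_mk hZ h.ord]
  exact hψ

/-- If a cocycle does not vanish at the bottom, its source is projective over the quotient. -/
lemma IsCoc.proj_desc (hc : IsCoc X Y c) (h : NormCyc p n d χ)
    (hZ : Z = Subgroup.zpowers (d ^ p ^ n)) (hX : Simp X) (hY : Simp Y) (hf : RelTr d f)
    (hB : InB f X) (h0 : c (d ^ p ^ n) ≠ 0) : Proj (X.desc Z (h.triv_of_mem hX hZ)) := by
  have hhom := hc.isHom_tw h hX hY
  let e := LinearEquiv.ofBijective (c (d ^ p ^ n))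
    ⟨inj_of_simp (hX.tw χ) hhom h0, surj_of_simp (X := X.tw χ) hY hhom h0⟩
  have he : ∀ v, e.symm (c (d ^ p ^ n) v) = v := e.symm_apply_apply
  have hinv : ∀ j, cj Y X (d ^ j) e.symm = e.symm := cj_pow_eq (by
    have h1 : χ d = 1 := h.eq_one ((pow_succ d _).symm.trans (pow_succ' d _))
    ext v
    obtain ⟨v, rfl⟩ := e.surjective v
    have h2 := hhom d⁻¹ v
    rw [tw_ρ, map_inv, h1, inv_one, Units.val_one, one_smul] at h2
    rw [cj_apply]
    change X.ρ d (e.symm (Y.ρ d⁻¹ (c (d ^ p ^ n) v))) = e.symm (c (d ^ p ^ n) v)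
    rw [← h2, he, he, ρ_inv_self])
  refine proj_desc_of_nullOn h hZ hX hf hB ((e.symm : Y.V →ₗ[K] X.V) ∘ₗ c d) ?_
  have h1 : LinearMap.id = (e.symm : Y.V →ₗ[K] X.V) ∘ₗ c (d ^ p ^ n) := by
    ext v; exact (he v).symm
  rw [h1, hc.map_pow_sum]
  ext v
  simp only [LinearMap.comp_apply, LinearMap.sum_apply, map_sum]
  refine Finset.sum_congr rfl fun j _ => ?_
  rw [cj_comp (Y := Y), hinv, LinearMap.comp_apply]

/-- Reduction of the statement on extensions to cocycles of the quotient. -/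
lemma nak_of_desc [IsAlgClosed K] (h : NormCyc p n d χ) (hZ : Z = Subgroup.zpowers (d ^ p ^ n))
    (hf : ∀ g, cjA K Q g f = f) (hi : f * f = f) (htr : RelTr d f)
    (hs : ∀ g, f.coeff g ≠ 0 → χ g = 1)
    (hq : ∀ (S S' : Rp K Q) (hS : Simp S) (hS' : Simp S'), InB f S → InB f S' →
      ¬ Proj (S.desc Z (h.triv_of_mem hS hZ)) → ¬ Proj (S'.desc Z (h.triv_of_mem hS' hZ)) →
      (Linked (S.desc Z (h.triv_of_mem hS hZ)) (S'.desc Z (h.triv_of_mem hS' hZ)) →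
        Iso (S.tw χ) S') ∧
      ∀ c c', IsCoc (S.desc Z (h.triv_of_mem hS hZ)) (S'.desc Z (h.triv_of_mem hS' hZ)) c →
        IsCoc (S.desc Z (h.triv_of_mem hS hZ)) (S'.desc Z (h.triv_of_mem hS' hZ)) c' →
        ∃ a b : K, (a ≠ 0 ∨ b ≠ 0) ∧
          IsCob (S.desc Z (h.triv_of_mem hS hZ)) (S'.desc Z (h.triv_of_mem hS' hZ))
            (a • c + b • c')) : Nak f χ := by
  have key : ∀ (S S' : Rp K Q) (hS : Simp S) (hS' : Simp S') (c : Q → (S.V →ₗ[K] S'.V)),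
      IsCoc S S' c → c (d ^ p ^ n) = 0 → ∀ x ∈ Z, c x = 0 := by
    intro S S' hS hS' c hc h0 x hx
    rw [hZ] at hx
    obtain ⟨i, -, rfl⟩ := Finset.mem_image.1 (mem_zpowers_iff_mem_range_orderOf.1 hx)
    rw [hc.map_pow (h.triv hS) (h.triv hS'), h0, smul_zero]
  refine ⟨hf, hi, hs, fun S S' hS hS' hB hB' => ?_, fun S S' hS hS' hB hB' c c' hc hc' => ?_⟩
  · rintro ⟨c, hc, hcb⟩
    by_cases h0 : c (d ^ p ^ n) = 0
    · obtain ⟨c1, hc1, he⟩ := hc.exists_desc (hX := h.triv_of_mem hS hZ)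
        (hY := h.triv_of_mem hS' hZ) (key S S' hS hS' c hc h0)
      have hcb1 : ¬ IsCob (S.desc Z (h.triv_of_mem hS hZ)) (S'.desc Z (h.triv_of_mem hS' hZ)) c1 :=
        fun hh => hcb (isCob_of_desc hh he)
      exact (hq S S' hS hS' hB hB' (fun hP => hcb1 (hc1.cob_of_proj_left hP))
        (fun hP => hcb1 (hc1.cob_of_proj_right hP))).1 ⟨c1, hc1, hcb1⟩
    · exact iso_of_simp (hS.tw χ) hS' (hc.isHom_tw h hS hS') h0
  · have hcomb : ∀ a b : K, a • c (d ^ p ^ n) + b • c' (d ^ p ^ n) = 0 →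
        ∀ x ∈ Z, (a • c + b • c') x = 0 := fun a b hab =>
      key S S' hS hS' _ ((hc.smul a).add (hc'.smul b)) hab
    by_cases hP : Proj (S.desc Z (h.triv_of_mem hS hZ)) ∨
        Proj (S'.desc Z (h.triv_of_mem hS' hZ))
    · obtain ⟨a, b, hab, h0⟩ := schur_dep (hS.tw χ) hS' (hc.isHom_tw h hS hS')
        (hc'.isHom_tw h hS hS')
      refine ⟨a, b, hab, ?_⟩
      obtain ⟨c1, hc1, he⟩ := ((hc.smul a).add (hc'.smul b)).exists_desc
        (hX := h.triv_of_mem hS hZ) (hY := h.triv_of_mem hS' hZ) (hcomb a b h0)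
      exact isCob_of_desc (hP.elim hc1.cob_of_proj_left hc1.cob_of_proj_right) he
    · rw [not_or] at hP
      have hz : ∀ c, IsCoc S S' c → c (d ^ p ^ n) = 0 := fun c hc => by
        by_contra h0
        exact hP.1 (hc.proj_desc h hZ hS hS' htr hB h0)
      obtain ⟨c1, hc1, he⟩ := hc.exists_desc (hX := h.triv_of_mem hS hZ)
        (hY := h.triv_of_mem hS' hZ) (key S S' hS hS' c hc (hz c hc))
      obtain ⟨c1', hc1', he'⟩ := hc'.exists_desc (hX := h.triv_of_mem hS hZ)
        (hY := h.triv_of_mem hS' hZ) (key S S' hS hS' c' hc' (hz c' hc'))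
      obtain ⟨a, b, hab, hcb⟩ := (hq S S' hS hS' hB hB' hP.1 hP.2).2 c1 c1' hc1 hc1'
      refine ⟨a, b, hab, isCob_of_desc hcb fun g => ?_⟩
      simp only [Pi.add_apply, Pi.smul_apply, he, he']

end Rp

end NormalCase

namespace Rp

section Induction

variable {K Q : Type} [Field K] [Group Q]

lemma _root_.ProfiniteBlocks.mapDomain_cjA {Q' : Type} [Group Q'] (π : Q →* Q') (g : Q)
    (a : MonoidAlgebra K Q) : MonoidAlgebra.mapDomainAlgHom K K π (cjA K Q g a) =
      cjA K Q' (π g) (MonoidAlgebra.mapDomainAlgHom K K π a) := by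
  simp only [cjA_apply, map_mul, MonoidAlgebra.mapDomainAlgHom_apply,
    MonoidAlgebra.mapDomain_single, map_inv]

lemma _root_.ProfiniteBlocks.exists_of_coeff_ne {Q' : Type} [Group Q'] (π : Q →* Q')
    {a : MonoidAlgebra K Q} {y : Q'}
    (h : (MonoidAlgebra.mapDomainAlgHom K K π a).coeff y ≠ 0) :
    ∃ x, π x = y ∧ a.coeff x ≠ 0 := by
  have h1 : y ∈ (Finsupp.mapDomain π a.coeff).support := Finsupp.mem_support_iff.2 h
  obtain ⟨x, hx, hxy⟩ := Finset.mem_image.1 (Finsupp.mapDomain_support h1)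
  exact ⟨x, hxy, Finsupp.mem_support_iff.1 hx⟩

variable [Fintype Q] [IsAlgClosed K]

/-- Extensions between non-projective simples, controlled by a local element. -/
lemma _root_.ProfiniteBlocks.LocalElt.link_dep {d z : Q} {hd : d ∈ Nz z} {f : MonoidAlgebra K Q}
    {ε : MonoidAlgebra K (Nz z)} (hε : LocalElt d z hd f ε) {ξ : Q →* Kˣ}
    (hN : Nak ε (ξ.comp (Nz z).subtype)) (htr : RelTr d f)
    (hξ : ∀ g, f.coeff g ≠ 0 → ξ g = 1) {S S' : Rp K Q} (hS : Simp S) (hS' : Simp S')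
    (hB : InB f S) (hB' : InB f S') (hnp : ¬ Proj S) (hnp' : ¬ Proj S') :
    (Linked S S' → Iso (S.tw ξ) S') ∧ ∀ c c', IsCoc S S' c → IsCoc S S' c' →
      ∃ a b : K, (a ≠ 0 ∨ b ≠ 0) ∧ IsCob S S' (a • c + b • c') := by
  have hξ' : ∀ g : Nz z, ε.coeff g ≠ 0 → ξ g = 1 := hN.triv
  obtain ⟨X, T, π, i, r, hP⟩ := exists_pkg hε hN htr hS hB hnp
  obtain ⟨X', T', π', i', r', hP'⟩ := exists_pkg hε hN htr hS' hB' hnp'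
  have hcore := hN.link_core hP.loc hP.inB hP.np
    (hP.null_of_not_surj hε hξ' hS hB (hB.tw hξ)) hP'.loc hP'.inB hP'.np
    (hP'.null_of_not_surj hε hξ' hS' hB' (hB'.tw hξ))
  refine ⟨?_, fun c c' hc hc' => ?_⟩
  · rintro ⟨c, hc, hcb⟩
    have hPt := hP.tw hξ'
    rcases hcore.1 ⟨_, hP.coc hP' hc, fun h => hcb (hP.isCob htr hP' hB hc h)⟩ with
      ⟨u, hu, hun⟩ | ⟨u, hu, hun⟩
    · exact hPt.iso_of_nonnull hε hP' (hS.tw ξ) hS' (hB.tw hξ) hB' hu hun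
    · exact (hP'.iso_of_nonnull hε hPt hS' (hS.tw ξ) hB' (hB.tw hξ) hu hun).symm
  · obtain ⟨a, b, hab, h⟩ := hcore.2 _ _ (hP.coc hP' hc) (hP.coc hP' hc')
    refine ⟨a, b, hab, hP.isCob htr hP' hB ((hc.smul a).add (hc'.smul b)) ?_⟩
    convert h using 2 with g
    ext v
    simp

variable {p : ℕ} [Fact p.Prime] [CharP K p]

theorem _root_.ProfiniteBlocks.NormCyc.nak (n : ℕ) : ∀ {Q : Type} [Group Q] [Fintype Q] {d : Q}
    {χ : Q →* Kˣ} {f : MonoidAlgebra K Q}, NormCyc p n d χ → (∀ g, cjA K Q g f = f) →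
    f * f = f → RelTr d f → (∀ g, f.coeff g ≠ 0 → χ g = 1) → Nak f χ := by
  induction n with
  | zero =>
    intro Q _ _ d χ f h hf hi htr hs
    have := h.normal
    refine nak_of_desc h rfl hf hi htr hs fun S S' hS hS' hB hB' hnp => (hnp ?_).elim
    refine proj_desc_of_nullOn h rfl hS htr hB LinearMap.id ?_
    ext v
    simp
  | succ m ih =>
    intro Q _ _ d χ f h hf hi htr hs
    have hp : p.Prime := Fact.out
    have := h.normal
    set Z := Subgroup.zpowers (d ^ p ^ (m + 1)) with hZ
    set q := QuotientGroup.mk' Z with hq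
    have hqs : Function.Surjective q := QuotientGroup.mk'_surjective Z
    set fb := MonoidAlgebra.mapDomainAlgHom K K q f with hfb
    have hord : orderOf (q d) = p ^ (m + 1) := orderOf_mk hZ h.ord
    have hbot := bot_of_orderOf (K := K) hord
    have hfbc : ∀ g, cjA K (Q ⧸ Z) g fb = fb := fun g => by
      obtain ⟨g, rfl⟩ := hqs g
      conv_rhs => rw [hfb, ← hf g]
      exact (mapDomain_cjA q g f).symm
    have hfbi : fb * fb = fb := by rw [hfb, ← map_mul, hi]
    have hfbt : RelTr (q d) fb := relTr_mk hZ htr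
    obtain ⟨ε, hε⟩ := hbot.exists_localElt hfbc hfbi hfbt
    have hχZ : ∀ x ∈ Z, χ x = 1 := fun x hx => by
      obtain ⟨i, rfl⟩ := Subgroup.mem_zpowers_iff.1 hx
      exact h.eq_one ((Commute.refl _).zpow_right i)
    let ξ : Q ⧸ Z →* Kˣ := QuotientGroup.lift Z χ hχZ
    have hξ : ∀ g, fb.coeff g ≠ 0 → ξ g = 1 := by
      intro g hg
      obtain ⟨x, rfl, hx⟩ := exists_of_coeff_ne q hg
      exact hs x hx
    have hcyc : NormCyc p m (⟨q d, hbot.d_mem⟩ : Nz (q d ^ p ^ m))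
        (ξ.comp (Nz (q d ^ p ^ m)).subtype) := by
      refine ⟨(Subgroup.orderOf_mk _ _).trans hord, fun g => ?_⟩
      obtain ⟨x, hx⟩ := hqs g
      obtain ⟨a, -, ha⟩ := Finset.mem_image.1 (mem_zpowers_iff_mem_range_orderOf.1
        ((Subgroup.mem_normalizer_iff.1 g.2 _).1 (Subgroup.mem_zpowers (q d ^ p ^ m))))
      refine ⟨a, Subtype.ext ha.symm, ?_⟩
      have h1 : q ((d ^ p ^ m) ^ a) = q (x * d ^ p ^ m * x⁻¹) := by
        simp only [map_pow, map_mul, map_inv, hx]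
        exact ha
      have h2 := QuotientGroup.eq.1 h1
      obtain ⟨b, hb⟩ := Subgroup.mem_zpowers_iff.1 h2
      rw [eq_inv_mul_iff_mul_eq] at hb
      have h3 : x * d ^ p ^ (m + 1) * x⁻¹ = (d ^ p ^ (m + 1)) ^ a := by
        have hpz : (d ^ p ^ (m + 1)) ^ p = 1 := by
          have h4 := pow_orderOf_eq_one (d ^ p ^ (m + 1))
          rwa [orderOf_pow_prime h.ord] at h4
        rw [show d ^ p ^ (m + 1) = (d ^ p ^ m) ^ p from by rw [← pow_mul, ← pow_succ]]
          at hpz hb ⊢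
        generalize d ^ p ^ m = w at hpz hb ⊢
        have hc : Commute (w ^ a) ((w ^ p) ^ b) := ((Commute.refl w).pow_pow a p).zpow_right b
        rw [← conj_pow, ← hb, hc.mul_pow, ← zpow_natCast ((w ^ p) ^ b), ← zpow_mul, mul_comm b,
          zpow_mul, zpow_natCast, hpz, one_zpow, mul_one, ← pow_mul, ← pow_mul, mul_comm a p]
      obtain ⟨a', ha', hχ⟩ := h.act x
      rw [h3, pow_eq_pow_iff_modEq, orderOf_pow_prime h.ord] at ha'
      rw [(CharP.natCast_eq_natCast K p).2 ha', ← hχ]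
      change ((ξ (g : Q ⧸ Z) : Kˣ) : K) = _
      rw [← hx]; rfl
    have hN : Nak ε (ξ.comp (Nz (q d ^ p ^ m)).subtype) :=
      ih hcyc hε.central hε.idem hε.relTr fun g hg => hcyc.eq_one (Subtype.ext (hε.supp g hg))
    refine nak_of_desc h hZ hf hi htr hs fun S S' hS hS' hB hB' hnp hnp' => ?_
    obtain ⟨h1, h2⟩ := hε.link_dep hN hfbt hξ hS.desc hS'.desc hB.desc hB'.desc hnp hnp'
    refine ⟨fun hl => ?_, h2⟩
    obtain ⟨φ, hφ⟩ := h1 hl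
    exact ⟨φ, fun g => hφ (q g)⟩

end Induction

end Rp

namespace Rp

section Chains

variable {K Q : Type} [Field K] [Group Q] [Fintype Q] {X X' T T' : Rp K Q}
  {f : MonoidAlgebra K Q} {χ : Q →* Kˣ} {π : X.V →ₗ[K] T.V} {π' : X'.V →ₗ[K] T'.V}

/-- A non-zero homomorphism between submodules of local modules relates the tops. -/
lemma Nak.tops_of_hom (hN : Nak f χ) (hX : Loc X T π) (hB : InB f X) (hX' : Loc X' T' π')
    (hB' : InB f X') {W : Rp K Q} {j : W.V →ₗ[K] X.V} (hj : IsHom W X j)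
    (hji : Function.Injective j) {u : W.V →ₗ[K] X'.V} (hu : IsHom W X' u) (h0 : u ≠ 0) :
    ∃ a b : ℕ, Iso (T.tw (χ ^ a)) (T'.tw (χ ^ b)) := by
  have hW : Nontrivial W.V := by
    by_contra hW
    rw [not_nontrivial_iff_subsingleton] at hW
    exact h0 (LinearMap.ext fun v => by rw [Subsingleton.elim v 0, map_zero, map_zero])
  obtain ⟨a, T1, π1, hL1, hi1⟩ := hN.sub_loc hX hB hj hji hW
  have hR : Nontrivial (X'.sub _ hu.range).V := by
    obtain ⟨v, hv⟩ : ∃ v, u v ≠ 0 := by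
      by_contra! h
      exact h0 (LinearMap.ext h)
    exact ⟨⟨⟨u v, v, rfl⟩, 0, fun h => hv (congrArg Subtype.val h)⟩⟩
  obtain ⟨b, T2, π2, hL2, hi2⟩ := hN.sub_loc hX' hB' (isHom_subtype X' _ hu.range)
    (Submodule.subtype_injective _) hR
  obtain ⟨π3, hL3, -⟩ := hL1.of_surj (Y := X'.sub _ hu.range)
    (q := u.codRestrict _ fun v => ⟨v, rfl⟩)
    (hu.codRestrict hu.range _) (by rintro ⟨_, v, rfl⟩; exact ⟨v, rfl⟩) hR
  exact ⟨a, b, hi1.trans ((hL3.top_unique hL2.simp hL2.hom hL2.ne_zero).1.trans hi2.symm)⟩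

lemma Nak.tops_of_linked (hN : Nak f χ) (hX : Loc X T π) (hB : InB f X) (hX' : Loc X' T' π')
    (hB' : InB f X') (h : Linked X X') : ∃ a b : ℕ, Iso (T.tw (χ ^ a)) (T'.tw (χ ^ b)) := by
  obtain ⟨P, πP, hP, hPB, hL⟩ :=
    exists_cover hN.central hN.idem hX.simp (hB.of_surj hX.hom hX.surj)
  obtain ⟨q, hq, hqe⟩ := hP.lift hL.hom hX.hom hX.surj
  have hqs := hX.surj_of hq (hqe ▸ hL.ne_zero)
  obtain ⟨c, hc, hcb⟩ := h
  obtain ⟨b, hb⟩ := hc.exists_covCob hq hP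
  refine hN.tops_of_hom hL hPB hX' hB' (isHom_subtype P _ hq.ker)
    (Submodule.subtype_injective _) (hb.isHom hq) fun h0 => hcb ?_
  exact hb.isCob hq hqs (IsHom.zero _ _) fun v hv => LinearMap.congr_fun h0 ⟨v, hv⟩

end Chains

section Bound

variable {K Q : Type} [Field K] [Group Q] [Fintype Q]

lemma Pkg.iso {d : Q} {N : Subgroup Q} {hd : d ∈ N} {ε : MonoidAlgebra K N} {S S' : Rp K Q}
    {X T : Rp K N} {π : X.V →ₗ[K] T.V} {i : X.V →ₗ[K] S.V} {r : S.V →ₗ[K] X.V}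
    (hP : Pkg hd ε S π i r) (h : Iso S S') : ∃ i' r', Pkg hd ε S' π i' r' := by
  obtain ⟨φ, hφ⟩ := h
  have hφ' : IsHom S' S (φ.symm : S'.V →ₗ[K] S.V) := fun g v => φ.injective (by
    have := hφ g (φ.symm v)
    simp only [LinearEquiv.coe_coe, LinearEquiv.apply_symm_apply] at this ⊢
    exact this.symm)
  refine ⟨φ ∘ₗ i, r ∘ₗ φ.symm, hP.loc, hP.np, hP.inB, ?_, ?_, ?_, ?_⟩
  · exact IsHom.comp (X := X) (Y := S.pull N.subtype) (Z := S'.pull N.subtype)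
      (fun g => hφ g) hP.hi
  · exact IsHom.comp (X := S'.pull N.subtype) (Y := S.pull N.subtype) (Z := X) hP.hr
      (fun g => hφ' g)
  · rw [← hP.ri]; ext v; simp
  · have h1 := (hP.null.comp_left (hφ.cj d)).comp_right (hφ'.cj d)
    convert h1 using 1
    ext v; simp

variable {p : ℕ} [Fact p.Prime] [CharP K p]

/-- The character by which the normalizer of a subgroup of order `p` acts on it. -/
lemma exists_normCyc {d : Q} {n : ℕ} (h : orderOf d = p ^ (n + 1)) (hd : d ∈ Nz (d ^ p ^ n)) :
    ∃ χ : Nz (d ^ p ^ n) →* Kˣ, NormCyc p n (⟨d, hd⟩ : Nz (d ^ p ^ n)) χ ∧ χ ^ (p - 1) = 1 := by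
  have hp : p.Prime := Fact.out
  set z := d ^ p ^ n with hz
  have hoz : orderOf z = p := orderOf_pow_prime h
  have hex : ∀ g : Nz z, ∃ a : ℕ, z ^ a = (g : Q) * z * (g : Q)⁻¹ := fun g => by
    obtain ⟨a, -, ha⟩ := Finset.mem_image.1 (mem_zpowers_iff_mem_range_orderOf.1
      ((Subgroup.mem_normalizer_iff.1 g.2 _).1 (Subgroup.mem_zpowers z)))
    exact ⟨a, ha⟩
  choose a ha using hex
  have hcast : ∀ b c : ℕ, z ^ b = z ^ c → (b : K) = c := fun b c hbc => by
    rw [pow_eq_pow_iff_modEq, hoz] at hbc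
    exact (CharP.natCast_eq_natCast K p).2 hbc
  let φ : Nz z →* K :=
    { toFun := fun g => a g
      map_one' := by
        rw [← Nat.cast_one]
        exact hcast _ _ (by rw [ha]; simp)
      map_mul' := fun g g' => by
        rw [← Nat.cast_mul]
        refine hcast _ _ ?_
        rw [ha, pow_mul, ha, conj_pow, ha]
        simp [mul_assoc] }
  refine ⟨φ.toHomUnits, ⟨?_, fun g => ⟨a g, Subtype.ext (ha g).symm, rfl⟩⟩, ?_⟩
  · exact (Subgroup.orderOf_mk _ _).trans h
  · ext g
    change ((φ.toHomUnits g : Kˣ) : K) ^ (p - 1) = 1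
    have h1 : ((φ.toHomUnits g : Kˣ) : K) ≠ 0 := Units.ne_zero _
    have h2 : ((φ.toHomUnits g : Kˣ) : K) ^ p = (φ.toHomUnits g : Kˣ) :=
      map_natCast (frobenius K p) (a g)
    refine mul_right_cancel₀ h1 ?_
    rw [← pow_succ, Nat.sub_add_cancel hp.one_le, h2, one_mul]

/-- One step in the linking of simples belonging to `f`. -/
def Adj (f : MonoidAlgebra K Q) (S S' : Rp K Q) : Prop :=
  Simp S' ∧ InB f S' ∧ (Iso S S' ∨ Linked S S' ∨ Linked S' S)

lemma tw_pow_mul_pow {X : Rp K Q} {χ : Q →* Kˣ} (a b : ℕ) :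
    Iso ((X.tw (χ ^ a)).tw (χ ^ b)) (X.tw (χ ^ (a + b))) := by
  rw [show χ ^ (a + b) = χ ^ a * χ ^ b from by ext; simp [pow_add]]; exact tw_tw _ _ _

lemma iso_of_tw_iso {T T' : Rp K Q} {χ : Q →* Kˣ} {m : ℕ} (hm : χ ^ m = 1) (hm0 : 0 < m)
    {a b : ℕ} (h : Iso (T.tw (χ ^ a)) (T'.tw (χ ^ b))) : ∃ c, Iso (T.tw (χ ^ c)) T' := by
  obtain ⟨e, he⟩ : ∃ e, b + e = m * b :=
    ⟨m * b - b, Nat.add_sub_cancel' (Nat.le_mul_of_pos_left b hm0)⟩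
  refine ⟨a + e, (tw_pow_mul_pow a e).symm.trans ((h.tw (χ ^ e)).trans
    ((tw_pow_mul_pow b e).trans ?_))⟩
  rw [he, show χ ^ (m * b) = 1 from MonoidHom.ext fun g => by
    rw [MonoidHom.pow_apply, pow_mul, ← MonoidHom.pow_apply, hm]; simp]
  exact tw_one T'

/-- Among `p` simples linked to each other in a block with cyclic defect group, two are
isomorphic. -/
theorem exists_iso_of_adj [IsAlgClosed K] {f : MonoidAlgebra K Q} (hf : ∀ g, cjA K Q g f = f)
    (hi : f * f = f) {d : Q} (hd : ∃ n, orderOf d = p ^ n) (htr : RelTr d f) {S₀ : Rp K Q}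
    (hS₀ : Simp S₀) (hB₀ : InB f S₀) (S : Fin p → Rp K Q)
    (hS : ∀ i, Relation.ReflTransGen (Adj f) S₀ (S i)) : ∃ i j, i ≠ j ∧ Iso (S i) (S j) := by
  have hp : p.Prime := Fact.out
  by_cases hP₀ : Proj S₀
  · have key : ∀ S', Relation.ReflTransGen (Adj f) S₀ S' → Iso S₀ S' := fun S' h => by
      induction h with
      | refl => exact Iso.refl _
      | tail _ h ih =>
        rcases h.2.2 with h1 | ⟨c, hc, hcb⟩ | ⟨c, hc, hcb⟩
        · exact ih.trans h1
        · exact (hcb (hc.cob_of_proj_left (hP₀.iso ih))).elim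
        · exact (hcb (hc.cob_of_proj_right (hP₀.iso ih))).elim
    exact ⟨⟨0, hp.pos⟩, ⟨1, hp.one_lt⟩, by simp, (key _ (hS _)).symm.trans (key _ (hS _))⟩
  obtain ⟨n, hn⟩ := hd
  obtain rfl | ⟨n, rfl⟩ : n = 0 ∨ ∃ m, n = m + 1 := by cases n <;> simp
  · refine (hP₀ ((RelTr.relP htr hB₀).null_of_nullOn (IsHom.id _) ⟨LinearMap.id, ?_⟩)).elim
    rw [hn]; ext v; simp
  have hbot := bot_of_orderOf (K := K) hn
  obtain ⟨χ, hχ, hχp⟩ := exists_normCyc (K := K) hn hbot.d_mem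
  obtain ⟨ε, hε⟩ := hbot.exists_localElt hf hi htr
  have hN : Nak ε χ := hχ.nak n hε.central hε.idem hε.relTr fun g hg =>
    hχ.eq_one (Subtype.ext (hε.supp g hg))
  have hm0 : 0 < p - 1 := Nat.sub_pos_of_lt hp.one_lt
  obtain ⟨X₀, T₀, π₀, i₀, r₀, hP⟩ := exists_pkg hε hN htr hS₀ hB₀ hP₀
  have key : ∀ S', Relation.ReflTransGen (Adj f) S₀ S' → Simp S' ∧ InB f S' ∧
      ∃ (a : ℕ) (X T : Rp K (Nz (d ^ p ^ n))) (π : X.V →ₗ[K] T.V) (i : X.V →ₗ[K] S'.V)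
        (r : S'.V →ₗ[K] X.V), Pkg hbot.d_mem ε S' π i r ∧ Iso (T₀.tw (χ ^ a)) T := by
    intro S' h
    induction h with
    | refl =>
      exact ⟨hS₀, hB₀, 0, X₀, T₀, π₀, i₀, r₀, hP, by
        rw [show χ ^ 0 = 1 from by ext; simp]; exact tw_one _⟩
    | @tail S S' _ h ih =>
      obtain ⟨hSs, hSB, a, X, T, π, i, r, hPX, hT⟩ := ih
      refine ⟨h.1, h.2.1, ?_⟩
      rcases h.2.2 with h1 | h1
      · obtain ⟨i', r', hP'⟩ := hPX.iso h1
        exact ⟨a, X, T, π, i', r', hP', hT⟩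
      have hnp : ¬ Proj S' := fun hpr => h1.elim
        (fun ⟨c, hc, hcb⟩ => hcb (hc.cob_of_proj_right hpr))
        (fun ⟨c, hc, hcb⟩ => hcb (hc.cob_of_proj_left hpr))
      obtain ⟨X', T', π', i', r', hPX'⟩ := exists_pkg hε hN htr h.1 h.2.1 hnp
      have h2 : ∃ x y : ℕ, Iso (T.tw (χ ^ x)) (T'.tw (χ ^ y)) := by
        rcases h1 with ⟨c, hc, hcb⟩ | ⟨c, hc, hcb⟩
        · exact hN.tops_of_linked hPX.loc hPX.inB hPX'.loc hPX'.inB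
            ⟨_, hPX.coc hPX' hc, fun h => hcb (hPX.isCob htr hPX' hSB hc h)⟩
        · obtain ⟨x, y, hxy⟩ := hN.tops_of_linked hPX'.loc hPX'.inB hPX.loc hPX.inB
            ⟨_, hPX'.coc hPX hc, fun h' => hcb (hPX'.isCob htr hPX h.2.1 hc h')⟩
          exact ⟨y, x, hxy.symm⟩
      obtain ⟨x, y, hxy⟩ := h2
      obtain ⟨c, hc⟩ := iso_of_tw_iso hχp hm0
        ((tw_pow_mul_pow a x).symm.trans ((hT.tw (χ ^ x)).trans hxy))
      exact ⟨c, X', T', π', i', r', hPX', hc⟩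
  choose hSs hSB a X T π i r hPX hT using fun j => key _ (hS j)
  obtain ⟨j, j', hjj, hjm⟩ := Fintype.exists_ne_map_eq_of_card_lt
    (fun j : Fin p => (⟨a j % (p - 1), Nat.mod_lt _ hm0⟩ : Fin (p - 1)))
    (by simpa using hp.pos)
  have hmod : ∀ b : ℕ, χ ^ b = χ ^ (b % (p - 1)) := fun b => MonoidHom.ext fun g => by
    rw [MonoidHom.pow_apply, MonoidHom.pow_apply]
    exact pow_eq_pow_mod b (by rw [← MonoidHom.pow_apply, hχp]; rfl)
  have hTT : Iso (T j) (T j') := by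
    refine (hT j).symm.trans (Iso.trans ?_ (hT j'))
    rw [hmod (a j), hmod (a j'), Fin.mk.inj hjm]
    exact Iso.refl _
  refine ⟨j, j', hjj, ?_⟩
  rcases hN.exists_nonnull (hPX j).loc (hPX j).inB (hPX j).np (hPX j').loc (hPX j').inB
    (hPX j').np hTT with ⟨s, hs, hsn⟩ | ⟨s, hs, hsn⟩
  · exact (hPX j).iso_of_nonnull hε (hPX j') (hSs j) (hSs j') (hSB j) (hSB j') hs hsn
  · exact ((hPX j').iso_of_nonnull hε (hPX j) (hSs j') (hSs j) (hSB j') (hSB j) hs hsn).symm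

end Bound

end Rp

namespace Rp

section Split

variable {K Q : Type} [Field K] [Group Q] [Fintype Q]

/-- A class sum intertwines a cocycle up to a coboundary. -/
lemma IsCoc.act_comm {X Y : Rp K Q} {c : Q → (X.V →ₗ[K] Y.V)} (hc : IsCoc X Y c)
    {f : MonoidAlgebra K Q} (hf : ∀ g, cjA K Q g f = f) :
    ∃ b, ∀ g, c g ∘ₗ X.act f - Y.act f ∘ₗ c g = b - cj X Y g b := by
  refine ⟨∑ h, f.coeff h • (c h ∘ₗ X.ρ h), fun g => ?_⟩
  have hco : ∀ h, f.coeff (g * h * g⁻¹) = f.coeff h := fun h => by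
    conv_lhs => rw [← hf g, cjA_coeff]
    congr 1; group
  have h1 : cj X Y g (∑ h, f.coeff h • (c h ∘ₗ X.ρ h)) =
      ∑ h, f.coeff h • (c h ∘ₗ X.ρ h + Y.ρ h ∘ₗ c g - c g ∘ₗ X.ρ h) := by
    rw [map_sum]
    refine Fintype.sum_equiv (MulAut.conj g).toEquiv _ _ fun h => ?_
    simp only [MulEquiv.toEquiv_eq_coe, EquivLike.coe_coe, MulAut.conj_apply, hco, map_smul]
    congr 1
    have h2 : c g + cj X Y g (c h) = c (g * h * g⁻¹) + cj X Y (g * h * g⁻¹) (c g) := by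
      rw [← hc, ← hc]; congr 1; group
    have h3 : cj X Y g (c h) = c (g * h * g⁻¹) + cj X Y (g * h * g⁻¹) (c g) - c g := by
      rw [← h2]; abel
    have h4 : cj X X g (X.ρ h) = X.ρ (g * h * g⁻¹) := by
      ext v; simp [cj_apply]
    rw [cj_comp (Y := X), h3, h4, LinearMap.sub_comp, LinearMap.add_comp]
    congr 2
    ext v
    simp only [LinearMap.comp_apply, cj_apply, ρ_self_inv]
  rw [h1, act_eq_sum, act_eq_sum]
  ext v
  simp only [LinearMap.sub_apply, LinearMap.comp_apply, LinearMap.sum_apply,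
    LinearMap.smul_apply, LinearMap.add_apply, smul_sub, smul_add, Finset.sum_sub_distrib,
    Finset.sum_add_distrib, map_sum, map_smul]
  abel

lemma act_eq_one_or_zero {S : Rp K Q} (hS : Simp S) {f : MonoidAlgebra K Q}
    (hf : ∀ g, cjA K Q g f = f) (hi : f * f = f) : S.act f = 1 ∨ S.act f = 0 := by
  have h2 : ∀ v, S.act f (S.act f v) = S.act f v := fun v => by
    rw [← Module.End.mul_apply, ← map_mul, hi]
  by_cases h : S.act f = 0
  · exact Or.inr h
  · left
    ext v
    exact inj_of_simp hS (isHom_act S hf) h (h2 v)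

lemma not_linked_of_act {X Y : Rp K Q} {f : MonoidAlgebra K Q} (hf : ∀ g, cjA K Q g f = f)
    (hX : InB f X) (hY : Y.act f = 0) : ¬ Linked X Y ∧ ¬ Linked Y X := by
  constructor
  · rintro ⟨c, hc, hcb⟩
    obtain ⟨b, hb⟩ := hc.act_comm hf
    refine hcb ⟨-b, fun g => ?_⟩
    have := hb g
    rw [show X.act f = 1 from hX, hY] at this
    rw [show c g = b - cj X Y g b by rw [← this]; ext v; simp, map_neg]
    abel
  · rintro ⟨c, hc, hcb⟩
    obtain ⟨b, hb⟩ := hc.act_comm hf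
    refine hcb ⟨b, fun g => ?_⟩
    have := hb g
    rw [show X.act f = 1 from hX, hY] at this
    rw [← neg_sub, ← this]; ext v; simp

variable (K Q) in
/-- The regular representation. -/
abbrev reg : Rp K Q where
  V := MonoidAlgebra K Q
  ρ :=
    { toFun := fun g => LinearMap.mulLeft K (MonoidAlgebra.single g 1)
      map_one' := LinearMap.ext fun a => by
        rw [LinearMap.mulLeft_apply, ← MonoidAlgebra.one_def, one_mul]; rfl
      map_mul' := fun g g' => LinearMap.ext fun a => by
        change MonoidAlgebra.single (g * g') 1 * a =
          MonoidAlgebra.single g 1 * (MonoidAlgebra.single g' 1 * a)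
        rw [← mul_assoc, MonoidAlgebra.single_mul_single, one_mul] }

lemma reg_act (a b : MonoidAlgebra K Q) : (reg K Q).act a b = a * b := by
  induction a using MonoidAlgebra.induction_linear with
  | zero => rw [map_zero, zero_mul]; rfl
  | add x y hx hy => rw [map_add, add_mul, ← hx, ← hy]; rfl
  | single g c =>
    rw [act_single]
    change c • (MonoidAlgebra.single g 1 * b) = _
    rw [← smul_mul_assoc, MonoidAlgebra.smul_single, smul_eq_mul, mul_one]

lemma reg_inv {W : Submodule K (reg K Q).V} (hW : (reg K Q).Inv W) (a b : MonoidAlgebra K Q)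
    (hb : b ∈ W) : a * b ∈ W := by
  induction a using MonoidAlgebra.induction_linear with
  | zero => rw [zero_mul]; exact W.zero_mem
  | add x y hx hy => rw [add_mul]; exact W.add_mem hx hy
  | single g c =>
    have h := W.smul_mem c (hW g b hb)
    change c • (MonoidAlgebra.single g 1 * b) ∈ W at h
    rwa [← smul_mul_assoc, MonoidAlgebra.smul_single, smul_eq_mul, mul_one] at h

/-- An idempotent which is central and kills every simple vanishes. -/
lemma eq_zero_of_act_simp {u : MonoidAlgebra K Q} (hu : u * u = u) (hc : ∀ a, a * u = u * a)
    (h : ∀ S : Rp K Q, Simp S → S.act u = 0) : u = 0 := by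
  by_contra h0
  have hz : IsHom (reg K Q) (reg K Q) (LinearMap.mulLeft K u) := fun g v => by
    change u * (MonoidAlgebra.single g 1 * v) = MonoidAlgebra.single g 1 * (u * v)
    rw [← mul_assoc, ← hc, mul_assoc]
  have hne : LinearMap.ker (LinearMap.mulLeft K u) ≠ ⊤ := fun ht => by
    have : (1 : MonoidAlgebra K Q) ∈ LinearMap.ker (LinearMap.mulLeft K u) := by
      rw [ht]; trivial
    exact h0 (by simpa using this)
  obtain ⟨S, q, hS, hq, hqs, hle⟩ := exists_simple_quot_le hz.ker hne
  refine hS.ne_zero_of_surj hqs (LinearMap.ext fun v => ?_)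
  have h1 : v - u * v ∈ LinearMap.ker q := hle (by
    rw [LinearMap.mem_ker, LinearMap.mulLeft_apply, mul_sub, ← mul_assoc, hu, sub_self])
  have h2 : q (u * v) = 0 := by
    have := hq.act u v
    rw [reg_act, h S hS] at this
    exact this
  rw [LinearMap.mem_ker, map_sub, h2, sub_zero] at h1
  exact h1

/-- A class of simples closed under isomorphism and linking. -/
structure Cls (C : Rp K Q → Prop) : Prop where
  iso : ∀ {S S'}, C S → Iso S S' → C S'
  link : ∀ {S S'}, Simp S → Simp S' → C S → ¬ C S' → ¬ Linked S S' ∧ ¬ Linked S' S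

lemma Cls.compl {C : Rp K Q → Prop} (h : Cls C) : Cls (fun S => ¬ C S) where
  iso := fun h1 hi h2 => h1 (h.iso h2 hi.symm)
  link := fun hS hS' h1 h2 => (h.link hS' hS (not_not.1 h2) h1).symm

/-- Every simple subquotient of the submodule `W` lies in the class. -/
def Pure (C : Rp K Q → Prop) (M : Rp K Q) (W : Submodule K M.V) : Prop :=
  ∀ (Y S : Rp K Q) (j : Y.V →ₗ[K] M.V) (t : Y.V →ₗ[K] S.V), IsHom Y M j →
    Function.Injective j → LinearMap.range j ≤ W → Simp S → IsHom Y S t → t ≠ 0 → C S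

variable {C : Rp K Q → Prop} {M N : Rp K Q}

lemma Pure.of_inj {φ : N.V →ₗ[K] M.V} {W : Submodule K M.V} (h : Pure C M W) (hφ : IsHom N M φ)
    (hi : Function.Injective φ) {W' : Submodule K N.V} (hW : W'.map φ ≤ W) : Pure C N W' := by
  intro Y S j t hj hji hjW hS ht h0
  refine h Y S (φ ∘ₗ j) t (hφ.comp hj) (hi.comp hji) ?_ hS ht h0
  rw [LinearMap.range_comp]
  exact (Submodule.map_mono hjW).trans hW

lemma Pure.hom_eq_zero (hM : Pure C M ⊤) (hN : Pure (fun S => ¬ C S) N ⊤)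
    {φ : M.V →ₗ[K] N.V} (hφ : IsHom M N φ) : φ = 0 := by
  by_contra h0
  have hne : (⊥ : Submodule K (N.sub _ hφ.range).V) ≠ ⊤ := fun hb => h0 (LinearMap.ext fun v => by
    have : (⟨φ v, LinearMap.mem_range_self φ v⟩ : LinearMap.range φ) ∈
      (⊥ : Submodule K (LinearMap.range φ)) := by rw [hb]; trivial
    exact congrArg Subtype.val ((Submodule.mem_bot K).1 this))
  obtain ⟨S, q, hS, hq, hqs, -⟩ := exists_simple_quot_le (inv_bot (N.sub _ hφ.range)) hne
  have hr : IsHom M (N.sub _ hφ.range) φ.rangeRestrict := fun g v => Subtype.ext (hφ g v)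
  refine hN _ S (Submodule.subtype _) q (isHom_subtype N _ hφ.range) Subtype.val_injective le_top
    hS hq (hS.ne_zero_of_surj hqs)
    (hM M S LinearMap.id (q ∘ₗ φ.rangeRestrict) (IsHom.id M) Function.injective_id le_top hS
      (hq.comp hr) (hS.ne_zero_of_surj (hqs.comp φ.surjective_rangeRestrict)))

lemma Cls.cob (hC : Cls C) {S : Rp K Q} (hS : Simp S) (hCS : C S) {c : Q → (S.V →ₗ[K] N.V)}
    (hN : Pure (fun S => ¬ C S) N ⊤) (hc : IsCoc S N c) : IsCob S N c := by
  induction hn : Module.finrank K N.V using Nat.strong_induction_on generalizing N with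
  | _ n ih =>
    by_cases hb : (⊥ : Submodule K N.V) = ⊤
    · have : Subsingleton N.V := (Submodule.subsingleton_iff K).1 (subsingleton_of_bot_eq_top hb)
      exact ⟨0, fun g => LinearMap.ext fun v => Subsingleton.elim _ _⟩
    obtain ⟨T, q, hT, hq, hqs, -⟩ := exists_simple_quot_le (inv_bot N) hb
    have hCT : ¬ C T := hN N T LinearMap.id q (IsHom.id N) Function.injective_id le_top hT hq
      (hT.ne_zero_of_surj hqs)
    have h1 : IsCob S T (fun g => q ∘ₗ c g) := by
      by_contra h
      exact (hC.link hS hT hCS hCT).1 ⟨_, hc.comp_left hq, h⟩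
    obtain ⟨b, hb⟩ := h1
    obtain ⟨r, hr⟩ := q.exists_rightInverse_of_surjective (LinearMap.range_eq_top.2 hqs)
    set b' : S.V →ₗ[K] N.V := r ∘ₗ b with hb'
    have hqb : q ∘ₗ b' = b := by rw [hb', ← LinearMap.comp_assoc, hr, LinearMap.id_comp]
    have hm : ∀ g v, (c g - (cj S N g b' - b')) v ∈ LinearMap.ker q := fun g v => by
      have h2 := LinearMap.congr_fun (hb g) v
      have h3 : q ∘ₗ cj S N g b' = cj S T g b := by
        rw [← hqb, cj_comp (Y := N), hq.cj]
      have h4 := LinearMap.congr_fun h3 v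
      have h5 := LinearMap.congr_fun hqb v
      simp only [LinearMap.comp_apply, LinearMap.sub_apply] at h2 h4 h5
      simp only [LinearMap.mem_ker, LinearMap.sub_apply, map_sub, h2, h4, h5]
      abel
    have hlt : Module.finrank K (N.sub _ hq.ker).V < n := by
      rw [← hn]
      exact Submodule.finrank_lt fun ht => hT.ne_zero_of_surj hqs (LinearMap.ker_eq_top.1 ht)
    have hcob : IsCoc S N (fun g => c g - (cj S N g b' - b')) := by
      have := hc.add ((IsCob.isCoc ⟨b', fun g => rfl⟩ :
        IsCoc S N (fun g => cj S N g b' - b')).smul (-1))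
      convert this using 2 with g
      simp [sub_eq_add_neg]
    obtain ⟨b₂, hb₂⟩ := ih _ hlt (N := N.sub _ hq.ker)
      (c := fun g => (c g - (cj S N g b' - b')).codRestrict _ (hm g))
      (hN.of_inj (isHom_subtype N _ hq.ker) Subtype.val_injective le_top)
      (fun g g' => LinearMap.ext fun v => Subtype.ext (LinearMap.congr_fun (hcob g g') v)) rfl
    refine ⟨b' + (LinearMap.ker q).subtype ∘ₗ b₂, fun g => ?_⟩
    have h2 : (LinearMap.ker q).subtype ∘ₗ
        ((c g - (cj S N g b' - b')).codRestrict _ (hm g) : S.V →ₗ[K] (N.sub _ hq.ker).V) =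
        cj S N g ((LinearMap.ker q).subtype ∘ₗ b₂) - (LinearMap.ker q).subtype ∘ₗ b₂ := by
      refine (congrArg ((LinearMap.ker q).subtype ∘ₗ ·) (hb₂ g)).trans ?_
      rw [LinearMap.comp_sub, cj_comp (Y := N.sub _ hq.ker), (isHom_subtype N _ hq.ker).cj]
    have h3 : c g - (cj S N g b' - b') =
        cj S N g ((LinearMap.ker q).subtype ∘ₗ b₂) - (LinearMap.ker q).subtype ∘ₗ b₂ := h2
    rw [map_add, ← sub_eq_zero, ← sub_eq_zero.2 h3]
    abel

lemma Pure.of_hom {S : Rp K Q} (hC : Cls C) (hS : Simp S) (hCS : C S) {t : M.V →ₗ[K] S.V}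
    (ht : IsHom M S t) {W : Submodule K M.V} (h : Pure C M (W ⊓ LinearMap.ker t)) :
    Pure C M W := by
  intro Y T j τ hj hji hjW hT hτ h0
  have htj := ht.comp hj
  by_cases hk : LinearMap.ker (t ∘ₗ j) ≤ LinearMap.ker τ
  · have hne : t ∘ₗ j ≠ 0 := fun h => h0 (LinearMap.ext fun v => hk (by rw [h]; rfl))
    obtain ⟨c, hc, hcτ⟩ := exists_factor htj hτ (surj_of_simp hS htj hne) hk
    exact hC.iso hCS (iso_of_simp hS hT hc fun h => h0 (by rw [← hcτ, h]; rfl))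
  · refine h (Y.sub _ htj.ker) T (j ∘ₗ Submodule.subtype _) (τ ∘ₗ Submodule.subtype _)
      (hj.comp (isHom_subtype Y _ htj.ker)) (hji.comp Subtype.val_injective) ?_ hT
      (hτ.comp (isHom_subtype Y _ htj.ker)) ?_
    · rintro _ ⟨v, rfl⟩
      exact ⟨hjW ⟨_, rfl⟩, v.2⟩
    · intro h2
      exact hk fun v hv => LinearMap.congr_fun h2 ⟨v, hv⟩

lemma isHom_projectionOnto {W₁ W₂ : Submodule K M.V} (h₁ : M.Inv W₁) (h₂ : M.Inv W₂)
    (hc : IsCompl W₁ W₂) :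
    IsHom M (M.sub W₁ h₁) (W₁.projectionOnto W₂ hc : M.V →ₗ[K] (M.sub W₁ h₁).V) := fun g v => by
  obtain ⟨a, ha, b, hb, rfl⟩ := Submodule.mem_sup.1
    (show v ∈ W₁ ⊔ W₂ by rw [hc.sup_eq_top]; trivial)
  rw [map_add, map_add, map_add, map_add, (Submodule.projectionOnto_apply_eq_zero_iff hc).2 hb,
    (Submodule.projectionOnto_apply_eq_zero_iff hc).2 (h₂ g b hb), map_zero, add_zero, add_zero,
    Submodule.projectionOnto_apply_left hc ⟨a, ha⟩,
    Submodule.projectionOnto_apply_left hc ⟨_, h₁ g a ha⟩]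
  rfl

lemma Pure.sub_top {W : Submodule K M.V} (h : Pure C M W) (hW : M.Inv W) :
    Pure C (M.sub W hW) ⊤ :=
  h.of_inj (isHom_subtype M W hW) Subtype.val_injective (by simp)

lemma mul_mem_of_pure {W₁ W₂ : Submodule K (reg K Q).V} (h₁ : (reg K Q).Inv W₁)
    (h₂ : (reg K Q).Inv W₂) (hc : IsCompl W₁ W₂) (hp₁ : Pure C (reg K Q) W₁)
    (hp₂ : Pure (fun S => ¬ C S) (reg K Q) W₂) (a x : MonoidAlgebra K Q) (hx : x ∈ W₁) :
    x * a ∈ W₁ := by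
  have hr : IsHom (reg K Q) (reg K Q) (LinearMap.mulRight K a) := fun g v =>
    mul_assoc (MonoidAlgebra.single g (1 : K)) v a
  have h0 := Pure.hom_eq_zero (hp₁.sub_top h₁) (hp₂.sub_top h₂)
    ((isHom_projectionOnto h₂ h₁ hc.symm).comp (hr.comp (isHom_subtype (reg K Q) W₁ h₁)))
  exact (Submodule.projectionOnto_apply_eq_zero_iff hc.symm).1 (LinearMap.congr_fun h0 ⟨x, hx⟩)

lemma act_eq_zero_of_pure {W : Submodule K (reg K Q).V} (hW : (reg K Q).Inv W)
    (hp : Pure C (reg K Q) W) {x : MonoidAlgebra K Q} (hx : x ∈ W) {S : Rp K Q} (hS : Simp S)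
    (hCS : ¬ C S) : S.act x = 0 := by
  ext v
  by_contra h0
  let φ : (reg K Q).V →ₗ[K] S.V := (LinearMap.applyₗ v) ∘ₗ S.act.toLinearMap
  have hφ : IsHom (reg K Q) S φ := fun g a => by
    have h1 : S.act (MonoidAlgebra.single g 1 * a) = S.ρ g * S.act a := by
      rw [map_mul, act_single, one_smul]
    exact LinearMap.congr_fun h1 v
  refine hCS (hp _ S _ _ (isHom_subtype (reg K Q) W hW) Subtype.val_injective (by simp) hS
    (hφ.comp (isHom_subtype (reg K Q) W hW)) fun h => h0 (LinearMap.congr_fun h ⟨x, hx⟩))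

/-- A decomposition into a part in the class and a part in the complementary class. -/
def HasSplit (C : Rp K Q → Prop) (M : Rp K Q) : Prop :=
  ∃ W₁ W₂ : Submodule K M.V, M.Inv W₁ ∧ M.Inv W₂ ∧ IsCompl W₁ W₂ ∧ Pure C M W₁ ∧
    Pure (fun S => ¬ C S) M W₂

lemma HasSplit.compl (h : HasSplit C M) : HasSplit (fun S => ¬ C S) M := by
  obtain ⟨W₁, W₂, h₁, h₂, hc, hp₁, hp₂⟩ := h
  exact ⟨W₂, W₁, h₂, h₁, hc.symm, hp₂, by simpa only [not_not] using hp₁⟩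

lemma HasSplit.of_ker (hC : Cls C) {S : Rp K Q} (hS : Simp S) (hCS : C S)
    {t : M.V →ₗ[K] S.V} (ht : IsHom M S t) (hts : Function.Surjective t)
    (h : HasSplit C (M.sub _ ht.ker)) : HasSplit C M := by
  set L := M.sub _ ht.ker with hL
  obtain ⟨W₁, W₂, h₁, h₂, hc, hp₁, hp₂⟩ := h
  obtain ⟨s, c, hs, hcc, hcs⟩ := exists_section_coc ht hts
  let q : L.V →ₗ[K] (L.sub W₂ h₂).V := W₂.projectionOnto W₁ hc.symm
  have hqW : ∀ v : W₂, q v = v := fun v => Submodule.projectionOnto_apply_left hc.symm v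
  have hqk : ∀ v, q v = 0 ↔ v ∈ W₁ := fun v => Submodule.projectionOnto_apply_eq_zero_iff hc.symm
  have hq : IsHom L (L.sub W₂ h₂) q := isHom_projectionOnto h₂ h₁ hc.symm
  obtain ⟨ψ, hψ, hψq⟩ := extend_of_cob ht hs hcs hq (hC.cob hS hCS
    (hp₂.sub_top h₂) (hcc.comp_left hq))
  have hψ' : ∀ v : L.V, ψ v.1 = q v := fun v => LinearMap.congr_fun hψq v
  have hi := isHom_subtype M _ ht.ker
  refine ⟨LinearMap.ker ψ, W₂.map (LinearMap.ker t).subtype, hψ.ker, hi.map h₂, ⟨?_, ?_⟩, ?_, ?_⟩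
  · rw [Submodule.disjoint_def]
    rintro _ hv ⟨v, hv₂, rfl⟩
    have h3 : q v = 0 := (hψ' v).symm.trans hv
    rw [hqW ⟨v, hv₂⟩] at h3
    rw [show v = 0 from congrArg Subtype.val h3, map_zero]
  · rw [codisjoint_iff, eq_top_iff]
    intro v _
    refine Submodule.mem_sup.2 ⟨v - (ψ v).1.1, ?_, (ψ v).1.1, ⟨_, (ψ v).2, rfl⟩, by simp⟩
    rw [LinearMap.mem_ker, map_sub, hψ' (ψ v).1, hqW, sub_self]
  · refine Pure.of_hom hC hS hCS ht ?_
    intro Y T j τ hj hji hjW hT hτ h0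
    have hjk : ∀ v, j v ∈ LinearMap.ker t := fun v => (hjW ⟨v, rfl⟩).2
    refine hp₁ Y T (j.codRestrict _ hjk) τ (hj.codRestrict ht.ker hjk)
      (fun a b hab => hji (congrArg Subtype.val hab)) ?_ hT hτ h0
    rintro _ ⟨v, rfl⟩
    exact (hqk _).1 ((hψ' _).symm.trans (hjW ⟨v, rfl⟩).1)
  · intro Y T j τ hj hji hjW hT hτ h0
    have hjk : ∀ v, j v ∈ LinearMap.ker t := fun v => by
      obtain ⟨w, -, hw⟩ := hjW ⟨v, rfl⟩
      rw [← hw]; exact w.2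
    refine hp₂ Y T (j.codRestrict _ hjk) τ (hj.codRestrict ht.ker hjk)
      (fun a b hab => hji (congrArg Subtype.val hab)) ?_ hT hτ h0
    rintro _ ⟨v, rfl⟩
    obtain ⟨w, hw, hwv⟩ := hjW ⟨v, rfl⟩
    rwa [show j.codRestrict _ hjk v = w from Subtype.ext hwv.symm]

lemma Cls.hasSplit (hC : Cls C) (M : Rp K Q) : HasSplit C M := by
  induction hn : Module.finrank K M.V using Nat.strong_induction_on generalizing M with
  | _ n ih =>
    by_cases hb : (⊥ : Submodule K M.V) = ⊤
    · have hsub : Subsingleton M.V :=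
        (Submodule.subsingleton_iff K).1 (subsingleton_of_bot_eq_top hb)
      have hp : ∀ C', Pure C' M ⊤ := fun C' Y S j t hj hji _ hS ht h0 => by
        have : Subsingleton Y.V := hji.subsingleton
        exact (h0 (LinearMap.ext fun v => by rw [Subsingleton.elim v 0]; simp)).elim
      exact ⟨⊤, ⊤, inv_top M, inv_top M, ⟨by rw [← hb]; exact disjoint_bot_left,
        codisjoint_top_left⟩, hp _, hp _⟩
    obtain ⟨T, q, hT, hq, hqs, -⟩ := exists_simple_quot_le (inv_bot M) hb
    have hlt : Module.finrank K (M.sub _ hq.ker).V < n := by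
      rw [← hn]
      exact Submodule.finrank_lt fun ht => hT.ne_zero_of_surj hqs (LinearMap.ker_eq_top.1 ht)
    have h1 := ih _ hlt (M.sub _ hq.ker) rfl
    by_cases hCT : C T
    · exact h1.of_ker hC hT hCT hq hqs
    · simpa only [not_not] using (h1.compl.of_ker hC.compl hT hCT hq hqs).compl

/-- A class closed under isomorphism and linking is cut out by a central idempotent. -/
theorem Cls.exists_idem (hC : Cls C) : ∃ f : MonoidAlgebra K Q, f * f = f ∧
    (∀ a, a * f = f * a) ∧ ∀ S, Simp S → (C S → S.act f = 1) ∧ (¬ C S → S.act f = 0) := by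
  obtain ⟨W₁, W₂, h₁, h₂, hc, hp₁, hp₂⟩ := hC.hasSplit (reg K Q)
  have hp₁' : Pure (fun S => ¬ ¬ C S) (reg K Q) W₁ := by simpa only [not_not] using hp₁
  have hr₁ := mul_mem_of_pure h₁ h₂ hc hp₁ hp₂
  have hr₂ := mul_mem_of_pure h₂ h₁ hc.symm hp₂ hp₁'
  obtain ⟨f, hf, f', hf', hff⟩ := Submodule.mem_sup.1
    (show (1 : MonoidAlgebra K Q) ∈ W₁ ⊔ W₂ by rw [hc.sup_eq_top]; trivial)
  have hu : ∀ x ∈ W₁, ∀ y ∈ W₂, x + y = 0 → x = 0 := fun x hx y hy h =>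
    Submodule.disjoint_def.1 hc.disjoint x hx (by
      rw [eq_neg_of_add_eq_zero_left h]; exact W₂.neg_mem hy)
  have hz : ∀ x ∈ W₁, ∀ y ∈ W₂, x * y = 0 := fun x hx y hy =>
    Submodule.disjoint_def.1 hc.disjoint _ (hr₁ y x hx) (reg_inv h₂ x y hy)
  have hf2 : f' = 1 - f := by rw [← hff]; abel
  refine ⟨f, ?_, fun a => ?_, fun S hS => ⟨fun h => ?_, act_eq_zero_of_pure h₁ hp₁ hf hS⟩⟩
  · have := hz f hf f' hf'
    rw [hf2, mul_sub, mul_one, sub_eq_zero] at this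
    exact this.symm
  · refine sub_eq_zero.1 (hu _ (W₁.sub_mem (reg_inv h₁ a f hf) (hr₁ a f hf)) (a * f' - f' * a)
      (W₂.sub_mem (reg_inv h₂ a f' hf') (hr₂ a f' hf')) ?_)
    rw [hf2]; noncomm_ring
  · have := act_eq_zero_of_pure h₂ hp₂ hf' hS (not_not.2 h)
    rw [hf2, map_sub, map_one, sub_eq_zero] at this
    exact this.symm

end Split

end Rp

section Levels

variable {k : Type} [Field k] {G : Type} [Group G] [TopologicalSpace G]

/-- The projection of the completed group algebra onto the group algebra at level `N`. -/
def pr (N : OpenNormalSubgroup G) : CGA k G →ₐ[k] MonoidAlgebra k (G ⧸ N.toSubgroup) :=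
  (Pi.evalAlgHom k (fun N : OpenNormalSubgroup G => MonoidAlgebra k (G ⧸ N.toSubgroup)) N).comp
    (CGA k G).val

lemma tHom_pr {N M : OpenNormalSubgroup G} (h : N ≤ M) (x : CGA k G) :
    tHom k G N M h (pr N x) = pr M x := x.2 N M h

lemma ext_pr {x y : CGA k G} (h : ∀ N : OpenNormalSubgroup G, pr N x = pr N y) : x = y :=
  Subtype.ext (funext h)

lemma pr_ofG (N : OpenNormalSubgroup G) (g : G) :
    pr N (ofG k G g) = MonoidAlgebra.single (QuotientGroup.mk' N.toSubgroup g) 1 := rfl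

lemma pr_surjective (N : OpenNormalSubgroup G) : Function.Surjective (pr (k := k) N) := by
  intro a
  induction a using MonoidAlgebra.induction_linear with
  | zero => exact ⟨0, map_zero _⟩
  | add x y hx hy =>
    obtain ⟨⟨x, rfl⟩, y, rfl⟩ := And.intro hx hy
    exact ⟨x + y, map_add _ _ _⟩
  | single q c =>
    obtain ⟨g, rfl⟩ := QuotientGroup.mk'_surjective _ q
    refine ⟨c • ofG k G g, ?_⟩
    rw [map_smul, pr_ofG, MonoidAlgebra.smul_single, smul_eq_mul, mul_one]

lemma pr_ker_mono {N M : OpenNormalSubgroup G} (h : N ≤ M) {x : CGA k G} (hx : pr N x = 0) :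
    pr M x = 0 := by
  rw [← tHom_pr h, hx, map_zero]

lemma qHom_surjective {N M : OpenNormalSubgroup G} (h : N ≤ M) :
    Function.Surjective (qHom G N M h) := by
  intro q
  obtain ⟨g, rfl⟩ := QuotientGroup.mk'_surjective _ q
  exact ⟨QuotientGroup.mk' _ g, rfl⟩

lemma qHom_comp {L N M : OpenNormalSubgroup G} (h : L ≤ N) (h' : N ≤ M) :
    (qHom G N M h').comp (qHom G L N h) = qHom G L M (h.trans h') := by
  ext g
  rfl

lemma pr_conjAct (N : OpenNormalSubgroup G) (g : G) (x : CGA k G) :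
    pr N (conjAct k G g x) = cjA k _ (QuotientGroup.mk' N.toSubgroup g) (pr N x) := by
  rw [cjA_apply, conjAct, map_mul, map_mul, pr_ofG, pr_ofG, map_inv]

section Compact

variable [IsTopologicalGroup G] [CompactSpace G]

lemma finite_level (N : OpenNormalSubgroup G) : Finite (G ⧸ N.toSubgroup) :=
  Subgroup.quotient_finite_of_isOpen _ N.isOpen'

instance fintypeLevel (N : OpenNormalSubgroup G) : Fintype (G ⧸ N.toSubgroup) :=
  have := finite_level N
  Fintype.ofFinite _

/-- An element of the trace ideal of `DN` is, at level `N`, a relative trace. -/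
lemma relTr_of_mem_trImage {D : Subgroup G} {N : OpenNormalSubgroup G} {e : CGA k G}
    (he : e ∈ trImage k G (D ⊔ N.toSubgroup)) {d : G ⧸ N.toSubgroup}
    (hd : D.map (QuotientGroup.mk' N.toSubgroup) = Subgroup.zpowers d) :
    RelTr d (pr N e) := by
  obtain ⟨x, hx, rfl⟩ := he
  obtain ⟨w, hw⟩ := exists_isWt k d
  have hfin : Finite (G ⧸ (D ⊔ N.toSubgroup)) :=
    Subgroup.quotient_finite_of_isOpen _ (Subgroup.isOpen_mono le_sup_right N.isOpen')
  have : Fintype (G ⧸ (D ⊔ N.toSubgroup)) := Fintype.ofFinite _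
  have hfix : ∀ g h : G, h ∈ D ⊔ N.toSubgroup → cjA k _ (QuotientGroup.mk' N.toSubgroup (g * h))
      (pr N x) = cjA k _ (QuotientGroup.mk' N.toSubgroup g) (pr N x) := by
    intro g h hh
    rw [map_mul, map_mul, Module.End.mul_apply, ← pr_conjAct N h, hx h hh]
  have hker : ∀ g : G, QuotientGroup.mk' N.toSubgroup g ∈ Subgroup.zpowers d ↔
      g ∈ D ⊔ N.toSubgroup := by
    intro g
    rw [← hd, ← Subgroup.mem_comap, Subgroup.comap_map_eq, QuotientGroup.ker_mk']
  refine ⟨pr N x, w, ?_, hw, ?_⟩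
  · obtain ⟨g, rfl⟩ := QuotientGroup.mk'_surjective _ d
    have := hfix 1 g ((hker g).1 (Subgroup.mem_zpowers _))
    rwa [one_mul, map_one, map_one, Module.End.one_apply] at this
  · rw [trMap, finsum_eq_sum_of_fintype, map_sum]
    have hle : N.toSubgroup ≤ D ⊔ N.toSubgroup := le_sup_right
    rw [← Finset.sum_fiberwise Finset.univ (Subgroup.quotientMapOfLE hle)]
    refine Finset.sum_congr rfl fun c _ => ?_
    rw [pr_conjAct]
    set g₀ := Quotient.out c with hg₀
    have hc : (QuotientGroup.mk g₀ : G ⧸ (D ⊔ N.toSubgroup)) = c := Quotient.out_eq' c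
    have key : ∀ g : G, Subgroup.quotientMapOfLE hle (QuotientGroup.mk' N.toSubgroup g) = c ↔
        g₀⁻¹ * g ∈ D ⊔ N.toSubgroup := by
      intro g
      rw [← hc, ← QuotientGroup.eq]
      exact eq_comm
    have h1 : ∀ q : G ⧸ N.toSubgroup, Subgroup.quotientMapOfLE hle q = c →
        w q • cjA k _ q (pr N x) = w q • cjA k _ (QuotientGroup.mk' N.toSubgroup g₀) (pr N x) := by
      intro q hq
      obtain ⟨g, rfl⟩ := QuotientGroup.mk'_surjective _ q
      rw [← hfix g₀ _ ((key g).1 hq), mul_inv_cancel_left]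
    rw [Finset.sum_congr rfl (fun q hq => h1 q (Finset.mem_filter.1 hq).2), ← Finset.sum_smul]
    have h2 : ∑ q with Subgroup.quotientMapOfLE hle q = c, w q = 1 := by
      rw [← hw (QuotientGroup.mk' N.toSubgroup g₀),
        sum_pow_eq_ite d fun x => w (QuotientGroup.mk' N.toSubgroup g₀ * x), Finset.sum_filter,
        ← Equiv.sum_comp (Equiv.mulLeft (QuotientGroup.mk' N.toSubgroup g₀))]
      refine Finset.sum_congr rfl fun q _ => ?_
      obtain ⟨g, rfl⟩ := QuotientGroup.mk'_surjective _ q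
      refine if_congr ((key (g₀ * g)).trans ?_) rfl rfl
      rw [hker, inv_mul_cancel_left]
    rw [h2, one_smul]

lemma exists_generator_level [T2Space G] [TotallyDisconnectedSpace G] {p : ℕ} [Fact p.Prime]
    {D : Subgroup G} (hD : IsCyclicProP G p D) (N : OpenNormalSubgroup G) :
    ∃ d : G ⧸ N.toSubgroup, D.map (QuotientGroup.mk' N.toSubgroup) = Subgroup.zpowers d ∧
      ∃ n, orderOf d = p ^ n := by
  have hp : p.Prime := Fact.out
  suffices h : ∃ d : D, (∀ x : D, ∃ n : ℤ, (x * d ^ n : D).1 ∈ N.toSubgroup) ∧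
      ∃ n : ℕ, (d ^ p ^ n : D).1 ∈ N.toSubgroup by
    obtain ⟨d, hd, n, hn⟩ := h
    refine ⟨QuotientGroup.mk' N.toSubgroup d.1, le_antisymm ?_ ?_, ?_⟩
    · rintro _ ⟨x, hx, rfl⟩
      obtain ⟨n, hn⟩ := hd ⟨x, hx⟩
      refine Subgroup.mem_zpowers_iff.2 ⟨-n, ?_⟩
      have h1 : QuotientGroup.mk' N.toSubgroup (x * d.1 ^ n) = 1 :=
        (QuotientGroup.eq_one_iff _).2 hn
      rw [map_mul, map_zpow] at h1
      rw [zpow_neg]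
      exact (eq_inv_of_mul_eq_one_left h1).symm
    · rw [Subgroup.zpowers_le]
      exact ⟨_, d.2, rfl⟩
    · have h1 : (QuotientGroup.mk' N.toSubgroup d.1) ^ p ^ n = 1 := by
        rw [← map_pow]
        exact (QuotientGroup.eq_one_iff _).2 hn
      obtain ⟨m, -, hm⟩ := (Nat.dvd_prime_pow hp).1 (orderOf_dvd_of_pow_eq_one h1)
      exact ⟨m, hm⟩
  rcases hD with ⟨hfin, hpg, hc⟩ | ⟨φ, hφ⟩
  · obtain ⟨d, hd⟩ := hc.exists_generator
    obtain ⟨n, hn⟩ := hpg d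
    refine ⟨d, fun x => ?_, n, by rw [hn]; exact N.toSubgroup.one_mem⟩
    obtain ⟨m, hm⟩ := Subgroup.mem_zpowers_iff.1 (hd x)
    refine ⟨-m, ?_⟩
    rw [← hm, zpow_neg, mul_inv_cancel]
    exact N.toSubgroup.one_mem
  · let Φ : D ≃* Multiplicative ℤ_[p] := { φ.toEquiv with map_mul' := hφ }
    let ψ : ℤ_[p] → G := fun z => (Φ.symm (Multiplicative.ofAdd z)).1
    have hψc : Continuous ψ := continuous_subtype_val.comp
      (φ.symm.continuous.comp continuous_ofAdd)
    have hopen : IsOpen (ψ ⁻¹' (N.toSubgroup : Set G)) := N.isOpen'.preimage hψc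
    have h0 : (0 : ℤ_[p]) ∈ ψ ⁻¹' (N.toSubgroup : Set G) := by
      change (Φ.symm 1).1 ∈ N.toSubgroup
      rw [map_one]; exact N.toSubgroup.one_mem
    obtain ⟨ε, hε, hball⟩ := Metric.isOpen_iff.1 hopen 0 h0
    obtain ⟨n, hn⟩ := exists_pow_lt_of_lt_one hε
      (show ((p : ℝ)⁻¹) < 1 from inv_lt_one_of_one_lt₀ (by exact_mod_cast hp.one_lt))
    have hsmall : ∀ z : ℤ_[p], z ∈ Ideal.span {(p : ℤ_[p]) ^ n} →
        (Φ.symm (Multiplicative.ofAdd z)).1 ∈ N.toSubgroup := by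
      intro z hz
      refine hball ?_
      rw [Metric.mem_ball, dist_zero_right]
      refine lt_of_le_of_lt ((PadicInt.norm_le_pow_iff_mem_span_pow z n).2 hz) ?_
      rwa [zpow_neg, zpow_natCast, ← inv_pow]
    refine ⟨Φ.symm (Multiplicative.ofAdd 1), fun x => ?_, n, ?_⟩
    · obtain ⟨y, hy⟩ := Φ.symm.surjective x
      set z : ℤ_[p] := Multiplicative.toAdd y
      refine ⟨-(z.appr n : ℤ), ?_⟩
      have := hsmall (z - z.appr n) (PadicInt.appr_spec n z)
      rw [ofAdd_sub, map_div, div_eq_mul_inv] at this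
      rw [zpow_neg, zpow_natCast, ← map_pow, ← ofAdd_nsmul, nsmul_one, ← hy]
      exact this
    · rw [← map_pow, ← ofAdd_nsmul]
      refine hsmall _ ?_
      rw [nsmul_one, Nat.cast_pow]
      exact Ideal.mem_span_singleton_self _

end Compact

end Levels

namespace Rp

section Pull

variable {K Q Q' : Type} [Field K] [Group Q] [Group Q'] {X Y : Rp K Q} {π : Q' →* Q}

lemma inv_pull_iff (hπ : Function.Surjective π) {W : Submodule K X.V} :
    (X.pull π).Inv W ↔ X.Inv W := by
  constructor
  · intro h g v hv
    obtain ⟨g, rfl⟩ := hπ g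
    exact h g v hv
  · exact fun h g v hv => h (π g) v hv

lemma simp_pull_iff (hπ : Function.Surjective π) : Simp (X.pull π) ↔ Simp X :=
  ⟨fun h => ⟨h.1, fun W hW => h.2 W ((inv_pull_iff hπ).2 hW)⟩,
    fun h => ⟨h.1, fun W hW => h.2 W ((inv_pull_iff hπ).1 hW)⟩⟩

lemma Iso.pull (h : Iso X Y) (π : Q' →* Q) : Iso (X.pull π) (Y.pull π) := by
  obtain ⟨φ, hφ⟩ := h
  exact ⟨φ, fun g v => hφ (π g) v⟩

lemma Iso.of_pull (hπ : Function.Surjective π) (h : Iso (X.pull π) (Y.pull π)) : Iso X Y := by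
  obtain ⟨φ, hφ⟩ := h
  refine ⟨φ, fun g v => ?_⟩
  obtain ⟨g, rfl⟩ := hπ g
  exact hφ g v

lemma Linked.pull (hπ : Function.Surjective π) (h : Linked X Y) :
    Linked (X.pull π) (Y.pull π) := by
  obtain ⟨c, hc, hn⟩ := h
  have hcj : ∀ g (b : X.V →ₗ[K] Y.V), cj (X.pull π) (Y.pull π) g b = cj X Y (π g) b := by
    intro g b
    refine LinearMap.ext fun v => ?_
    change Y.ρ (π g) (b (X.ρ (π g⁻¹) v)) = Y.ρ (π g) (b (X.ρ (π g)⁻¹ v))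
    rw [map_inv]
  refine ⟨fun g => c (π g), fun g h => ?_, ?_⟩
  · change c (π (g * h)) = c (π g) + _
    rw [hcj, map_mul]
    exact hc _ _
  · rintro ⟨b, hb⟩
    refine hn ⟨b, fun g => ?_⟩
    obtain ⟨g, rfl⟩ := hπ g
    exact (hb g).trans (by rw [hcj])

lemma inB_pull_iff {f : MonoidAlgebra K Q'} :
    InB f (X.pull π) ↔ InB (MonoidAlgebra.mapDomainAlgHom K K π f) X := by
  unfold InB
  rw [act_pull]

lemma Adj.pull (hπ : Function.Surjective π) {f : MonoidAlgebra K Q'}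
    (h : Adj (MonoidAlgebra.mapDomainAlgHom K K π f) X Y) :
    Adj f (X.pull π) (Y.pull π) :=
  ⟨(simp_pull_iff hπ).2 h.1, inB_pull_iff.2 h.2.1,
    h.2.2.imp (fun h => h.pull π) (Or.imp (Linked.pull hπ) (Linked.pull hπ))⟩

/-- Central idempotents acting alike on all simple representations coincide. -/
lemma eq_of_act_simp [Fintype Q] {f g : MonoidAlgebra K Q} (hf : f * f = f) (hg : g * g = g)
    (hfc : ∀ a, a * f = f * a) (hgc : ∀ a, a * g = g * a)
    (h : ∀ S : Rp K Q, Simp S → S.act f = S.act g) : f = g := by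
  have key : ∀ f g : MonoidAlgebra K Q, f * f = f → g * g = g → (∀ a, a * f = f * a) →
      (∀ a, a * g = g * a) → (∀ S : Rp K Q, Simp S → S.act f = S.act g) → f = f * g := by
    intro f g hf hg hfc hgc h
    have hz : f - f * g = 0 := by
      refine eq_zero_of_act_simp ?_ (fun a => ?_) fun S hS => ?_
      · have h1 : f * (f * g) = f * g := by rw [← mul_assoc, hf]
        have h2 : f * g * f = f * g := by rw [mul_assoc, hfc g, ← mul_assoc, hf]
        have h3 : f * g * (f * g) = f * g := by
          rw [← mul_assoc, h2, mul_assoc, hg]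
        rw [mul_sub, sub_mul, sub_mul, hf, h1, h2, h3, sub_self, sub_zero]
      · rw [mul_sub, sub_mul, hfc, ← mul_assoc, hfc, mul_assoc f a g, hgc, mul_assoc]
      · rw [map_sub, map_mul, h S hS, ← map_mul, hg, sub_self]
    exact sub_eq_zero.1 hz
  have h1 := key f g hf hg hfc hgc h
  have h2 := key g f hg hf hgc hfc fun S hS => (h S hS).symm
  rw [h1, hgc, ← h2]

end Pull

end Rp

section Blocks

open Rp

variable {k : Type} [Field k] {G : Type} [Group G] [TopologicalSpace G]

/-- Inflation from level `N` to level `L`. -/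
abbrev infl {L N : OpenNormalSubgroup G} (h : L ≤ N) (X : Rp k (G ⧸ N.toSubgroup)) :
    Rp k (G ⧸ L.toSubgroup) := X.pull (qHom G L N h)

lemma infl_infl {L N M : OpenNormalSubgroup G} (h : L ≤ N) (h' : N ≤ M)
    (X : Rp k (G ⧸ M.toSubgroup)) : infl h (infl h' X) = infl (h.trans h') X := by
  have h1 : infl h (infl h' X) = X.pull ((qHom G N M h').comp (qHom G L N h)) := rfl
  rw [h1, qHom_comp]

lemma inB_infl {L N : OpenNormalSubgroup G} (h : L ≤ N) {X : Rp k (G ⧸ N.toSubgroup)}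
    {e : CGA k G} : InB (pr L e) (infl h X) ↔ InB (pr N e) X := by
  rw [← tHom_pr h]
  exact inB_pull_iff

lemma adj_infl {L N : OpenNormalSubgroup G} (h : L ≤ N) {X Y : Rp k (G ⧸ N.toSubgroup)}
    {e : CGA k G} (hA : Adj (pr N e) X Y) : Adj (pr L e) (infl h X) (infl h Y) := by
  rw [← tHom_pr h] at hA
  exact hA.pull (qHom_surjective h)

lemma chain_infl {L N : OpenNormalSubgroup G} (h : L ≤ N) {X Y : Rp k (G ⧸ N.toSubgroup)}
    {e : CGA k G} (hA : Relation.ReflTransGen (Adj (pr N e)) X Y) :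
    Relation.ReflTransGen (Adj (pr L e)) (infl h X) (infl h Y) :=
  hA.lift (infl h) fun _ _ => adj_infl h

/-- The representations at level `N` reachable, at some deeper level, from `S₀`. -/
def Reach (e : CGA k G) {M : OpenNormalSubgroup G} (S₀ : Rp k (G ⧸ M.toSubgroup))
    (N : OpenNormalSubgroup G) (T : Rp k (G ⧸ N.toSubgroup)) : Prop :=
  Simp T ∧ InB (pr N e) T ∧ ∃ (L : OpenNormalSubgroup G) (hN : L ≤ N) (hM : L ≤ M),
    Relation.ReflTransGen (Adj (pr L e)) (infl hM S₀) (infl hN T)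

variable {e : CGA k G} {M : OpenNormalSubgroup G} {S₀ : Rp k (G ⧸ M.toSubgroup)}

lemma Reach.step {N : OpenNormalSubgroup G} {S T : Rp k (G ⧸ N.toSubgroup)}
    (h : Reach e S₀ N S) (hA : Adj (pr N e) S T) : Reach e S₀ N T := by
  obtain ⟨-, -, L, hN, hM, hc⟩ := h
  exact ⟨hA.1, hA.2.1, L, hN, hM, hc.tail (adj_infl hN hA)⟩

lemma reach_infl_iff {N N' : OpenNormalSubgroup G} (h : N ≤ N')
    {T : Rp k (G ⧸ N'.toSubgroup)} : Reach e S₀ N (infl h T) ↔ Reach e S₀ N' T := by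
  unfold Reach
  rw [simp_pull_iff (qHom_surjective h), inB_infl]
  refine and_congr_right fun _ => and_congr_right fun _ => ⟨?_, ?_⟩
  · rintro ⟨L, hN, hM, hc⟩
    exact ⟨L, hN.trans h, hM, by rwa [infl_infl] at hc⟩
  · rintro ⟨L, hN, hM, hc⟩
    refine ⟨L ⊓ N, inf_le_right, inf_le_left.trans hM, ?_⟩
    have := chain_infl (inf_le_left : L ⊓ N ≤ L) hc
    rwa [infl_infl, infl_infl, ← infl_infl inf_le_right h] at this

lemma pr_central (hc : e ∈ Set.center (CGA k G)) (N : OpenNormalSubgroup G)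
    (a : MonoidAlgebra k (G ⧸ N.toSubgroup)) : a * pr N e = pr N e * a := by
  obtain ⟨a, rfl⟩ := pr_surjective N a
  rw [← map_mul, ← map_mul, (Semigroup.mem_center_iff.1 hc a)]

lemma cjA_pr_central (hc : e ∈ Set.center (CGA k G)) (N : OpenNormalSubgroup G)
    (g : G ⧸ N.toSubgroup) : cjA k _ g (pr N e) = pr N e := by
  rw [cjA_apply, pr_central hc, mul_assoc, MonoidAlgebra.single_mul_single, mul_inv_cancel,
    mul_one, ← MonoidAlgebra.one_def, mul_one]

section Compact

variable [IsTopologicalGroup G] [CompactSpace G]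

lemma cls_reach (he : IsBlockIdem (CGA k G) e) (N : OpenNormalSubgroup G) :
    Cls (Reach e S₀ N) where
  iso := fun h hi => h.step ⟨hi.simp h.1, h.2.1.iso hi, Or.inl hi⟩
  link := by
    intro S S' hS hS' h hn
    have hcj := cjA_pr_central he.central N
    rcases act_eq_one_or_zero hS' hcj (by rw [← map_mul, he.idem.eq]) with h1 | h0
    · exact ⟨fun hl => hn (h.step ⟨hS', h1, Or.inr (Or.inl hl)⟩),
        fun hl => hn (h.step ⟨hS', h1, Or.inr (Or.inr hl)⟩)⟩
    · exact not_linked_of_act hcj h.2.1 h0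

/-- All simple representations of a block are connected at some level. -/
lemma reach_of_block (he : IsBlockIdem (CGA k G) e) (hS₀ : Simp S₀) (hB₀ : InB (pr M e) S₀)
    {N : OpenNormalSubgroup G} {T : Rp k (G ⧸ N.toSubgroup)} (hT : Simp T)
    (hB : InB (pr N e) T) : Reach e S₀ N T := by
  choose f hfi hfc hfa using fun N => (cls_reach (S₀ := S₀) he N).exists_idem
  have hcomp : ∀ (N N' : OpenNormalSubgroup G) (h : N ≤ N'), tHom k G N N' h (f N) = f N' := by
    intro N N' h
    have hs : Function.Surjective (tHom k G N N' h) := by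
      intro a
      obtain ⟨a, rfl⟩ := pr_surjective N' a
      exact ⟨pr N a, tHom_pr h a⟩
    refine eq_of_act_simp (by rw [← map_mul, hfi]) (hfi N') (fun a => ?_) (hfc N') fun S hS => ?_
    · obtain ⟨a, rfl⟩ := hs a
      rw [← map_mul, ← map_mul, hfc]
    · have h1 : S.act (tHom k G N N' h (f N)) = (infl h S).act (f N) := (act_pull S _ _).symm
      rw [h1]
      have hS' := (simp_pull_iff (qHom_surjective h)).2 hS
      by_cases hR : Reach e S₀ N' S
      · rw [(hfa N' S hS).1 hR, (hfa N _ hS').1 ((reach_infl_iff h).2 hR)]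
      · rw [(hfa N' S hS).2 hR, (hfa N _ hS').2 fun h' => hR ((reach_infl_iff h).1 h')]
  let F : CGA k G := ⟨f, hcomp⟩
  have hF : ∀ N, pr N F = f N := fun _ => rfl
  have hFi : F * F = F := ext_pr fun N => by rw [map_mul, hF, hfi]
  have hFc : F ∈ Set.center (CGA k G) :=
    Semigroup.mem_center_iff.2 fun a => ext_pr fun N => by rw [map_mul, map_mul, hF, hfc]
  have hFe : F * e = F := by
    refine ext_pr fun N => ?_
    rw [map_mul]
    refine eq_of_act_simp ?_ (by rw [hF, hfi]) (fun a => ?_) (hfc N) fun S hS => ?_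
    · rw [← map_mul, ← map_mul, mul_assoc, ← mul_assoc e F e, Semigroup.mem_center_iff.1 hFc e,
        mul_assoc F e e, he.idem.eq, ← mul_assoc, hFi]
    · rw [← mul_assoc, pr_central hFc, mul_assoc, pr_central he.central, mul_assoc]
    · rw [map_mul, hF]
      by_cases hR : Reach e S₀ N S
      · rw [show S.act (pr N e) = 1 from hR.2.1, mul_one]
      · rw [(hfa N S hS).2 hR, zero_mul]
  have heF : e * F = F := (Semigroup.mem_center_iff.1 hFc e).trans hFe
  have hone : ∀ {N : OpenNormalSubgroup G} {T : Rp k (G ⧸ N.toSubgroup)}, Simp T →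
      (1 : Module.End k T.V) ≠ 0 := fun hT h => by
    obtain ⟨v, hv⟩ := @exists_ne _ hT.1 0
    exact hv (LinearMap.congr_fun h v)
  have hmain : e = F := by
    have hsq : (e - F) * (e - F) = e - F := by
      rw [mul_sub, sub_mul, sub_mul, he.idem.eq, hFe, heF, hFi, sub_self, sub_zero]
    rcases he.primitive F (e - F) hFc ((Subring.center (CGA k G)).sub_mem he.central hFc) hFi hsq
      (by rw [mul_sub, hFe, hFi, sub_self]) (by rw [sub_mul, heF, hFi, sub_self])
      (by abel) with h | h
    · exfalso
      have h1 := (hfa M S₀ hS₀).1 ⟨hS₀, hB₀, M, le_rfl, le_rfl, Relation.ReflTransGen.refl⟩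
      rw [← hF, h, map_zero, map_zero] at h1
      exact hone hS₀ h1.symm
    · exact sub_eq_zero.1 h
  by_contra hR
  have h0 := (hfa N T hT).2 hR
  rw [← hF, ← hmain, show T.act (pr N e) = 1 from hB] at h0
  exact hone hT h0

/-- A block with cyclic defect group has at most `p - 1` simple modules at each level. -/
theorem exists_iso_of_block [T2Space G] [TotallyDisconnectedSpace G] [IsAlgClosed k] {p : ℕ}
    [Fact p.Prime] [CharP k p] (he : IsBlockIdem (CGA k G) e) {D : Subgroup G}
    (hD : DefectProp k G e D) (hcyc : IsCyclicProP G p D) {N : OpenNormalSubgroup G}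
    (S : Fin p → Rp k (G ⧸ N.toSubgroup)) (hS : ∀ i, Simp (S i))
    (hB : ∀ i, InB (pr N e) (S i)) : ∃ i j, i ≠ j ∧ Iso (S i) (S j) := by
  have hp : p.Prime := Fact.out
  let i₀ : Fin p := ⟨0, hp.pos⟩
  choose L hLN hLN' hc using fun i => (reach_of_block he (hS i₀) (hB i₀) (hS i) (hB i)).2.2
  have : Nonempty (OpenNormalSubgroup G) := ⟨N⟩
  obtain ⟨L', hL'⟩ := Finite.exists_ge L
  have hN : L' ≤ N := (hL' i₀).trans (hLN i₀)
  obtain ⟨d, hd, hpd⟩ := exists_generator_level hcyc L'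
  obtain ⟨i, j, hij, h⟩ := exists_iso_of_adj (f := pr L' e) (cjA_pr_central he.central L')
    (by rw [← map_mul, he.idem.eq]) hpd (relTr_of_mem_trImage (hD L') hd)
    ((simp_pull_iff (qHom_surjective hN)).2 (hS i₀)) ((inB_infl hN).2 (hB i₀))
    (fun i => infl hN (S i)) fun i => by
      have := chain_infl (hL' i) (hc i)
      rwa [infl_infl, infl_infl] at this
  exact ⟨i, j, hij, h.of_pull (qHom_surjective hN)⟩

end Compact

end Blocks

section Simples

open Rp

variable {k : Type} [Field k] {G : Type} [Group G] [TopologicalSpace G]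

section Level

variable {N : OpenNormalSubgroup G} {S : Type} [AddCommGroup S] [Module k S] [Module (CGA k G) S]
  [IsScalarTower k (CGA k G) S]

lemma smul_eq_of_pr_eq (hS : ∀ x : CGA k G, pr N x = 0 → ∀ v : S, x • v = 0) {x y : CGA k G}
    (h : pr N x = pr N y) (v : S) : x • v = y • v := by
  rw [← sub_eq_zero, ← sub_smul]
  exact hS _ (by rw [map_sub, h, sub_self]) v

/-- A module of finite dimension factoring through level `N`, as a representation. -/
abbrev rpOf [FiniteDimensional k S] (hS : ∀ x : CGA k G, pr N x = 0 → ∀ v : S, x • v = 0) :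
    Rp k (G ⧸ N.toSubgroup) where
  V := S
  ρ := {
    toFun := fun q => Algebra.lsmul k k S (ofG k G (Quotient.out q))
    map_one' := LinearMap.ext fun v => by
      rw [Module.End.one_apply, ← one_smul (CGA k G) v]
      refine (smul_eq_of_pr_eq hS (x := ofG k G (Quotient.out (1 : G ⧸ N.toSubgroup)))
        (y := 1) ?_ _).trans (one_smul _ _)
      rw [pr_ofG, map_one, MonoidAlgebra.one_def]
      exact congrArg (fun q => MonoidAlgebra.single q 1) (Quotient.out_eq' _)
    map_mul' := fun q r => LinearMap.ext fun v => by
      rw [Module.End.mul_apply]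
      refine (smul_eq_of_pr_eq hS (x := ofG k G (Quotient.out (q * r)))
        (y := ofG k G (Quotient.out q) * ofG k G (Quotient.out r)) ?_ v).trans (mul_smul _ _ _)
      rw [map_mul, pr_ofG, pr_ofG, pr_ofG, MonoidAlgebra.single_mul_single, mul_one]
      refine congrArg (fun q => MonoidAlgebra.single q 1) ?_
      exact (Quotient.out_eq' _).trans (congrArg₂ _ (Quotient.out_eq' _) (Quotient.out_eq' _)).symm }

variable [FiniteDimensional k S] (hS : ∀ x : CGA k G, pr N x = 0 → ∀ v : S, x • v = 0)

lemma rpOf_act (x : CGA k G) (v : S) : (rpOf hS).act (pr N x) v = x • v := by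
  obtain ⟨a, ha⟩ : ∃ a, a = pr N x := ⟨_, rfl⟩
  rw [← ha]
  induction a using MonoidAlgebra.induction_linear generalizing x with
  | zero => rw [map_zero, hS x ha.symm]; rfl
  | add a b iha ihb =>
    obtain ⟨y, rfl⟩ := pr_surjective N a
    obtain ⟨z, rfl⟩ := pr_surjective N b
    rw [map_add, LinearMap.add_apply, iha y rfl, ihb z rfl, ← add_smul]
    exact smul_eq_of_pr_eq hS (by rw [map_add, ha]) v
  | single q c =>
    rw [act_single]
    change c • (ofG k G (Quotient.out q) • v) = _
    rw [← smul_assoc]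
    refine smul_eq_of_pr_eq hS ?_ v
    rw [← ha, map_smul, pr_ofG, MonoidAlgebra.smul_single, smul_eq_mul, mul_one]
    exact congrArg (fun q => MonoidAlgebra.single q c) (Quotient.out_eq' _)

lemma simp_rpOf (h : IsSimpleModule (CGA k G) S) : Simp (rpOf hS) := by
  refine ⟨h.nontrivial, fun W hW => ?_⟩
  let W' : Submodule (CGA k G) S := { W.toAddSubmonoid with
    smul_mem' := fun x v hv => by
      have h1 := (isHom_subtype (rpOf hS) W hW).act (pr N x) ⟨v, hv⟩
      rw [show (rpOf hS).act (pr N x) (W.subtype ⟨v, hv⟩) = x • v from rpOf_act hS x v] at h1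
      rw [← h1]
      exact Subtype.property _ }
  have hm : ∀ v, v ∈ W' ↔ v ∈ W := fun v => Iff.rfl
  rcases h.eq_bot_or_eq_top W' with h1 | h1
  · exact Or.inl (Submodule.ext fun v => by rw [← hm, h1]; exact Iff.rfl)
  · exact Or.inr (Submodule.ext fun v => by rw [← hm, h1]; exact Iff.rfl)

lemma inB_rpOf {e : CGA k G} (h : InBlock (CGA k G) (X := S) e) : InB (pr N e) (rpOf hS) :=
  LinearMap.ext fun v => (rpOf_act hS e v).trans (h v)

lemma nonempty_equiv_of_iso {T : Type} [AddCommGroup T] [Module k T] [Module (CGA k G) T]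
    [IsScalarTower k (CGA k G) T] [FiniteDimensional k T]
    (hT : ∀ x : CGA k G, pr N x = 0 → ∀ v : T, x • v = 0) (h : Iso (rpOf hS) (rpOf hT)) :
    Nonempty (S ≃ₗ[CGA k G] T) := by
  obtain ⟨φ, hφ⟩ := h
  exact ⟨{ φ with
    map_smul' := fun x v => by
      have h1 := hφ.act (pr N x) v
      rw [rpOf_act] at h1
      exact h1.trans (rpOf_act hT x (φ v)) }⟩

end Level

variable {e : CGA k G}

/-- A discrete maximal left ideal whose quotient lies in the block of `e`. -/
structure BlkMax (e : CGA k G) (m : Submodule (CGA k G) (CGA k G)) : Prop where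
  coatom : IsCoatom m
  level : ∃ N : OpenNormalSubgroup G, ∀ x : CGA k G, pr N x = 0 → x ∈ m
  block : ∀ x, e * x - x ∈ m

lemma BlkMax.isSimple {m : Submodule (CGA k G) (CGA k G)} (h : BlkMax e m) :
    IsSimpleModule (CGA k G) (CGA k G ⧸ m) := isSimpleModule_iff_isCoatom.2 h.coatom

lemma BlkMax.inBlock {m : Submodule (CGA k G) (CGA k G)} (h : BlkMax e m) :
    InBlock (CGA k G) (X := CGA k G ⧸ m) e := by
  intro x
  obtain ⟨x, rfl⟩ := Submodule.Quotient.mk_surjective _ x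
  exact (Submodule.Quotient.eq _).2 (h.block x)

lemma quot_smul_eq_zero {N : OpenNormalSubgroup G} {m : Submodule (CGA k G) (CGA k G)}
    (h : ∀ x : CGA k G, pr N x = 0 → x ∈ m) (x : CGA k G) (hx : pr N x = 0)
    (v : CGA k G ⧸ m) : x • v = 0 := by
  obtain ⟨v, rfl⟩ := Submodule.Quotient.mk_surjective _ v
  rw [← Submodule.Quotient.mk_smul, Submodule.Quotient.mk_eq_zero]
  exact h _ (by rw [smul_eq_mul, map_mul, hx, zero_mul])

section Compact

variable [IsTopologicalGroup G] [CompactSpace G]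

lemma finiteDimensional_quot {N : OpenNormalSubgroup G} {m : Submodule (CGA k G) (CGA k G)}
    (h : ∀ x : CGA k G, pr N x = 0 → x ∈ m) : FiniteDimensional k (CGA k G ⧸ m) := by
  have hker : LinearMap.ker (pr (k := k) N).toLinearMap ≤
      LinearMap.ker (m.mkQ.restrictScalars k) := fun x hx =>
    (Submodule.Quotient.mk_eq_zero m).2 (h x hx)
  have hs : Function.Surjective (pr (k := k) N).toLinearMap := pr_surjective N
  let E := (pr (k := k) N).toLinearMap.quotKerEquivOfSurjective hs
  let φ : MonoidAlgebra k (G ⧸ N.toSubgroup) →ₗ[k] CGA k G ⧸ m :=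
    (Submodule.liftQ _ (m.mkQ.restrictScalars k) hker).comp E.symm.toLinearMap
  refine Module.Finite.of_surjective φ ?_
  intro v
  obtain ⟨x, rfl⟩ := Submodule.Quotient.mk_surjective _ v
  refine ⟨pr N x, ?_⟩
  have hE : E.symm (pr N x) = Submodule.Quotient.mk x := by
    rw [LinearEquiv.symm_apply_eq]
    rfl
  change Submodule.liftQ _ (m.mkQ.restrictScalars k) hker (E.symm (pr N x)) = _
  rw [hE]
  rfl

lemma exists_common_level {ι : Type} [Finite ι] {m : ι → Submodule (CGA k G) (CGA k G)}
    (hm : ∀ i, BlkMax e (m i)) (N₀ : OpenNormalSubgroup G) :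
    ∃ N : OpenNormalSubgroup G, N ≤ N₀ ∧ ∀ i (x : CGA k G), pr N x = 0 → x ∈ m i := by
  have : Nonempty (OpenNormalSubgroup G) := ⟨N₀⟩
  choose N hN using fun i => (hm i).level
  obtain ⟨L, hL⟩ := Finite.exists_ge N
  exact ⟨L ⊓ N₀, inf_le_right, fun i x hx => hN i x (pr_ker_mono (inf_le_left.trans (hL i)) hx)⟩

theorem exists_equiv_of_block [T2Space G] [TotallyDisconnectedSpace G] [IsAlgClosed k] {p : ℕ}
    [Fact p.Prime] [CharP k p] (he : IsBlockIdem (CGA k G) e) {D : Subgroup G}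
    (hD : DefectProp k G e D) (hcyc : IsCyclicProP G p D)
    {m : Fin p → Submodule (CGA k G) (CGA k G)} (hm : ∀ i, BlkMax e (m i)) :
    ∃ i j, i ≠ j ∧ Nonempty ((CGA k G ⧸ m i) ≃ₗ[CGA k G] (CGA k G ⧸ m j)) := by
  obtain ⟨N₀, -⟩ := (hm ⟨0, (Fact.out : p.Prime).pos⟩).level
  obtain ⟨N, -, hN⟩ := exists_common_level hm N₀
  have hfd : ∀ i, FiniteDimensional k (CGA k G ⧸ m i) := fun i => finiteDimensional_quot (hN i)
  obtain ⟨i, j, hij, h⟩ := exists_iso_of_block he hD hcyc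
    (fun i => rpOf (quot_smul_eq_zero (hN i))) (fun i => simp_rpOf _ (hm i).isSimple)
    fun i => inB_rpOf _ (hm i).inBlock
  exact ⟨i, j, hij, nonempty_equiv_of_iso _ _ h⟩

/-- A finite set of representatives for the discrete simple modules of the block. -/
theorem exists_reps [T2Space G] [TotallyDisconnectedSpace G] [IsAlgClosed k] {p : ℕ}
    [Fact p.Prime] [CharP k p] (he : IsBlockIdem (CGA k G) e) {D : Subgroup G}
    (hD : DefectProp k G e D) (hcyc : IsCyclicProP G p D) :
    ∃ n ≤ p - 1, ∃ m : Fin n → Submodule (CGA k G) (CGA k G), (∀ i, BlkMax e (m i)) ∧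
      (∀ i j, i ≠ j → IsEmpty ((CGA k G ⧸ m i) ≃ₗ[CGA k G] (CGA k G ⧸ m j))) ∧
      ∀ m', BlkMax e m' → ∃ i, Nonempty ((CGA k G ⧸ m') ≃ₗ[CGA k G] (CGA k G ⧸ m i)) := by
  let P : ℕ → Prop := fun n => ∃ m : Fin n → Submodule (CGA k G) (CGA k G),
    (∀ i, BlkMax e (m i)) ∧
      ∀ i j, i ≠ j → IsEmpty ((CGA k G ⧸ m i) ≃ₗ[CGA k G] (CGA k G ⧸ m j))
  have h0 : P 0 := ⟨Fin.elim0, fun i => i.elim0, fun i => i.elim0⟩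
  have hp : ¬ P p := by
    rintro ⟨m, hm, hi⟩
    obtain ⟨i, j, hij, h⟩ := exists_equiv_of_block he hD hcyc hm
    exact not_isEmpty_iff.2 h (hi i j hij)
  obtain ⟨n, hn⟩ : ∃ n, Nat.find (⟨p, hp⟩ : ∃ n, ¬ P n) = n + 1 :=
    Nat.exists_eq_succ_of_ne_zero fun h => Nat.find_spec (⟨p, hp⟩ : ∃ n, ¬ P n) (h ▸ h0)
  have hPn : P n := not_not.1 (Nat.find_min (⟨p, hp⟩ : ∃ n, ¬ P n) (by omega))
  have hPn' : ¬ P (n + 1) := hn ▸ Nat.find_spec (⟨p, hp⟩ : ∃ n, ¬ P n)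
  have hle : Nat.find (⟨p, hp⟩ : ∃ n, ¬ P n) ≤ p := Nat.find_min' _ hp
  obtain ⟨m, hm, hi⟩ := hPn
  refine ⟨n, by omega, m, hm, hi, fun m' hm' => ?_⟩
  by_contra hne
  simp only [not_exists, not_nonempty_iff] at hne
  refine hPn' ⟨Fin.cons m' m, fun i => ?_, fun i j => ?_⟩
  · refine Fin.cases hm' (fun i => ?_) i
    exact hm i
  · refine Fin.cases ?_ (fun i => ?_) i <;> refine Fin.cases ?_ (fun j => ?_) j
    · exact fun h => (h rfl).elim
    · exact fun _ => hne j
    · exact fun _ => ⟨fun φ => (hne i).false φ.symm⟩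
    · exact fun h => hi i j fun h' => h (congrArg _ h')

end Compact

end Simples

section Radical

variable {k : Type} [Field k] {G : Type} [Group G] [TopologicalSpace G] [IsTopologicalGroup G]
  [CompactSpace G]

lemma isDedekindFinite_level (N : OpenNormalSubgroup G) :
    IsDedekindFiniteMonoid (MonoidAlgebra k (G ⧸ N.toSubgroup)) := by
  have := IsArtinianRing.of_finite k (MonoidAlgebra k (G ⧸ N.toSubgroup))
  infer_instance

/-- Invertibility in the completed group algebra is detected at the finite levels, from the left. -/
lemma isUnit_of_pr {u : CGA k G} (h : ∀ N : OpenNormalSubgroup G, ∃ a : CGA k G,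
    pr N (a * u) = 1) : IsUnit u := by
  have hd := fun N : OpenNormalSubgroup G => isDedekindFinite_level (k := k) N
  choose a ha using h
  have ha' : ∀ N, pr N (a N) * pr N u = 1 := fun N => by rw [← map_mul, ha]
  have ha2 : ∀ N, pr N u * pr N (a N) = 1 := fun N => mul_eq_one_comm.1 (ha' N)
  have hcomp : ∀ (N M : OpenNormalSubgroup G) (h : N ≤ M),
      tHom k G N M h (pr N (a N)) = pr M (a M) := by
    intro N M h
    rw [tHom_pr]
    have h1 : pr M (a N) * pr M u = 1 := by
      rw [← tHom_pr h, ← tHom_pr h, ← map_mul, ha', map_one]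
    rw [← mul_one (pr M (a N)), ← ha2 M, ← mul_assoc, h1, one_mul]
  let b : CGA k G := ⟨fun N => pr N (a N), hcomp⟩
  have hb : ∀ N, pr N b = pr N (a N) := fun _ => rfl
  refine ⟨⟨u, b, ext_pr fun N => ?_, ext_pr fun N => ?_⟩, rfl⟩
  · rw [map_mul, hb, ha2, map_one]
  · rw [map_mul, hb, ha', map_one]

variable {e : CGA k G} {ι : Type} {m : ι → Submodule (CGA k G) (CGA k G)}

/-- A discrete maximal left ideal is either in the block or contains `e`. -/
lemma blkMax_or_mem (he : IsBlockIdem (CGA k G) e) {m' : Submodule (CGA k G) (CGA k G)}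
    (hm : IsCoatom m') (hN : ∃ N : OpenNormalSubgroup G, ∀ x : CGA k G, pr N x = 0 → x ∈ m') :
    BlkMax e m' ∨ e ∈ m' := by
  have hec := Semigroup.mem_center_iff.1 he.central
  let m'' : Submodule (CGA k G) (CGA k G) :=
    { carrier := {x | e * x ∈ m'}
      add_mem' := fun {a b} ha hb => by
        rw [Set.mem_ofPred_eq, mul_add]; exact m'.add_mem ha hb
      zero_mem' := by rw [Set.mem_ofPred_eq, mul_zero]; exact m'.zero_mem
      smul_mem' := fun c x hx => by
        rw [Set.mem_ofPred_eq, smul_eq_mul, ← mul_assoc, ← hec, mul_assoc]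
        exact m'.smul_mem c hx }
  have hle : m' ≤ m'' := fun x hx => m'.smul_mem e hx
  rcases hm.le_iff.1 hle with h | h
  · right
    have h1 : (1 : CGA k G) ∈ m'' := h ▸ Submodule.mem_top
    rwa [show (1 : CGA k G) ∈ m'' ↔ e * 1 ∈ m' from Iff.rfl, mul_one] at h1
  · refine Or.inl ⟨hm, hN, fun x => ?_⟩
    rw [← h]
    change e * (e * x - x) ∈ m'
    rw [mul_sub, ← mul_assoc, he.idem.eq, sub_self]
    exact m'.zero_mem

/-- An element of the block annihilating all its discrete simple modules is quasi-regular. -/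
lemma isUnit_one_sub (he : IsBlockIdem (CGA k G) e)
    (hc : ∀ m', BlkMax e m' → ∃ i, Nonempty ((CGA k G ⧸ m') ≃ₗ[CGA k G] (CGA k G ⧸ m i)))
    {y : CGA k G} (hye : y * e = y) (hy : ∀ i, ∀ v : CGA k G ⧸ m i, y • v = 0) :
    IsUnit (1 - y) := by
  refine isUnit_of_pr fun N => ?_
  let J : Ideal (CGA k G) := Ideal.span {1 - y} ⊔ RingHom.ker (pr (k := k) N)
  by_cases hJ : J = ⊤
  · have h1 : (1 : CGA k G) ∈ J := hJ ▸ Submodule.mem_top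
    obtain ⟨b, hb, z, hz, hbz⟩ := Submodule.mem_sup.1 h1
    obtain ⟨a, rfl⟩ := Ideal.mem_span_singleton'.1 hb
    refine ⟨a, ?_⟩
    have h2 := congrArg (pr (k := k) N) hbz
    rwa [map_add, (RingHom.mem_ker).1 hz, add_zero, map_one] at h2
  · exfalso
    obtain ⟨m', hm', hle⟩ := Ideal.exists_le_maximal J hJ
    have h1y : 1 - y ∈ m' := hle (Ideal.mem_sup_left (Ideal.mem_span_singleton_self _))
    have hy' : y ∈ m' := by
      rcases blkMax_or_mem he (Ideal.isMaximal_def.1 hm')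
        ⟨N, fun x hx => hle (Ideal.mem_sup_right hx)⟩ with h | h
      · obtain ⟨i, ⟨φ⟩⟩ := hc m' h
        refine (Submodule.Quotient.mk_eq_zero m').1 (φ.injective ?_)
        rw [map_zero, ← mul_one y, ← smul_eq_mul, Submodule.Quotient.mk_smul, map_smul, hy]
      · rw [← hye]
        exact m'.mul_mem_left y h
    refine hm'.ne_top ((Ideal.eq_top_iff_one _).2 ?_)
    rw [← sub_add_cancel 1 y]
    exact m'.add_mem h1y hy'

/-- Every simple module of the block is isomorphic to one of the representatives. -/
theorem exists_equiv_of_simple (he : IsBlockIdem (CGA k G) e) {N : OpenNormalSubgroup G}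
    (hN : ∀ i (x : CGA k G), pr N x = 0 → x ∈ m i)
    (hc : ∀ m', BlkMax e m' → ∃ i, Nonempty ((CGA k G ⧸ m') ≃ₗ[CGA k G] (CGA k G ⧸ m i)))
    (S : Type) [AddCommGroup S] [Module (CGA k G) S] (hS : IsSimpleModule (CGA k G) S)
    (hB : InBlock (CGA k G) (X := S) e) : ∃ i, Nonempty (S ≃ₗ[CGA k G] (CGA k G ⧸ m i)) := by
  have hkill : ∀ x : CGA k G, pr N x = 0 → ∀ v : S, x • v = 0 := by
    intro x hx v
    by_contra h0
    obtain ⟨a, ha⟩ := IsSimpleModule.toSpanSingleton_surjective (CGA k G) h0 v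
    rw [LinearMap.toSpanSingleton_apply] at ha
    obtain ⟨u, hu⟩ := isUnit_one_sub he hc (y := a * x * e)
      (by rw [mul_assoc, he.idem.eq]) fun i w => by
        refine quot_smul_eq_zero (hN i) _ ?_ w
        rw [map_mul, map_mul, hx, mul_zero, zero_mul]
    have h1 : (u : CGA k G) • v = 0 := by
      rw [hu, sub_smul, one_smul, mul_smul, mul_smul, hB v, ha, sub_self]
    refine h0 ?_
    rw [show v = (↑u⁻¹ : CGA k G) • (u : CGA k G) • v by rw [smul_smul, Units.inv_mul, one_smul],
      h1, smul_zero, smul_zero]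
  have := hS.nontrivial
  obtain ⟨v, hv⟩ := exists_ne (0 : S)
  let φ := LinearMap.toSpanSingleton (CGA k G) S v
  have hφ : Function.Surjective φ := IsSimpleModule.toSpanSingleton_surjective (CGA k G) hv
  have hm : BlkMax e (LinearMap.ker φ) :=
    ⟨Ideal.isMaximal_def.1 (IsSimpleModule.ker_toSpanSingleton_isMaximal (CGA k G) hv),
      ⟨N, fun x hx => hkill x hx v⟩, fun x => by
        rw [LinearMap.mem_ker, LinearMap.toSpanSingleton_apply, sub_smul, mul_smul, hB, sub_self]⟩
  obtain ⟨i, ⟨ψ⟩⟩ := hc _ hm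
  exact ⟨i, ⟨(φ.quotKerEquivOfSurjective hφ).symm.trans ψ⟩⟩

/-- An element of the block annihilating all its simple modules is nilpotent at each level. -/
lemma exists_pow_pr_eq_zero (he : IsBlockIdem (CGA k G) e)
    (hc : ∀ m', BlkMax e m' → ∃ i, Nonempty ((CGA k G ⧸ m') ≃ₗ[CGA k G] (CGA k G ⧸ m i)))
    {y : CGA k G} (hye : y * e = y) (hy : ∀ i, ∀ v : CGA k G ⧸ m i, y • v = 0)
    (N : OpenNormalSubgroup G) : ∃ r, pr N y ^ r = 0 := by
  have hart := IsArtinianRing.of_finite k (MonoidAlgebra k (G ⧸ N.toSubgroup))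
  let f : ℕ →o (Ideal (MonoidAlgebra k (G ⧸ N.toSubgroup)))ᵒᵈ :=
    ⟨fun r => OrderDual.toDual (Ideal.span {pr N y ^ r}), monotone_nat_of_le_succ fun r => by
      change Ideal.span {pr N y ^ (r + 1)} ≤ Ideal.span {pr N y ^ r}
      rw [Ideal.span_singleton_le_iff_mem, pow_succ']
      exact Ideal.mul_mem_left _ _ (Ideal.mem_span_singleton_self _)⟩
  obtain ⟨r, hr⟩ := IsArtinian.monotone_stabilizes f
  have h1 : Ideal.span {pr N y ^ r} = Ideal.span {pr N y ^ (r + 1)} := hr (r + 1) (Nat.le_succ r)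
  have h2 : pr N y ^ r ∈ Ideal.span {pr N y ^ (r + 1)} := h1 ▸ Ideal.mem_span_singleton_self _
  obtain ⟨a, ha⟩ := Ideal.mem_span_singleton'.1 h2
  obtain ⟨a, rfl⟩ := pr_surjective N a
  obtain ⟨u, hu⟩ := isUnit_one_sub he hc (y := a * y) (by rw [mul_assoc, hye])
    fun i v => by rw [mul_smul, hy, smul_zero]
  refine ⟨r, ?_⟩
  have h3 : pr N u * pr N y ^ r = 0 := by
    rw [hu, map_sub, map_one, map_mul, sub_mul, one_mul, mul_assoc, ← pow_succ', ha, sub_self]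
  rw [← one_mul (pr N y ^ r), ← map_one (pr (k := k) N), ← Units.inv_mul u, map_mul, mul_assoc, h3,
    mul_zero]

end Radical

section Density

variable {k : Type} [Field k] [IsAlgClosed k] {A : Type} [Ring A] [Algebra k A]

/-- Density for a finite family of pairwise non-isomorphic finite dimensional simple modules over
an algebraically closed field. -/
lemma exists_smul_eq_linearMap {ι : Type} [Finite ι] {S : ι → Type} [∀ i, AddCommGroup (S i)]
    [∀ i, Module k (S i)] [∀ i, Module A (S i)] [∀ i, IsScalarTower k A (S i)]
    [∀ i, FiniteDimensional k (S i)] [∀ i, IsSimpleModule A (S i)]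
    (hne : ∀ i j, i ≠ j → IsEmpty (S i ≃ₗ[A] S j)) (T : ∀ i, S i →ₗ[k] S i) :
    ∃ x : A, ∀ i (v : S i), x • v = T i v := by
  have := Fintype.ofFinite ι
  have hdiag : ∀ φ : Module.End A (∀ i, S i), ∀ i, ∃ c : k, ∀ v, φ v i = c • v i := by
    intro φ i
    obtain ⟨c, hc⟩ := (IsSimpleModule.algebraMap_end_bijective_of_isAlgClosed
      (A := A) (V := S i) k).2 ((LinearMap.proj i).comp (φ.comp (LinearMap.single A S i)))
    refine ⟨c, fun v => ?_⟩
    have h1 : ∀ j, φ (Pi.single j (v j)) i = if j = i then c • v i else 0 := by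
      intro j
      split_ifs with h
      · subst h
        exact (LinearMap.congr_fun hc (v j)).symm
      · rcases LinearMap.bijective_or_eq_zero
          ((LinearMap.proj i).comp (φ.comp (LinearMap.single A S j))) with h0 | h0
        · exact ((hne j i h).false (LinearEquiv.ofBijective _ h0)).elim
        · exact LinearMap.congr_fun h0 (v j)
    conv_lhs => rw [← Finset.univ_sum_single v]
    rw [map_sum, Finset.sum_apply, Finset.sum_congr rfl fun j _ => h1 j,
      Finset.sum_ite_eq' Finset.univ i fun _ => c • v i, if_pos (Finset.mem_univ i)]
  let f : Module.End (Module.End A (∀ i, S i)) (∀ i, S i) :=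
    { toFun := fun v i => T i (v i)
      map_add' := fun v w => funext fun i => map_add (T i) _ _
      map_smul' := fun φ v => funext fun i => by
        obtain ⟨c, hc⟩ := hdiag φ i
        change T i (φ v i) = φ (fun i => T i (v i)) i
        rw [hc, hc, map_smul] }
  obtain ⟨s, hs⟩ := Module.Finite.fg_top (R := k) (M := ∀ i, S i)
  obtain ⟨x, hx⟩ := jacobson_density f s
  have hall : ∀ v : ∀ i, S i, f v = x • v := by
    intro v
    have hv : v ∈ Submodule.span k (s : Set (∀ i, S i)) := hs ▸ Submodule.mem_top
    induction hv using Submodule.span_induction with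
    | mem m hm => exact hx m hm
    | zero => rw [map_zero, smul_zero]
    | add _ _ _ _ h₁ h₂ => rw [map_add, h₁, h₂, smul_add]
    | smul c v _ h =>
      rw [smul_comm, ← h]
      exact funext fun i => map_smul (T i) c (v i)
  refine ⟨x, fun i v => ?_⟩
  have h2 := congrFun (hall (Pi.single i v)) i
  change T i (Pi.single i v i) = x • (Pi.single i v i : S i) at h2
  rw [Pi.single_eq_same] at h2
  exact h2.symm

end Density

section Lifting

variable {R : Type} [CommRing R]

open Polynomial in
lemma exists_lift_polynomial {n : ℕ} (hn : n ≠ 0) :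
    ∃ q : R[X], 1 - (1 - X ^ n) ^ n = X + q * (X - X ^ 2) := by
  obtain ⟨a, ha⟩ : (X : R[X]) ∣ 1 - (1 - X ^ n) ^ n - X := by
    rw [X_dvd_iff]
    simp [coeff_zero_eq_eval_zero, hn]
  obtain ⟨b, hb⟩ : (X - C 1 : R[X]) ∣ 1 - (1 - X ^ n) ^ n - X := by
    rw [dvd_iff_isRoot]
    simp [hn]
  refine ⟨a - b, ?_⟩
  rw [C_1] at hb
  have h : (1 - (1 - X ^ n) ^ n : R[X]) = 1 - (1 - X ^ n) ^ n - X + X := by ring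
  have h2 : (1 - (1 - X ^ n) ^ n - X : R[X]) = (a - b) * (X - X ^ 2) := by
    have e1 : (1 - (1 - X ^ n) ^ n - X : R[X]) * (1 - X) = a * (X - X ^ 2) := by rw [ha]; ring
    have e2 : (1 - (1 - X ^ n) ^ n - X : R[X]) * X = - b * (X - X ^ 2) := by rw [hb]; ring
    linear_combination e1 + e2
  rw [h, h2, add_comm]

end Lifting

section Idempotents

variable {k : Type} [Field k] {G : Type} [Group G] [TopologicalSpace G] [IsTopologicalGroup G]
  [CompactSpace G] {e : CGA k G} {ι : Type} {m : ι → Submodule (CGA k G) (CGA k G)}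

open Polynomial in
/-- Lifting an element which acts idempotently on all simple modules of the block. -/
lemma exists_idempotent_lift (he : IsBlockIdem (CGA k G) e)
    (hc : ∀ m', BlkMax e m' → ∃ i, Nonempty ((CGA k G ⧸ m') ≃ₗ[CGA k G] (CGA k G ⧸ m i)))
    {N₀ : OpenNormalSubgroup G} (hN : ∀ i (x : CGA k G), pr N₀ x = 0 → x ∈ m i)
    {x : CGA k G} (hxe : x * e = x) (hx : ∀ i, ∀ v : CGA k G ⧸ m i, x • x • v = x • v) :
    ∃ f : CGA k G, f * f = f ∧ f * e = f ∧ ∀ i, ∀ v : CGA k G ⧸ m i, f • v = x • v := by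
  have hkill : ∀ i, ∀ v : CGA k G ⧸ m i, (x - x ^ 2) • v = 0 := fun i v => by
    rw [sub_smul, sq, mul_smul, hx, sub_self]
  have hnil := exists_pow_pr_eq_zero he hc (y := x - x ^ 2)
    (by rw [sq, sub_mul, mul_assoc, hxe]) hkill
  choose r hr using hnil
  let F : ℕ → CGA k G := fun n => 1 - (1 - x ^ (n + 1)) ^ (n + 1)
  have hq : ∀ n, ∃ z, Commute z x ∧ F n = x + z * (x - x ^ 2) := by
    intro n
    obtain ⟨q, hq⟩ := exists_lift_polynomial (R := k) n.succ_ne_zero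
    refine ⟨aeval x q, ?_, ?_⟩
    · have h0 := Commute.map (Commute.all q X) (aeval x)
      rwa [aeval_X] at h0
    · have h1 := congrArg (aeval x) hq
      simpa only [map_sub, map_one, map_pow, aeval_X, map_add, map_mul] using h1
  have hpow : ∀ N, (pr N x - pr N x ^ 2) ^ (r N + 1) = 0 := fun N => by
    rw [pow_succ, ← map_pow, ← map_sub, hr, zero_mul]
  have hidem : ∀ N, IsIdempotentElem (pr N (F (r N))) := fun N => by
    have h1 := isIdempotentElem_one_sub_one_sub_pow_pow (pr N x) (r N + 1) (hpow N)
    simpa only [F, map_sub, map_one, map_pow] using h1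
  have hcomp : ∀ (N M : OpenNormalSubgroup G) (h : N ≤ M),
      tHom k G N M h (pr N (F (r N))) = pr M (F (r M)) := by
    intro N M h
    obtain ⟨z, hz, hz'⟩ := hq (r N)
    obtain ⟨w, hw, hw'⟩ := hq (r M)
    have hzy : Commute z (x - x ^ 2) := hz.sub_right (hz.pow_right 2)
    have hwy : Commute w (x - x ^ 2) := hw.sub_right (hw.pow_right 2)
    rw [tHom_pr]
    refine eq_of_isNilpotent_sub_of_isIdempotentElem_of_commute ?_ (hidem M) ?_ ?_
    · have h1 := (hidem N).map (tHom k G N M h)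
      rwa [tHom_pr] at h1
    · refine ⟨r M, ?_⟩
      rw [← map_sub, ← map_pow, hz', hw', add_sub_add_left_eq_sub, ← sub_mul,
        (hzy.sub_left hwy).mul_pow, map_mul, map_pow (pr M) (x - x ^ 2), hr, mul_zero]
    · refine Commute.map ?_ (pr M)
      have hF : ∀ n, Commute x (F n) := fun n =>
        (Commute.one_right x).sub_right
          (((Commute.one_right x).sub_right ((Commute.refl x).pow_right _)).pow_right _)
      exact (Commute.one_left _).sub_left
        (((Commute.one_left _).sub_left ((hF _).pow_left _)).pow_left _)
  let f : CGA k G := ⟨fun N => pr N (F (r N)), hcomp⟩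
  have hf : ∀ N, pr N f = pr N (F (r N)) := fun _ => rfl
  refine ⟨f, ext_pr fun N => ?_, ext_pr fun N => ?_, fun i v => ?_⟩
  · rw [map_mul, hf]; exact hidem N
  · obtain ⟨z, hz, hz'⟩ := hq (r N)
    rw [map_mul, hf, ← map_mul, hz', add_mul, mul_assoc, sub_mul, sq, mul_assoc x x e, hxe]
  · obtain ⟨z, hz, hz'⟩ := hq (r N₀)
    have h1 : f • v = F (r N₀) • v := by
      rw [← sub_eq_zero, ← sub_smul]
      exact quot_smul_eq_zero (hN i) _ (by rw [map_sub, hf, sub_self]) v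
    rw [h1, hz', add_smul, mul_smul, hkill, smul_zero, add_zero]

/-- `f` is an idempotent of the block acting as a projection onto the line through `v₀` on the
`i`-th simple module and as zero on the others. -/
structure IsPrimFor (e : CGA k G) (m : ι → Submodule (CGA k G) (CGA k G)) (i : ι) (f : CGA k G)
    (v₀ : CGA k G ⧸ m i) : Prop where
  idem : f * f = f
  block : f * e = f
  ne_zero : v₀ ≠ 0
  fix : f • v₀ = v₀
  line : ∀ v : CGA k G ⧸ m i, ∃ c : k, f • v = c • v₀
  kill : ∀ j, j ≠ i → ∀ v : CGA k G ⧸ m j, f • v = 0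

theorem exists_isPrimFor [IsAlgClosed k] [Finite ι] (he : IsBlockIdem (CGA k G) e)
    (hm : ∀ i, BlkMax e (m i))
    (hne : ∀ i j, i ≠ j → IsEmpty ((CGA k G ⧸ m i) ≃ₗ[CGA k G] (CGA k G ⧸ m j)))
    (hc : ∀ m', BlkMax e m' → ∃ i, Nonempty ((CGA k G ⧸ m') ≃ₗ[CGA k G] (CGA k G ⧸ m i)))
    {N₀ : OpenNormalSubgroup G} (hN : ∀ i (x : CGA k G), pr N₀ x = 0 → x ∈ m i) (i : ι) :
    ∃ (f : CGA k G) (v₀ : CGA k G ⧸ m i), IsPrimFor e m i f v₀ := by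
  have hfd : ∀ j, FiniteDimensional k (CGA k G ⧸ m j) := fun j => finiteDimensional_quot (hN j)
  have hs : ∀ j, IsSimpleModule (CGA k G) (CGA k G ⧸ m j) := fun j => (hm j).isSimple
  have := (hs i).nontrivial
  obtain ⟨v₀, hv₀⟩ := exists_ne (0 : CGA k G ⧸ m i)
  obtain ⟨l, hl⟩ := Module.Projective.exists_dual_eq_one k hv₀
  obtain ⟨x, hx⟩ := exists_smul_eq_linearMap (k := k) hne
    (Pi.single i (l.smulRight v₀) : ∀ j, (CGA k G ⧸ m j) →ₗ[k] (CGA k G ⧸ m j))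
  have hxi : ∀ v : CGA k G ⧸ m i, x • v = l v • v₀ := fun v => by
    rw [hx, Pi.single_eq_same, LinearMap.smulRight_apply]
  have hxj : ∀ j, j ≠ i → ∀ v : CGA k G ⧸ m j, x • v = 0 := fun j hj v => by
    rw [hx, Pi.single_eq_of_ne hj, LinearMap.zero_apply]
  have hxe : ∀ j, ∀ v : CGA k G ⧸ m j, (x * e) • v = x • v := fun j v => by
    rw [mul_smul, (hm j).inBlock]
  obtain ⟨f, hff, hfe, hf⟩ := exists_idempotent_lift he hc hN (x := x * e)
    (by rw [mul_assoc, he.idem.eq]) fun j v => by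
      rw [hxe, hxe]
      by_cases hj : j = i
      · subst hj
        rw [hxi, hxi, map_smul, hl, smul_eq_mul, mul_one]
      · rw [hxj j hj, hxj j hj]
  refine ⟨f, v₀, hff, hfe, hv₀, ?_, fun v => ⟨l v, ?_⟩, fun j hj v => ?_⟩
  · rw [hf, hxe, hxi, hl, one_smul]
  · rw [hf, hxe, hxi]
  · rw [hf, hxe, hxj j hj]

variable {i : ι} {f : CGA k G} {v₀ : CGA k G ⧸ m i}

/-- An element of `f k⟦G⟧ f` acting nontrivially on the simple module is invertible there. -/
lemma IsPrimFor.exists_inv (hf : IsPrimFor e m i f v₀) (he : IsBlockIdem (CGA k G) e)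
    (hc : ∀ m', BlkMax e m' → ∃ i, Nonempty ((CGA k G ⧸ m') ≃ₗ[CGA k G] (CGA k G ⧸ m i)))
    {u : CGA k G} (hfu : f * u = u) (huf : u * f = u) {c : k} (hc0 : c ≠ 0)
    (hu : u • v₀ = c • v₀) : ∃ w, w * f = w ∧ w * u = f ∧ u * w = f := by
  let y := f - c⁻¹ • u
  have hyf : y * f = y := by
    rw [sub_mul, hf.idem, smul_mul_assoc, huf]
  have hfy : f * y = y := by
    rw [mul_sub, hf.idem, mul_smul_comm, hfu]
  obtain ⟨t, ht⟩ := isUnit_one_sub he hc (y := y)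
    (by rw [← hyf, mul_assoc, hf.block]) fun j v => by
      rw [← hyf, mul_smul]
      by_cases hj : j = i
      · subst hj
        obtain ⟨a, ha⟩ := hf.line v
        rw [ha, smul_comm, sub_smul, hf.fix, smul_assoc, hu, smul_smul, inv_mul_cancel₀ hc0,
          one_smul, sub_self, smul_zero]
      · rw [hf.kill j hj, smul_zero]
  have h1 : f * t = c⁻¹ • u := by rw [ht, mul_sub, mul_one, hfy, sub_sub_cancel]
  have h2 : (t : CGA k G) * f = c⁻¹ • u := by rw [ht, sub_mul, one_mul, hyf, sub_sub_cancel]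
  refine ⟨c⁻¹ • (f * ↑t⁻¹ * f), ?_, ?_, ?_⟩
  · rw [smul_mul_assoc, mul_assoc, hf.idem]
  · rw [smul_mul_assoc, mul_assoc, hfu, ← mul_smul_comm, ← h2, mul_assoc, ← mul_assoc _ (t : CGA k G),
      Units.inv_mul, one_mul, hf.idem]
  · rw [mul_smul_comm, ← smul_mul_assoc, ← mul_assoc, ← mul_assoc, smul_mul_assoc, huf, ← h1,
      mul_assoc f, Units.mul_inv, mul_one, hf.idem]

end Idempotents

section PseudocompactFamilies

variable {k : Type} [Field k] {A : Type} [Ring A] [Algebra k A] {X : Type} [AddCommGroup X]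
  [Module k X] [Module A X] [IsScalarTower k A X]

lemma mapQ'_id_mk {V W : Submodule A X} (h : V ≤ W) (x : X) :
    mapQ' V W LinearMap.id (Submodule.Quotient.mk x) = Submodule.Quotient.mk x := by
  have h' : V ≤ W.comap LinearMap.id := h
  rw [mapQ', dif_pos h', Submodule.mapQ_apply, LinearMap.id_apply]

lemma finiteDimensional_quot_of_ker_le {Y : Type} [AddCommGroup Y] [Module k Y]
    [FiniteDimensional k Y] (l : X →ₗ[k] Y) {V : Submodule k X} (h : LinearMap.ker l ≤ V) :
    FiniteDimensional k (X ⧸ V) := by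
  have h1 : FiniteDimensional k (X ⧸ LinearMap.ker l) :=
    Module.Finite.equiv l.quotKerEquivRange.symm
  exact Module.Finite.of_surjective _ (Submodule.factor_surjective h)

variable [TopologicalSpace A] [TopologicalSpace X]

/-- Pseudocompactness can be checked on a fundamental system of open submodules. -/
lemma isPseudocompactMod_of_family (t2 : T2Space X) (ag : IsTopologicalAddGroup X)
    (cs : ContinuousSMul A X) {I : Type} [Preorder I] (V : I → Submodule A X) (hmono : Monotone V)
    (hopen : ∀ i, IsOpen (V i : Set X))
    (hfin : ∀ i, FiniteDimensional k (X ⧸ (V i).restrictScalars k))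
    (hbasis : ∀ U ∈ nhds (0 : X), ∃ i, (V i : Set X) ⊆ U)
    (hcomp : ∀ c : I → X, (∀ i j, i ≤ j → c i - c j ∈ V j) → ∃ x, ∀ i, x - c i ∈ V i) :
    IsPseudocompactMod k A X where
  t2 := t2
  addGroup := ag
  contSMul := cs
  basis := ⟨fun U => ⟨fun hU => (hbasis U hU).elim fun i hi => ⟨V i, ⟨hopen i, hfin i⟩, hi⟩,
    fun ⟨W, hW, hWU⟩ => Filter.mem_of_superset (hW.1.mem_nhds W.zero_mem) hWU⟩⟩
  inf_bot := by
    refine (Submodule.eq_bot_iff _).2 fun x hx => ?_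
    by_contra hx0
    obtain ⟨i, hi⟩ := hbasis {x}ᶜ (isOpen_compl_singleton.mem_nhds (Ne.symm hx0))
    have h1 : x ∈ V i := by
      rw [Submodule.mem_iInf] at hx
      exact (Submodule.mem_iInf _).1 (hx (V i)) ⟨hopen i, hfin i⟩
    exact hi h1 rfl
  complete := by
    intro c hc
    have hex : ∀ i, ∃ x : X, c ⟨V i, hopen i, hfin i⟩ = Submodule.Quotient.mk x := fun i =>
      (Submodule.Quotient.mk_surjective _ _).imp fun _ h => h.symm
    choose d hd using hex
    obtain ⟨x, hx⟩ := hcomp d fun i j hij => by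
      rw [← Submodule.Quotient.eq, ← hd j, ← hc ⟨V i, hopen i, hfin i⟩ ⟨V j, hopen j, hfin j⟩ (hmono hij), hd i]
      exact (mapQ'_id_mk (hmono hij) _).symm
    refine ⟨x, fun W => ?_⟩
    obtain ⟨i, hi⟩ := hbasis W.1 (W.2.1.mem_nhds W.1.zero_mem)
    rw [← hc ⟨V i, hopen i, hfin i⟩ W hi, hd i, ← (Submodule.Quotient.eq _).2 (hx i)]
    exact mapQ'_id_mk hi x

/-- Completeness of a pseudocompact module, in terms of elements. -/
lemma IsPseudocompactMod.exists_limit (hX : IsPseudocompactMod k A X) {U : Submodule A X}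
    (hU : IsOpen (U : Set X)) (hUf : FiniteDimensional k (X ⧸ U.restrictScalars k))
    (c : {V : Submodule A X // (IsOpen (V : Set X) ∧
      FiniteDimensional k (X ⧸ V.restrictScalars k)) ∧ V ≤ U} → X)
    (hc : ∀ V W, V.1 ≤ W.1 → c V - c W ∈ W.1) : ∃ x, ∀ V, x - c V ∈ V.1 := by
  have hinf : ∀ V : Submodule A X, FiniteDimensional k (X ⧸ V.restrictScalars k) →
      FiniteDimensional k (X ⧸ (V ⊓ U).restrictScalars k) := fun V hV =>
    finiteDimensional_quot_of_ker_le
      (((V.restrictScalars k).mkQ).prod ((U.restrictScalars k).mkQ)) fun x hx => by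
        rw [LinearMap.ker_prod, Submodule.ker_mkQ, Submodule.ker_mkQ] at hx
        exact hx
  let t : {V : Submodule A X // IsOpen (V : Set X) ∧
      FiniteDimensional k (X ⧸ V.restrictScalars k)} →
    {V : Submodule A X // (IsOpen (V : Set X) ∧
      FiniteDimensional k (X ⧸ V.restrictScalars k)) ∧ V ≤ U} :=
    fun V => ⟨V.1 ⊓ U, ⟨V.2.1.inter hU, hinf V.1 V.2.2⟩, inf_le_right⟩
  obtain ⟨x, hx⟩ := hX.complete (fun V => Submodule.Quotient.mk (c (t V))) fun V W h => by
    rw [mapQ'_id_mk h, Submodule.Quotient.eq]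
    exact (hc (t V) (t W) (inf_le_inf_right U h)).1
  refine ⟨x, fun V => ?_⟩
  have h1 := hx ⟨V.1, V.2.1⟩
  have h2 : t ⟨V.1, V.2.1⟩ = V := Subtype.ext (inf_eq_left.2 V.2.2)
  rw [h2] at h1
  exact (Submodule.Quotient.eq _).1 h1.symm

end PseudocompactFamilies

section Product

variable {k : Type} [Field k] {G : Type} [Group G] [TopologicalSpace G]

instance instDiscreteTopologyMonoidAlgebra (X : Type) : DiscreteTopology (MonoidAlgebra k X) := ⟨rfl⟩

instance instT2SpaceCGA : T2Space (CGA k G) :=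
  inferInstanceAs (T2Space (Subtype _))

instance instIsTopologicalRingCGA : IsTopologicalRing (CGA k G) :=
  inferInstanceAs (IsTopologicalRing (CGA k G).toSubring)

lemma continuous_pr (N : OpenNormalSubgroup G) : Continuous (pr (k := k) N) :=
  (continuous_apply N).comp continuous_subtype_val

lemma exists_pr_ker_subset {U : Set (CGA k G)} (hU : U ∈ nhds (0 : CGA k G))
    (N₀ : OpenNormalSubgroup G) :
    ∃ N : OpenNormalSubgroup G, ∀ x : CGA k G, pr N x = 0 → x ∈ U := by
  obtain ⟨V, hV, hVU⟩ := mem_nhds_subtype _ _ _ |>.1 hU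
  rw [nhds_pi, Filter.mem_pi] at hV
  obtain ⟨I, hI, t, ht, htV⟩ := hV
  obtain ⟨N, hN⟩ : ∃ N : OpenNormalSubgroup G, ∀ M ∈ I, N ≤ M := by
    clear htV
    induction I, hI using Set.Finite.induction_on with
    | empty => exact ⟨N₀, fun M hM => hM.elim⟩
    | insert _ _ ih =>
      obtain ⟨N, hN⟩ := ih
      exact ⟨N ⊓ _, Set.forall_mem_insert.2 ⟨inf_le_right, fun M hM => inf_le_left.trans (hN M hM)⟩⟩
  refine ⟨N, fun x hx => hVU (htV fun M hM => ?_)⟩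
  have h1 : x.1 M = 0 := pr_ker_mono (hN M hM) hx
  rw [h1]
  exact mem_of_mem_nhds (ht M)

variable [IsTopologicalGroup G] [CompactSpace G]

/-- The product of an open submodule of a pseudocompact module with `k⟦G⟧` is pseudocompact. -/
lemma isPseudocompactMod_prod {P : Type} [AddCommGroup P] [Module k P] [Module (CGA k G) P]
    [IsScalarTower k (CGA k G) P] [TopologicalSpace P] (hP : IsPseudocompactMod k (CGA k G) P)
    {U : Submodule (CGA k G) P} (hU : IsOpen (U : Set P))
    (hUf : FiniteDimensional k (P ⧸ U.restrictScalars k)) :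
    IsPseudocompactMod k (CGA k G) (U × CGA k G) := by
  have := hP.t2
  have := hP.addGroup
  have := hP.contSMul
  let I := {V : Submodule (CGA k G) P // (IsOpen (V : Set P) ∧
      FiniteDimensional k (P ⧸ V.restrictScalars k)) ∧ V ≤ U}
  let N₀ : OpenNormalSubgroup G := { toSubgroup := ⊤, isOpen' := isOpen_univ }
  have hN₀ : ∀ N, N ≤ N₀ := fun N x _ => trivial
  let U₀ : I := ⟨U, ⟨hU, hUf⟩, le_rfl⟩
  refine isPseudocompactMod_of_family inferInstance inferInstance inferInstance
    (I := I × OpenNormalSubgroup G)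
    (fun i => (i.1.1.comap U.subtype).prod (RingHom.ker (pr (k := k) i.2)))
    (fun i j hij => Submodule.prod_mono (Submodule.comap_mono (Prod.le_def.1 hij).1)
      fun x hx => pr_ker_mono (Prod.le_def.1 hij).2 hx)
    (fun i => (i.1.2.1.1.preimage continuous_subtype_val).prod
      ((isOpen_discrete {0}).preimage (continuous_pr i.2)))
    (fun i => ?_) (fun W hW => ?_) (fun c hc => ?_)
  · have := i.1.2.1.2
    have hfin : FiniteDimensional k (MonoidAlgebra k (G ⧸ i.2.toSubgroup)) := inferInstance
    refine finiteDimensional_quot_of_ker_le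
      (LinearMap.prodMap ((i.1.1.restrictScalars k).mkQ.comp (U.restrictScalars k).subtype)
        (pr (k := k) i.2).toLinearMap) fun x hx => ?_
    rw [LinearMap.mem_ker, LinearMap.prodMap_apply, Prod.mk_eq_zero] at hx
    exact ⟨(Submodule.Quotient.mk_eq_zero (i.1.1.restrictScalars k)).1 hx.1, hx.2⟩
  · obtain ⟨W₁, hW₁, W₂, hW₂, hW'⟩ := mem_nhds_prod_iff.1 (show W ∈ nhds ((0 : U), (0 : CGA k G)) from hW)
    obtain ⟨N, hN⟩ := exists_pr_ker_subset hW₂ N₀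
    obtain ⟨W₃, hW₃, hW₃'⟩ := mem_nhds_subtype _ _ _ |>.1 hW₁
    obtain ⟨V, hV, hVW⟩ := hP.basis.mem_iff.1
      (Filter.inter_mem hW₃ (hU.mem_nhds U.zero_mem))
    exact ⟨(⟨V, hV, fun x hx => (hVW hx).2⟩, N), fun x hx =>
      hW' ⟨hW₃' (hVW hx.1).1, hN _ hx.2⟩⟩
  · have hc1 : ∀ (V : I) N, (c (V, N) - c (V, N₀)).1.1 ∈ V.1 := fun V N =>
      (hc (V, N) (V, N₀) ⟨le_rfl, hN₀ N⟩).1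
    have hc2 : ∀ (V : I) N, pr N ((c (V, N)).2 - (c (U₀, N)).2) = 0 := fun V N =>
      (hc (V, N) (U₀, N) ⟨V.2.2, le_rfl⟩).2
    obtain ⟨x, hx⟩ := hP.exists_limit hU hUf (fun V => (c (V, N₀)).1.1) fun V W h =>
      (hc (V, N₀) (W, N₀) ⟨h, le_rfl⟩).1
    have hxU : x ∈ U := (Submodule.sub_mem_iff_left U (c (U₀, N₀)).1.2).1 (hx U₀)
    let b : CGA k G := ⟨fun N => pr N (c (U₀, N)).2, fun N M h => by
      have h1 : pr M ((c (U₀, N)).2 - (c (U₀, M)).2) = 0 := (hc (U₀, N) (U₀, M) ⟨le_rfl, h⟩).2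
      rw [map_sub, sub_eq_zero] at h1
      exact (tHom_pr h _).trans h1⟩
    have hb : ∀ N, pr N b = pr N (c (U₀, N)).2 := fun _ => rfl
    refine ⟨(⟨x, hxU⟩, b), fun i => ⟨?_, ?_⟩⟩
    · have h1 := i.1.1.sub_mem (hx i.1) (hc1 i.1 i.2)
      have h2 : x - (c (i.1, N₀)).1.1 - (c (i.1, i.2) - c (i.1, N₀)).1.1 = x - (c i).1.1 := by
        change x - (c (i.1, N₀)).1.1 - ((c (i.1, i.2)).1.1 - (c (i.1, N₀)).1.1) = x - (c i).1.1
        abel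
      rw [h2] at h1
      exact h1
    · have h1 := hc2 i.1 i.2
      change pr i.2 (b - (c i).2) = 0
      rw [map_sub, hb, sub_eq_zero]
      rw [map_sub, sub_eq_zero] at h1
      exact h1.symm

end Product

section Projectives

variable {k : Type} [Field k] {G : Type} [Group G] [TopologicalSpace G]

/-- The left ideal `k⟦G⟧f` of an idempotent `f`. -/
def leftIdeal (f : CGA k G) : Submodule (CGA k G) (CGA k G) where
  carrier := {a | a * f = a}
  add_mem' {a b} ha hb := (add_mul a b f).trans (congrArg₂ _ ha hb)
  zero_mem' := zero_mul f
  smul_mem' c a ha := (mul_assoc c a f).trans (congrArg _ ha)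

lemma mem_leftIdeal {f a : CGA k G} : a ∈ leftIdeal f ↔ a * f = a := Iff.rfl

lemma isPCProjective_leftIdeal {f : CGA k G} (hf : f * f = f) :
    IsPCProjective k G (leftIdeal f) := by
  intro W _ _ _ _ _ hW F _ hF
  have := hW.contSMul
  obtain ⟨w, hw⟩ := hF ⟨f, hf⟩
  refine ⟨(LinearMap.toSpanSingleton (CGA k G) W w).comp (leftIdeal f).subtype,
    continuous_subtype_val.smul continuous_const, LinearMap.ext fun a => ?_⟩
  change F (a.1 • w) = a
  rw [map_smul, hw]
  exact Subtype.ext a.2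

variable [IsTopologicalGroup G] [CompactSpace G] {e : CGA k G} {ι : Type}
  {m : ι → Submodule (CGA k G) (CGA k G)} {i : ι} {f : CGA k G} {v₀ : CGA k G ⧸ m i}

lemma IsPrimFor.inBlock (hf : IsPrimFor e m i f v₀) (he : IsBlockIdem (CGA k G) e) :
    InBlock (CGA k G) (X := leftIdeal f) e := by
  intro a
  refine Subtype.ext ?_
  have hec := Semigroup.mem_center_iff.1 he.central
  change e * a.1 = a.1
  rw [← hec, ← mem_leftIdeal.1 a.2, mul_assoc, hf.block]

lemma IsPrimFor.isIndecTop (hf : IsPrimFor e m i f v₀) (he : IsBlockIdem (CGA k G) e)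
    (hc : ∀ m', BlkMax e m' → ∃ i, Nonempty ((CGA k G ⧸ m') ≃ₗ[CGA k G] (CGA k G ⧸ m i))) :
    IsIndecTop (CGA k G) (leftIdeal f) := by
  have key : ∀ W W' : Submodule (CGA k G) (leftIdeal f), IsCompl W W' →
      ∀ a ∈ W, ∀ b ∈ W', a.1 + b.1 = f → a.1 • v₀ ≠ 0 → W' = ⊥ := by
    intro W W' hW a ha b hb hab hav
    have hfa : f * a.1 = a.1 := by
      have h1 : f • a - a = b - f • b := by
        refine Subtype.ext ?_
        change f * a.1 - a.1 = b.1 - f * b.1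
        rw [sub_eq_sub_iff_add_eq_add, ← mul_add, hab, hf.idem, add_comm, hab]
      have h2 : f • a - a ∈ W ⊓ W' := ⟨W.sub_mem (W.smul_mem f ha) ha,
        h1 ▸ W'.sub_mem hb (W'.smul_mem f hb)⟩
      rw [hW.inf_eq_bot, Submodule.mem_bot, sub_eq_zero] at h2
      exact congrArg Subtype.val h2
    obtain ⟨c, hca⟩ := hf.line (a.1 • v₀)
    rw [← mul_smul, hfa] at hca
    obtain ⟨w, -, hw, -⟩ := hf.exists_inv he hc hfa a.2
      (fun h0 => hav (by rw [hca, h0, zero_smul])) hca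
    have htop : W = ⊤ := by
      refine (Submodule.eq_top_iff'.2 fun x => ?_)
      have h3 : x = (x.1 * w) • a := by
        refine Subtype.ext ?_
        change x.1 = x.1 * w * a.1
        rw [mul_assoc, hw]
        exact x.2.symm
      rw [h3]
      exact W.smul_mem _ ha
    rw [← top_inf_eq W', ← htop, hW.inf_eq_bot]
  constructor
  · refine ⟨⟨⟨f, hf.idem⟩, 0, fun h => hf.ne_zero ?_⟩⟩
    have h1 : f = 0 := congrArg Subtype.val h
    rw [← hf.fix, h1, zero_smul]
  · intro W W' _ _ hW
    have hmem : (⟨f, hf.idem⟩ : leftIdeal f) ∈ W ⊔ W' := by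
      rw [hW.sup_eq_top]; exact Submodule.mem_top
    obtain ⟨a, ha, b, hb, hab⟩ := Submodule.mem_sup.1 hmem
    have hab' : a.1 + b.1 = f := congrArg Subtype.val hab
    by_cases hav : a.1 • v₀ = 0
    · refine Or.inl (key W' W hW.symm b hb a ha (by rw [add_comm, hab']) fun hbv => hf.ne_zero ?_)
      rw [← hf.fix, ← hab', add_smul, hav, hbv, add_zero]
    · exact Or.inr (key W W' hW a ha b hb hab' hav)

variable {P : Type} [AddCommGroup P] [Module k P] [Module (CGA k G) P]
  [IsScalarTower k (CGA k G) P] [TopologicalSpace P]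

/-- A nonzero pseudocompact module has a discrete simple quotient. -/
lemma exists_isCoatom_isOpen (hP : IsPseudocompactMod k (CGA k G) P) [Nontrivial P] :
    ∃ U : Submodule (CGA k G) P, IsCoatom U ∧ IsOpen (U : Set P) ∧
      FiniteDimensional k (P ⧸ U.restrictScalars k) := by
  have := hP.addGroup
  obtain ⟨V, hV, hne⟩ : ∃ V : Submodule (CGA k G) P, (IsOpen (V : Set P) ∧
      FiniteDimensional k (P ⧸ V.restrictScalars k)) ∧ V ≠ ⊤ := by
    by_contra! hall
    refine bot_ne_top (α := Submodule (CGA k G) P) ?_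
    rw [← hP.inf_bot]
    exact iInf₂_eq_top.2 hall
  have hfd' := hV.2
  have hfd : FiniteDimensional k (P ⧸ V) := hV.2
  have hnoeth : IsNoetherian (CGA k G) (P ⧸ V) := isNoetherian_of_tower k inferInstance
  have hnt : Nontrivial (P ⧸ V) := Submodule.Quotient.nontrivial_iff.2 hne
  obtain ⟨M, hM, -⟩ := (eq_top_or_exists_le_coatom (⊥ : Submodule (CGA k G) (P ⧸ V))).resolve_left
    bot_ne_top
  have hle : V ≤ M.comap V.mkQ := fun x hx => by
    rw [Submodule.mem_comap, Submodule.mkQ_apply, (Submodule.Quotient.mk_eq_zero V).2 hx]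
    exact M.zero_mem
  refine ⟨M.comap V.mkQ, ?_, AddSubgroup.isOpen_mono (H₁ := V.toAddSubgroup)
    (H₂ := (M.comap V.mkQ).toAddSubgroup) hle hV.1,
    finiteDimensional_quot_of_ker_le ((V.restrictScalars k).mkQ) ?_⟩
  · have := isSimpleModule_iff_isCoatom.2 hM
    have h1 : LinearMap.ker (M.mkQ.comp V.mkQ) = M.comap V.mkQ := by
      rw [LinearMap.ker_comp, Submodule.ker_mkQ]
    rw [← h1, ← isSimpleModule_iff_isCoatom]
    exact IsSimpleModule.congr ((M.mkQ.comp V.mkQ).quotKerEquivOfSurjective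
      ((Submodule.mkQ_surjective M).comp (Submodule.mkQ_surjective V)))
  · rwa [Submodule.ker_mkQ]

/-- An indecomposable projective of the block with a given simple quotient is isomorphic to the
corresponding left ideal. -/
theorem IsPrimFor.nonempty_equiv (hf : IsPrimFor e m i f v₀) (he : IsBlockIdem (CGA k G) e)
    (hc : ∀ m', BlkMax e m' → ∃ i, Nonempty ((CGA k G ⧸ m') ≃ₗ[CGA k G] (CGA k G ⧸ m i)))
    (hm : IsSimpleModule (CGA k G) (CGA k G ⧸ m i))
    (hP : IsPseudocompactMod k (CGA k G) P) (hproj : IsPCProjective k G P)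
    (hind : IsIndecTop (CGA k G) P) (π : P →ₗ[CGA k G] (CGA k G ⧸ m i))
    (hπ : Function.Surjective π) (hopen : IsOpen (LinearMap.ker π : Set P))
    (hfin : FiniteDimensional k (P ⧸ (LinearMap.ker π).restrictScalars k)) :
    Nonempty (P ≃ₗ[CGA k G] leftIdeal f) := by
  have := hP.t2
  have := hP.addGroup
  have := hP.contSMul
  obtain ⟨p₀, hp₀⟩ := hπ v₀
  obtain ⟨x₀, hfx₀, hπx₀⟩ : ∃ x₀ : P, f • x₀ = x₀ ∧ π x₀ = v₀ :=
    ⟨f • p₀, by rw [smul_smul, hf.idem], by rw [map_smul, hp₀, hf.fix]⟩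
  let F : (LinearMap.ker π × CGA k G) →ₗ[CGA k G] P :=
    (LinearMap.ker π).subtype.coprod (LinearMap.toSpanSingleton (CGA k G) P x₀)
  have hF : ∀ z, F z = z.1.1 + z.2 • x₀ := fun z => rfl
  have hFc : Continuous F :=
    (continuous_subtype_val.comp continuous_fst).add (continuous_snd.smul continuous_const)
  have hFs : Function.Surjective F := by
    intro x
    obtain ⟨a, ha⟩ := IsSimpleModule.toSpanSingleton_surjective (CGA k G) hf.ne_zero (π x)
    rw [LinearMap.toSpanSingleton_apply] at ha
    refine ⟨(⟨x - a • x₀, ?_⟩, a), ?_⟩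
    · rw [LinearMap.mem_ker, map_sub, map_smul, hπx₀, ha, sub_self]
    · rw [hF]
      exact sub_add_cancel _ _
  obtain ⟨s, hsc, hs⟩ := hproj _ (isPseudocompactMod_prod hP hopen hfin) F hFc hFs
  let b : P →ₗ[CGA k G] CGA k G := (LinearMap.snd _ _ _).comp s
  have hbc : Continuous b := continuous_snd.comp hsc
  have hb : b x₀ • v₀ = v₀ := by
    have h1 : F (s x₀) = x₀ := LinearMap.congr_fun hs x₀
    have h2 := congrArg π h1
    rw [hF, map_add, map_smul, hπx₀, LinearMap.mem_ker.1 (s x₀).1.2, zero_add] at h2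
    exact h2
  have hfb : f * b x₀ = b x₀ := by rw [← smul_eq_mul, ← map_smul, hfx₀]
  obtain ⟨w, hwf, -, hw⟩ := hf.exists_inv he hc (u := b x₀ * f)
    (by rw [← mul_assoc, hfb]) (by rw [mul_assoc, hf.idem]) (one_ne_zero (α := k))
    (by rw [mul_smul, hf.fix, hb, one_smul])
  let h : P →ₗ[CGA k G] CGA k G := (LinearMap.toSpanSingleton _ _ (f * w)).comp b
  have hh : ∀ x, h x = b x * (f * w) := fun x => rfl
  have hhc : Continuous h := hbc.mul continuous_const
  have hx₀ : h x₀ = f := by rw [hh, ← mul_assoc, hw]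
  have hhf : ∀ x, h x * f = h x := fun x => by rw [hh, mul_assoc, mul_assoc, hwf]
  have hmem : ∀ x, h x ∈ leftIdeal f := hhf
  let W : Submodule (CGA k G) P := LinearMap.eqLocus ((LinearMap.toSpanSingleton _ _ x₀).comp h)
    LinearMap.id
  have hW : ∀ x, x ∈ W ↔ h x • x₀ = x := fun _ => Iff.rfl
  have hhx : ∀ a, h (a • x₀) = a * f := fun a => by rw [map_smul, hx₀, smul_eq_mul]
  have hcompl : IsCompl (LinearMap.ker h) W := by
    refine IsCompl.of_eq ((Submodule.eq_bot_iff _).2 fun x hx => ?_)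
      (Submodule.eq_top_iff'.2 fun x => ?_)
    · rw [← (hW x).1 hx.2, LinearMap.mem_ker.1 hx.1, zero_smul]
    · rw [← sub_add_cancel x (h x • x₀)]
      refine Submodule.add_mem_sup ?_ ((hW _).2 ?_)
      · rw [LinearMap.mem_ker, map_sub, hhx, hhf, sub_self]
      · rw [hhx, hhf]
  have hker : LinearMap.ker h = ⊥ := by
    refine (hind.2 _ _ (isClosed_singleton.preimage hhc)
      (isClosed_eq (hhc.smul continuous_const) continuous_id) hcompl).resolve_right fun h0 => ?_
    have h1 : x₀ ∈ W := (hW x₀).2 (by rw [hx₀, hfx₀])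
    rw [h0, Submodule.mem_bot] at h1
    rw [h1, map_zero] at hπx₀
    exact hf.ne_zero hπx₀.symm
  refine ⟨LinearEquiv.ofBijective (h.codRestrict (leftIdeal f) hmem) ⟨?_, fun a => ?_⟩⟩
  · rw [← LinearMap.ker_eq_bot, LinearMap.ker_codRestrict, hker]
  · exact ⟨a.1 • x₀, Subtype.ext ((hhx a.1).trans a.2)⟩

/-- Every indecomposable pseudocompact projective of the block is one of the left ideals attached
to the simple modules. -/
theorem exists_equiv_leftIdeal (he : IsBlockIdem (CGA k G) e) (hm : ∀ i, BlkMax e (m i))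
    (hc : ∀ m', BlkMax e m' → ∃ i, Nonempty ((CGA k G ⧸ m') ≃ₗ[CGA k G] (CGA k G ⧸ m i)))
    {N₀ : OpenNormalSubgroup G} (hN : ∀ i (x : CGA k G), pr N₀ x = 0 → x ∈ m i)
    {f : ι → CGA k G} {v₀ : ∀ i, CGA k G ⧸ m i} (hf : ∀ i, IsPrimFor e m i (f i) (v₀ i))
    (hP : IsPseudocompactMod k (CGA k G) P) (hproj : IsPCProjective k G P)
    (hind : IsIndecTop (CGA k G) P) (hB : InBlock (CGA k G) (X := P) e) :
    ∃ i, Nonempty (P ≃ₗ[CGA k G] leftIdeal (f i)) := by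
  have := hind.1
  obtain ⟨U, hU, hopen, hfin⟩ := exists_isCoatom_isOpen hP
  obtain ⟨i, ⟨φ⟩⟩ := exists_equiv_of_simple he hN hc (P ⧸ U) (isSimpleModule_iff_isCoatom.2 hU)
    fun x => by
      obtain ⟨x, rfl⟩ := Submodule.Quotient.mk_surjective _ x
      rw [← Submodule.Quotient.mk_smul, hB x]
  have hker : LinearMap.ker (φ.toLinearMap.comp U.mkQ) = U := by
    rw [LinearEquiv.ker_comp, Submodule.ker_mkQ]
  exact ⟨i, (hf i).nonempty_equiv he hc (hm i).isSimple hP hproj hind (φ.toLinearMap.comp U.mkQ)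
    (φ.surjective.comp (Submodule.mkQ_surjective U)) (by rw [hker]; exact hopen)
    (by rw [hker]; exact hfin)⟩

end Projectives

/-- Lemma 3.1: a block of `k⟦G⟧` with non-trivial cyclic defect
group has only finitely many (at most `p - 1`) isomorphism classes of simple
modules, and hence only finitely many isomorphism classes of indecomposable
projective modules. -/
theorem finitely_many_simples_of_cyclic_defect
    (p : ℕ) [Fact p.Prime] (k : Type) [Field k] [CharP k p] [IsAlgClosed k]
    (G : Type) [Group G] [TopologicalSpace G] [IsTopologicalGroup G]
    [CompactSpace G] [TotallyDisconnectedSpace G] [T2Space G]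
    (e : CGA k G) (he : IsBlockIdem (CGA k G) e)
    (D : Subgroup G) (hD : IsDefectGroup k G e D)
    (hcyc : IsCyclicProP G p D) (hnt : D ≠ ⊥) :
    (∃ n : ℕ, n ≤ p - 1 ∧ ∃ m : Fin n → Submodule (CGA k G) (CGA k G),
      (∀ i, IsSimpleModule (CGA k G) ((CGA k G) ⧸ m i) ∧
        InBlock (CGA k G) (X := (CGA k G) ⧸ m i) e) ∧
      (∀ i j, i ≠ j →
        IsEmpty (((CGA k G) ⧸ m i) ≃ₗ[CGA k G] ((CGA k G) ⧸ m j))) ∧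
      (∀ (S : Type) [AddCommGroup S] [Module (CGA k G) S],
        IsSimpleModule (CGA k G) S → InBlock (CGA k G) (X := S) e →
          ∃ i, Nonempty (S ≃ₗ[CGA k G] ((CGA k G) ⧸ m i)))) ∧
    (∃ (nP : ℕ) (Q : Fin nP → Submodule (CGA k G) (CGA k G)),
      (∀ i, IsPCProjective k G (Q i) ∧ IsIndecTop (CGA k G) (Q i) ∧
        InBlock (CGA k G) (X := Q i) e) ∧
      (∀ (P : Type) [AddCommGroup P] [Module k P] [Module (CGA k G) P]
          [IsScalarTower k (CGA k G) P] [TopologicalSpace P],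
        IsPseudocompactMod k (CGA k G) P → IsPCProjective k G P →
          IsIndecTop (CGA k G) P → InBlock (CGA k G) (X := P) e →
            ∃ i, Nonempty (P ≃ₗ[CGA k G] (Q i)))) := by
  obtain ⟨n, hn, m, hm, hne, hc⟩ := exists_reps he hD.defect hcyc
  obtain ⟨N, -, hN⟩ := exists_common_level hm { toSubgroup := ⊤, isOpen' := isOpen_univ }
  choose f v₀ hf using exists_isPrimFor he hm hne hc hN
  exact ⟨⟨n, hn, m, fun i => ⟨(hm i).isSimple, (hm i).inBlock⟩, hne,
      fun S _ _ => exists_equiv_of_simple he hN hc S⟩,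
    n, fun i => leftIdeal (f i), fun i => ⟨isPCProjective_leftIdeal (hf i).idem,
      (hf i).isIndecTop he hc, (hf i).inBlock he⟩,
    fun P _ _ _ _ _ hP hproj hind hB => exists_equiv_leftIdeal he hm hc hN hf hP hproj hind hB⟩

end ProfiniteBlocks
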